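/- Computational adequacy: in a functional EPTS, for Γ, A with Γ ⊢ A type, let T = U_A if A is a top-sort and T = El_{s_A} ⟦A⟧ otherwise (Γ ⊢ A : s_A). Then the maps ⟦·⟧ and |·| define a bijection between the set of EPTS terms M with Γ ⊢ M : A and the quotient by ≡_H of the set of Dedukti terms in β-normal form N with ⟦Γ⟧ ⊢ N : T. The bijection is compositional (⟦·⟧ commutes with substitution) and computational (M reduces to N in the EPTS iff ⟦M⟧ reduces to ⟦N⟧ in Dedukti); moreover every Dedukti term M with ⟦Γ⟧ ⊢ M : T has a β-normal form. -/

import Mathlib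

namespace DKPaper

inductive Tm (C : Type) : Type
  | var : Nat → Tm C
  | const : C → List (Tm C) → Tm C
  | type : Tm C
  | kind : Tm C
  | app : Tm C → Tm C → Tm C
  | lam : Tm C → Tm C → Tm C
  | pi : Tm C → Tm C → Tm C

namespace Tm
variable {C : Type}

def liftRen (ρ : Nat → Nat) : Nat → Nat
  | 0 => 0
  | n + 1 => ρ n + 1

def ren (ρ : Nat → Nat) : Tm C → Tm C
  | var n => var (ρ n)
  | const c Ms => const c (Ms.attach.map fun x => ren ρ x.1)
  | type => type
  | kind => kind
  | app M N => app (ren ρ M) (ren ρ N)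
  | lam A M => lam (ren ρ A) (ren (liftRen ρ) M)
  | pi A B => pi (ren ρ A) (ren (liftRen ρ) B)
termination_by t => sizeOf t
decreasing_by
  all_goals simp_wf
  all_goals try omega
  all_goals (have h := List.sizeOf_lt_of_mem x.2; omega)

def liftSub (σ : Nat → Tm C) : Nat → Tm C
  | 0 => var 0
  | n + 1 => ren Nat.succ (σ n)

def sub (σ : Nat → Tm C) : Tm C → Tm C
  | var n => σ n
  | const c Ms => const c (Ms.attach.map fun x => sub σ x.1)
  | type => type
  | kind => kind
  | app M N => app (sub σ M) (sub σ N)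
  | lam A M => lam (sub σ A) (sub (liftSub σ) M)
  | pi A B => pi (sub σ A) (sub (liftSub σ) B)
termination_by t => sizeOf t
decreasing_by
  all_goals simp_wf
  all_goals try omega
  all_goals (have h := List.sizeOf_lt_of_mem x.2; omega)

/-- Substitution of `N` for the variable of de Bruijn index `k` (the usual `M{N/x}`). -/
def substAt (k : Nat) (N : Tm C) : Tm C → Tm C :=
  sub fun n => if n < k then var n else if n = k then ren (· + k) N else var (n - 1)

end Tm

/-! ## Signatures, rewrite rules, rewriting -/

/-- An entry `c[Δ] : A` of a signature: head constant, telescope (in declaration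
order, each entry a type under the previous ones), and the type. -/
abbrev Sig (C : Type) := Set (C × List (Tm C) × Tm C)

/-- A rewrite rule `c[l⃗] ↪ r`: head constant, list of left-hand side argument
patterns (free de Bruijn variables are the pattern variables), right-hand side. -/
abbrev Rules (C : Type) := Set (C × List (Tm C) × Tm C)

variable {C : Type}

/-- Closure of a root relation under all term-forming contexts. -/
inductive Cong (r : Tm C → Tm C → Prop) : Tm C → Tm C → Prop
  | base {M N} : r M N → Cong r M N
  | appL {M M' N} : Cong r M M' → Cong r (.app M N) (.app M' N)
  | appR {M N N'} : Cong r N N' → Cong r (.app M N) (.app M N')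
  | lamA {A A' M} : Cong r A A' → Cong r (.lam A M) (.lam A' M)
  | lamM {A M M'} : Cong r M M' → Cong r (.lam A M) (.lam A M')
  | piA {A A' B} : Cong r A A' → Cong r (.pi A B) (.pi A' B)
  | piB {A B B'} : Cong r B B' → Cong r (.pi A B) (.pi A B')
  | constArg {c l₁ M M' l₂} : Cong r M M' →
      Cong r (.const c (l₁ ++ M :: l₂)) (.const c (l₁ ++ M' :: l₂))

/-- Root β-reduction. -/
def BetaRoot : Tm C → Tm C → Prop := fun M N =>
  ∃ A P Q, M = .app (.lam A P) Q ∧ N = Tm.substAt 0 Q P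

/-- Root reduction by a rule of `R`: a substitution instance of some rule. -/
def RuleRoot (R : Rules C) : Tm C → Tm C → Prop := fun M N =>
  ∃ rl ∈ R, ∃ σ : Nat → Tm C,
    M = Tm.sub σ (.const rl.1 rl.2.1) ∧ N = Tm.sub σ rl.2.2

/-- One-step β-reduction `↪_β`. -/
def Beta : Tm C → Tm C → Prop := Cong BetaRoot

/-- One-step reduction by the rules of `R` only (no β). -/
def RStep (R : Rules C) : Tm C → Tm C → Prop := Cong (RuleRoot R)

/-- One-step reduction `↪_{β𝓡}`. -/
def Step (R : Rules C) : Tm C → Tm C → Prop :=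
  Cong (fun M N => BetaRoot M N ∨ RuleRoot R M N)

/-- The conversion `≡_{β𝓡}` generated by `↪_{β𝓡}`. -/
def Conv (R : Rules C) : Tm C → Tm C → Prop := Relation.EqvGen (Step R)

/-- Confluence of an abstract reduction relation. -/
def Confluent {α : Type _} (r : α → α → Prop) : Prop :=
  ∀ a b c, Relation.ReflTransGen r a b → Relation.ReflTransGen r a c →
    ∃ d, Relation.ReflTransGen r b d ∧ Relation.ReflTransGen r c d

/-- `M` is in β-normal form. -/
def BetaNormal (M : Tm C) : Prop := ∀ N, ¬ Beta M N

/-- Strong normalization of a relation at a point: no infinite `r`-sequence starts at `a`. -/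
def SN {α : Type _} (r : α → α → Prop) (a : α) : Prop := Acc (fun x y => r y x) a


/-! ## Dedukti typing -/

/-- `IsDKSort s` means `s` is `TYPE` or `KIND`. -/
def IsDKSort (s : Tm C) : Prop := s = Tm.type ∨ s = Tm.kind

/-- `A{M⃗}`: simultaneous instantiation of the telescope variables by the arguments. -/
def instArgs (Ms : List (Tm C)) (A : Tm C) : Tm C :=
  Tm.sub (fun n => Ms.reverse.getD n (Tm.var (n - Ms.length))) A

/-- Instantiate the first variable of the (remaining) telescope `Δ` with `M`. -/
def instTele (M : Tm C) (Δ : List (Tm C)) : List (Tm C) :=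
  Δ.mapIdx fun i B => Tm.substAt i M B

mutual
/-- Well-formed contexts `Σ;Γ well-formed` (de Bruijn: last declaration first). -/
inductive Wf (S : Sig C) (R : Rules C) : List (Tm C) → Prop
  | empty : Wf S R []
  | decl {Γ A} : Typed S R Γ A Tm.type → Wf S R (A :: Γ)

/-- The Dedukti typing judgment `Σ;Γ ⊢ M : A`. -/
inductive Typed (S : Sig C) (R : Rules C) : List (Tm C) → Tm C → Tm C → Prop
  | sort {Γ} : Wf S R Γ → Typed S R Γ Tm.type Tm.kind
  | var {Γ n A} : Wf S R Γ → Γ[n]? = some A →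
      Typed S R Γ (Tm.var n) (Tm.ren (· + (n + 1)) A)
  | cons {Γ c Δ A s Ms} : (c, Δ, A) ∈ S → Typed S R Δ.reverse A s → IsDKSort s →
      TypedArgs S R Γ Ms Δ → Typed S R Γ (Tm.const c Ms) (instArgs Ms A)
  | conv {Γ M A B s} : Typed S R Γ M A → Typed S R Γ B s → IsDKSort s →
      Conv R A B → Typed S R Γ M B
  | prod {Γ A B s} : Typed S R Γ A Tm.type → Typed S R (A :: Γ) B s → IsDKSort s →
      Typed S R Γ (Tm.pi A B) s
  | abs {Γ A B s M} : Typed S R Γ A Tm.type → Typed S R (A :: Γ) B s → IsDKSort s →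
      Typed S R (A :: Γ) M B → Typed S R Γ (Tm.lam A M) (Tm.pi A B)
  | app {Γ M N A B} : Typed S R Γ M (Tm.pi A B) → Typed S R Γ N A →
      Typed S R Γ (Tm.app M N) (Tm.substAt 0 N B)

/-- `Σ;Γ ⊢ M⃗ : Δ`: the arguments fit the telescope. -/
inductive TypedArgs (S : Sig C) (R : Rules C) : List (Tm C) → List (Tm C) → List (Tm C) → Prop
  | nil {Γ} : TypedArgs S R Γ [] []
  | cons {Γ M Ms A Δ} : Typed S R Γ M A → TypedArgs S R Γ Ms (instTele M Δ) →
      TypedArgs S R Γ (M :: Ms) (A :: Δ)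
end

/-! ## Type-level and object-level constants, syntactic classes -/

/-- Types of the form `Πx⃗:B⃗.TYPE`. -/
inductive IsKindShape : Tm C → Prop
  | type : IsKindShape Tm.type
  | pi {A K} : IsKindShape K → IsKindShape (Tm.pi A K)

/-- `c` is a type-level constant of the signature `S`. -/
def TypeLevel (S : Sig C) (c : C) : Prop := ∃ Δ A, (c, Δ, A) ∈ S ∧ IsKindShape A

/-- `c` is an object-level constant of the signature `S`: it is declared, and not type-level. -/
def ObjLevel (S : Sig C) (c : C) : Prop := (∃ Δ A, (c, Δ, A) ∈ S) ∧ ¬ TypeLevel S c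

mutual
/-- Kinds: `K ::= TYPE | Πx:T.K`. -/
inductive IsKind (S : Sig C) : Tm C → Prop
  | type : IsKind S Tm.type
  | pi {T K} : IsTypeFam S T → IsKind S K → IsKind S (Tm.pi T K)

/-- Type families: `T ::= α[O⃗] | T O | λx:T.T | Πx:T.T` with `α` type-level. -/
inductive IsTypeFam (S : Sig C) : Tm C → Prop
  | const {c Os} : TypeLevel S c → (∀ O ∈ Os, IsObj S O) → IsTypeFam S (Tm.const c Os)
  | app {T O} : IsTypeFam S T → IsObj S O → IsTypeFam S (Tm.app T O)
  | lam {T₁ T₂} : IsTypeFam S T₁ → IsTypeFam S T₂ → IsTypeFam S (Tm.lam T₁ T₂)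
  | pi {T₁ T₂} : IsTypeFam S T₁ → IsTypeFam S T₂ → IsTypeFam S (Tm.pi T₁ T₂)

/-- Objects: `O ::= x | a[O⃗] | O O | λx:T.O` with `a` object-level. -/
inductive IsObj (S : Sig C) : Tm C → Prop
  | var {n} : IsObj S (Tm.var n)
  | const {c Os} : ObjLevel S c → (∀ O ∈ Os, IsObj S O) → IsObj S (Tm.const c Os)
  | app {O₁ O₂} : IsObj S O₁ → IsObj S O₂ → IsObj S (Tm.app O₁ O₂)
  | lam {T O} : IsTypeFam S T → IsObj S O → IsObj S (Tm.lam T O)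
end

mutual
/-- Pre-kinds: `L ::= TYPE | Πx:R.L`. -/
inductive PreKind (S : Sig C) : Tm C → Prop
  | type : PreKind S Tm.type
  | pi {R L} : PreTypeFam S R → PreKind S L → PreKind S (Tm.pi R L)

/-- Pre-type families: `R ::= α[M⃗] | R N | λx:A.R | Πx:R.R` with `α` type-level
and `M⃗`, `N`, `A` arbitrary. -/
inductive PreTypeFam (S : Sig C) : Tm C → Prop
  | const {c Ms} : TypeLevel S c → PreTypeFam S (Tm.const c Ms)
  | app {R N} : PreTypeFam S R → PreTypeFam S (Tm.app R N)
  | lam {A R} : PreTypeFam S R → PreTypeFam S (Tm.lam A R)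
  | pi {R₁ R₂} : PreTypeFam S R₁ → PreTypeFam S R₂ → PreTypeFam S (Tm.pi R₁ R₂)
end

/-- A rewrite rule is type-level when its head constant is type-level. -/
def TypeLevelRule (S : Sig C) (rl : C × List (Tm C) × Tm C) : Prop := TypeLevel S rl.1

/-- The grammar `R ::= α[M⃗] | R N | λx:A.R` used to define arity preservation. -/
inductive APShape (S : Sig C) : Tm C → Prop
  | const {c Ms} : TypeLevel S c → APShape S (Tm.const c Ms)
  | app {R N} : APShape S R → APShape S (Tm.app R N)
  | lam {A R} : APShape S R → APShape S (Tm.lam A R)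

/-- `𝓡` is arity preserving (w.r.t. `Σ`). -/
def ArityPreserving (S : Sig C) (R : Rules C) : Prop :=
  ∀ rl ∈ R, TypeLevelRule S rl → APShape S rl.2.2

/-- `𝓡` is well-formed (w.r.t. `Σ`): right-hand sides of type-level rules are in
the grammar `R ::= α[M⃗] | R N | λx:B.R | Πx:R.R`. -/
def RulesWellFormed (S : Sig C) (R : Rules C) : Prop :=
  ∀ rl ∈ R, TypeLevelRule S rl → PreTypeFam S rl.2.2

/-! ## Simple types and the erasure maps -/

/-- Simple types `σ ::= * | σ → σ`. -/
inductive STy : Type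
  | star : STy
  | arr : STy → STy → STy
deriving DecidableEq

open Classical in
/-- The partial type erasure `⌈·⌉` from Dedukti terms to simple types. -/
noncomputable def tyErase (S : Sig C) : Tm C → Option STy
  | Tm.type => some STy.star
  | Tm.const c _ => if TypeLevel S c then some STy.star else none
  | Tm.pi A B => do return STy.arr (← tyErase S A) (← tyErase S B)
  | Tm.app A _ => tyErase S A
  | Tm.lam _ B => tyErase S B
  | Tm.var _ => none
  | Tm.kind => none

/-- Untyped λ-terms with constants in `K` (the target of the term erasure). -/
inductive LTm (K : Type) : Type
  | var : Nat → LTm K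
  | const : K → LTm K
  | app : LTm K → LTm K → LTm K
  | lam : LTm K → LTm K

namespace LTm
variable {K : Type}

def liftRen' (ρ : Nat → Nat) : Nat → Nat
  | 0 => 0
  | n + 1 => ρ n + 1

def ren (ρ : Nat → Nat) : LTm K → LTm K
  | var n => var (ρ n)
  | const k => const k
  | app M N => app (ren ρ M) (ren ρ N)
  | lam M => lam (ren (liftRen' ρ) M)

/-- Shift free variables `≥ d` up by one. -/
def shiftAbove (d : Nat) : LTm K → LTm K :=
  ren fun n => if n < d then n else n + 1

def liftSub (σ : Nat → LTm K) : Nat → LTm K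
  | 0 => var 0
  | n + 1 => ren Nat.succ (σ n)

def sub (σ : Nat → LTm K) : LTm K → LTm K
  | var n => σ n
  | const k => const k
  | app M N => app (sub σ M) (sub σ N)
  | lam M => lam (sub (liftSub σ) M)

/-- Substitution `M{N/x}` for the variable of index `k`. -/
def substAt (k : Nat) (N : LTm K) : LTm K → LTm K :=
  sub fun n => if n < k then var n else if n = k then ren (· + k) N else var (n - 1)

end LTm

/-- β-reduction for the (simply-typed) λ-calculus. -/
inductive LBeta {K : Type} : LTm K → LTm K → Prop
  | red {M N} : LBeta (LTm.app (LTm.lam M) N) (LTm.substAt 0 N M)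
  | appL {M M' N} : LBeta M M' → LBeta (LTm.app M N) (LTm.app M' N)
  | appR {M N N'} : LBeta N N' → LBeta (LTm.app M N) (LTm.app M N')
  | lam {M M'} : LBeta M M' → LBeta (LTm.lam M) (LTm.lam M')

/-- The partial term erasure `|·|` from Dedukti terms into the λ-calculus with
constants `C ⊕ STy` (`Sum.inr σ` being the constant `π_σ`). -/
noncomputable def erase (S : Sig C) : Tm C → Option (LTm (C ⊕ STy))
  | Tm.var n => some (LTm.var n)
  | Tm.const c Ms => do
      let ts ← Ms.attach.mapM fun x => erase S x.1
      return ts.foldl LTm.app (LTm.const (Sum.inl c))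
  | Tm.app M N => do return LTm.app (← erase S M) (← erase S N)
  | Tm.lam A M => do
      return LTm.app (LTm.lam (LTm.lam (LTm.shiftAbove 1 (← erase S M)))) (← erase S A)
  | Tm.pi A B => do
      return LTm.app (LTm.app (LTm.const (Sum.inr (← tyErase S A))) (← erase S A))
        (LTm.lam (← erase S B))
  | Tm.type => none
  | Tm.kind => none
termination_by t => sizeOf t
decreasing_by
  all_goals simp_wf
  all_goals try omega
  all_goals (have h := List.sizeOf_lt_of_mem x.2; omega)

/-- The type `* → (σ → *) → *` of the constant `π_σ`. -/
def piConstTy (σ : STy) : STy := STy.arr STy.star (STy.arr (STy.arr σ STy.star) STy.star)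

/-- `⌈A₁⌉ → ... → ⌈Aₙ⌉ → ⌈A⌉`, as a relation (defined when all erasures are). -/
inductive EraseTele (S : Sig C) : List (Tm C) → Tm C → STy → Prop
  | nil {A σ} : tyErase S A = some σ → EraseTele S [] A σ
  | cons {B Δ A τ σ} : tyErase S B = some τ → EraseTele S Δ A σ →
      EraseTele S (B :: Δ) A (STy.arr τ σ)

/-- The simply-typed constant context `Γ_π, ⌈Σ'⌉`: it declares `π_σ : * → (σ → *) → *`
for every simple type `σ`, and `c : ⌈A₁⌉ → ... → ⌈Aₙ⌉ → ⌈A⌉` for every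
declaration `c[x₁:A₁,...,xₙ:Aₙ] : A` of `Σ'` (erasures being taken w.r.t. `S`). -/
inductive ConstTy (S : Sig C) (S' : Sig C) : C ⊕ STy → STy → Prop
  | piConst (σ : STy) : ConstTy S S' (Sum.inr σ) (piConstTy σ)
  | const {c Δ A σ} : (c, Δ, A) ∈ S' → EraseTele S Δ A σ → ConstTy S S' (Sum.inl c) σ

/-- Typing in the simply-typed λ-calculus, with constants typed by `cty`. -/
inductive STTyped {K : Type} (cty : K → STy → Prop) : List STy → LTm K → STy → Prop
  | var {Γ n σ} : Γ[n]? = some σ → STTyped cty Γ (LTm.var n) σ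
  | const {Γ k σ} : cty k σ → STTyped cty Γ (LTm.const k) σ
  | app {Γ M N σ τ} : STTyped cty Γ M (STy.arr σ τ) → STTyped cty Γ N σ →
      STTyped cty Γ (LTm.app M N) τ
  | lam {Γ M σ τ} : STTyped cty (σ :: Γ) M τ → STTyped cty Γ (LTm.lam M) (STy.arr σ τ)

/-! ## Explicitly-typed Pure Type Systems (EPTS) -/

/-- EPTS terms (de Bruijn): `x | s | Π_{s₁,s₂}(A,[x]B) | λ_{s₁,s₂}(A,[x]B,[x]M) |
@_{s₁,s₂}(A,[x]B,M,N)`. -/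
inductive ETm (S : Type) : Type
  | var : Nat → ETm S
  | sort : S → ETm S
  | pi : S → S → ETm S → ETm S → ETm S
  | lam : S → S → ETm S → ETm S → ETm S → ETm S
  | app : S → S → ETm S → ETm S → ETm S → ETm S → ETm S

namespace ETm
variable {S : Type}

def ren (ρ : Nat → Nat) : ETm S → ETm S
  | var n => var (ρ n)
  | sort s => sort s
  | pi s₁ s₂ A B => pi s₁ s₂ (ren ρ A) (ren (Tm.liftRen ρ) B)
  | lam s₁ s₂ A B M => lam s₁ s₂ (ren ρ A) (ren (Tm.liftRen ρ) B) (ren (Tm.liftRen ρ) M)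
  | app s₁ s₂ A B M N => app s₁ s₂ (ren ρ A) (ren (Tm.liftRen ρ) B) (ren ρ M) (ren ρ N)

def liftSub (σ : Nat → ETm S) : Nat → ETm S
  | 0 => var 0
  | n + 1 => ren Nat.succ (σ n)

def sub (σ : Nat → ETm S) : ETm S → ETm S
  | var n => σ n
  | sort s => sort s
  | pi s₁ s₂ A B => pi s₁ s₂ (sub σ A) (sub (liftSub σ) B)
  | lam s₁ s₂ A B M => lam s₁ s₂ (sub σ A) (sub (liftSub σ) B) (sub (liftSub σ) M)
  | app s₁ s₂ A B M N => app s₁ s₂ (sub σ A) (sub (liftSub σ) B) (sub σ M) (sub σ N)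

/-- Substitution `M{N/x}` for the variable of de Bruijn index `k`. -/
def substAt (k : Nat) (N : ETm S) : ETm S → ETm S :=
  sub fun n => if n < k then var n else if n = k then ren (· + k) N else var (n - 1)

end ETm

variable {S : Type}

/-- Closure of a root relation under all EPTS term-forming contexts. -/
inductive ECong (r : ETm S → ETm S → Prop) : ETm S → ETm S → Prop
  | base {M N} : r M N → ECong r M N
  | piA {s₁ s₂ A A' B} : ECong r A A' → ECong r (.pi s₁ s₂ A B) (.pi s₁ s₂ A' B)
  | piB {s₁ s₂ A B B'} : ECong r B B' → ECong r (.pi s₁ s₂ A B) (.pi s₁ s₂ A B')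
  | lamA {s₁ s₂ A A' B M} : ECong r A A' → ECong r (.lam s₁ s₂ A B M) (.lam s₁ s₂ A' B M)
  | lamB {s₁ s₂ A B B' M} : ECong r B B' → ECong r (.lam s₁ s₂ A B M) (.lam s₁ s₂ A B' M)
  | lamM {s₁ s₂ A B M M'} : ECong r M M' → ECong r (.lam s₁ s₂ A B M) (.lam s₁ s₂ A B M')
  | appA {s₁ s₂ A A' B M N} : ECong r A A' → ECong r (.app s₁ s₂ A B M N) (.app s₁ s₂ A' B M N)
  | appB {s₁ s₂ A B B' M N} : ECong r B B' → ECong r (.app s₁ s₂ A B M N) (.app s₁ s₂ A B' M N)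
  | appM {s₁ s₂ A B M M' N} : ECong r M M' → ECong r (.app s₁ s₂ A B M N) (.app s₁ s₂ A B M' N)
  | appN {s₁ s₂ A B M N N'} : ECong r N N' → ECong r (.app s₁ s₂ A B M N) (.app s₁ s₂ A B M N')

/-- Root β-reduction of the EPTS (linearized rule, one instance per `(s₁,s₂,s₃) ∈ ℛ`):
`@_{s₁,s₂}(A,[x]B, λ_{s₁,s₂}(A',[x]B',[x]M), N) ↪ M{N/x}`. -/
def EBetaRoot (Rrel : S → S → S → Prop) : ETm S → ETm S → Prop := fun M N =>
  ∃ s₁ s₂ s₃ A B A' B' P Q, Rrel s₁ s₂ s₃ ∧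
    M = ETm.app s₁ s₂ A B (ETm.lam s₁ s₂ A' B' P) Q ∧ N = ETm.substAt 0 Q P

/-- One-step EPTS reduction. -/
def EStep (Rrel : S → S → S → Prop) : ETm S → ETm S → Prop := ECong (EBetaRoot Rrel)

/-- EPTS conversion `≡`. -/
def EConv (Rrel : S → S → S → Prop) : ETm S → ETm S → Prop := Relation.EqvGen (EStep Rrel)

mutual
/-- Well-formed EPTS contexts. -/
inductive EWf (Ar : S → S → Prop) (Rr : S → S → S → Prop) : List (ETm S) → Prop
  | empty : EWf Ar Rr []
  | decl {Γ A s} : ETyped Ar Rr Γ A (ETm.sort s) → EWf Ar Rr (A :: Γ)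

/-- The EPTS typing judgment `Γ ⊢ M : A`. -/
inductive ETyped (Ar : S → S → Prop) (Rr : S → S → S → Prop) : List (ETm S) → ETm S → ETm S → Prop
  | sort {Γ s₁ s₂} : EWf Ar Rr Γ → Ar s₁ s₂ → ETyped Ar Rr Γ (ETm.sort s₁) (ETm.sort s₂)
  | var {Γ n A} : EWf Ar Rr Γ → Γ[n]? = some A →
      ETyped Ar Rr Γ (ETm.var n) (ETm.ren (· + (n + 1)) A)
  | conv {Γ M A B s} : ETyped Ar Rr Γ M A → ETyped Ar Rr Γ B (ETm.sort s) →
      EConv Rr A B → ETyped Ar Rr Γ M B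
  | pi {Γ s₁ s₂ s₃ A B} : Rr s₁ s₂ s₃ → ETyped Ar Rr Γ A (ETm.sort s₁) →
      ETyped Ar Rr (A :: Γ) B (ETm.sort s₂) →
      ETyped Ar Rr Γ (ETm.pi s₁ s₂ A B) (ETm.sort s₃)
  | lam {Γ s₁ s₂ s₃ A B M} : Rr s₁ s₂ s₃ → ETyped Ar Rr Γ A (ETm.sort s₁) →
      ETyped Ar Rr (A :: Γ) B (ETm.sort s₂) → ETyped Ar Rr (A :: Γ) M B →
      ETyped Ar Rr Γ (ETm.lam s₁ s₂ A B M) (ETm.pi s₁ s₂ A B)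
  | app {Γ s₁ s₂ s₃ A B M N} : Rr s₁ s₂ s₃ → ETyped Ar Rr Γ A (ETm.sort s₁) →
      ETyped Ar Rr (A :: Γ) B (ETm.sort s₂) → ETyped Ar Rr Γ N A →
      ETyped Ar Rr Γ M (ETm.pi s₁ s₂ A B) →
      ETyped Ar Rr Γ (ETm.app s₁ s₂ A B M N) (ETm.substAt 0 N B)
end

/-- `𝒜` and `ℛ` are functional relations. -/
def FunctionalSpec (Ar : S → S → Prop) (Rr : S → S → S → Prop) : Prop :=
  (∀ s t t', Ar s t → Ar s t' → t = t') ∧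
  (∀ s₁ s₂ t t', Rr s₁ s₂ t → Rr s₁ s₂ t' → t = t')

/-- `s` is a top-sort. -/
def IsTopSort (Ar : S → S → Prop) (s : S) : Prop := ¬ ∃ s', Ar s s'

/-- `Γ ⊢ A type`: `A` is a sort, or `Γ ⊢ A : s` for some sort `s`. -/
def ETypeJ (Ar : S → S → Prop) (Rr : S → S → S → Prop) (Γ : List (ETm S)) (A : ETm S) : Prop :=
  (∃ s, A = ETm.sort s) ∨ ∃ s, ETyped Ar Rr Γ A (ETm.sort s)

/-! ## (Implicit) Pure Type Systems -/

/-- PTS terms. -/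
inductive PTm (S : Type) : Type
  | var : Nat → PTm S
  | sort : S → PTm S
  | pi : PTm S → PTm S → PTm S
  | lam : PTm S → PTm S → PTm S
  | app : PTm S → PTm S → PTm S

namespace PTm
variable {S : Type}

def ren (ρ : Nat → Nat) : PTm S → PTm S
  | var n => var (ρ n)
  | sort s => sort s
  | pi A B => pi (ren ρ A) (ren (Tm.liftRen ρ) B)
  | lam A M => lam (ren ρ A) (ren (Tm.liftRen ρ) M)
  | app M N => app (ren ρ M) (ren ρ N)

def liftSub (σ : Nat → PTm S) : Nat → PTm S
  | 0 => var 0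
  | n + 1 => ren Nat.succ (σ n)

def sub (σ : Nat → PTm S) : PTm S → PTm S
  | var n => σ n
  | sort s => sort s
  | pi A B => pi (sub σ A) (sub (liftSub σ) B)
  | lam A M => lam (sub σ A) (sub (liftSub σ) M)
  | app M N => app (sub σ M) (sub σ N)

def substAt (k : Nat) (N : PTm S) : PTm S → PTm S :=
  sub fun n => if n < k then var n else if n = k then ren (· + k) N else var (n - 1)

end PTm

/-- One-step β-reduction of PTS terms. -/
inductive PBeta : PTm S → PTm S → Prop
  | red {A M N} : PBeta (PTm.app (PTm.lam A M) N) (PTm.substAt 0 N M)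
  | piA {A A' B} : PBeta A A' → PBeta (PTm.pi A B) (PTm.pi A' B)
  | piB {A B B'} : PBeta B B' → PBeta (PTm.pi A B) (PTm.pi A B')
  | lamA {A A' M} : PBeta A A' → PBeta (PTm.lam A M) (PTm.lam A' M)
  | lamM {A M M'} : PBeta M M' → PBeta (PTm.lam A M) (PTm.lam A M')
  | appL {M M' N} : PBeta M M' → PBeta (PTm.app M N) (PTm.app M' N)
  | appR {M N N'} : PBeta N N' → PBeta (PTm.app M N) (PTm.app M N')

/-- PTS conversion. -/
def PConv : PTm S → PTm S → Prop := Relation.EqvGen PBeta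

mutual
/-- Well-formed PTS contexts. -/
inductive PWf (Ar : S → S → Prop) (Rr : S → S → S → Prop) : List (PTm S) → Prop
  | empty : PWf Ar Rr []
  | decl {Γ A s} : PTyped Ar Rr Γ A (PTm.sort s) → PWf Ar Rr (A :: Γ)

/-- The PTS typing judgment. -/
inductive PTyped (Ar : S → S → Prop) (Rr : S → S → S → Prop) : List (PTm S) → PTm S → PTm S → Prop
  | sort {Γ s₁ s₂} : PWf Ar Rr Γ → Ar s₁ s₂ → PTyped Ar Rr Γ (PTm.sort s₁) (PTm.sort s₂)
  | var {Γ n A} : PWf Ar Rr Γ → Γ[n]? = some A →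
      PTyped Ar Rr Γ (PTm.var n) (PTm.ren (· + (n + 1)) A)
  | conv {Γ M A B s} : PTyped Ar Rr Γ M A → PTyped Ar Rr Γ B (PTm.sort s) →
      PConv A B → PTyped Ar Rr Γ M B
  | pi {Γ s₁ s₂ s₃ A B} : Rr s₁ s₂ s₃ → PTyped Ar Rr Γ A (PTm.sort s₁) →
      PTyped Ar Rr (A :: Γ) B (PTm.sort s₂) →
      PTyped Ar Rr Γ (PTm.pi A B) (PTm.sort s₃)
  | lam {Γ s₁ s₂ s₃ A B M} : Rr s₁ s₂ s₃ → PTyped Ar Rr Γ A (PTm.sort s₁) →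
      PTyped Ar Rr (A :: Γ) B (PTm.sort s₂) → PTyped Ar Rr (A :: Γ) M B →
      PTyped Ar Rr Γ (PTm.lam A M) (PTm.pi A B)
  | app {Γ A B M N} : PTyped Ar Rr Γ M (PTm.pi A B) → PTyped Ar Rr Γ N A →
      PTyped Ar Rr Γ (PTm.app M N) (PTm.substAt 0 N B)
end

/-- `Γ ⊢_PTS A type`. -/
def PTypeJ (Ar : S → S → Prop) (Rr : S → S → S → Prop) (Γ : List (PTm S)) (A : PTm S) : Prop :=
  (∃ s, A = PTm.sort s) ∨ ∃ s, PTyped Ar Rr Γ A (PTm.sort s)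

/-- The natural erasure from EPTS terms to PTS terms. -/
def epsErase : ETm S → PTm S
  | ETm.var n => PTm.var n
  | ETm.sort s => PTm.sort s
  | ETm.pi _ _ A B => PTm.pi (epsErase A) (epsErase B)
  | ETm.lam _ _ A _ M => PTm.lam (epsErase A) (epsErase M)
  | ETm.app _ _ _ _ M N => PTm.app (epsErase M) (epsErase N)

/-! ## The encoding of EPTSs in Dedukti -/

/-- The constants of the theory `(Σ_EPTS, 𝓡_EPTS)`. -/
inductive EConst (S : Type) : Type
  | U : S → EConst S
  | El : S → EConst S
  | u : S → EConst S
  | Prod : S → S → EConst S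
  | abs : S → S → EConst S
  | app : S → S → EConst S

/-- `U_s`. -/
def Ucon (s : S) : Tm (EConst S) := Tm.const (EConst.U s) []
/-- `El_s A`. -/
def Elcon (s : S) (A : Tm (EConst S)) : Tm (EConst S) := Tm.const (EConst.El s) [A]
/-- `u_s`. -/
def ucon (s : S) : Tm (EConst S) := Tm.const (EConst.u s) []
/-- `Prod_{s₁,s₂} A B`. -/
def ProdC (s₁ s₂ : S) (A B : Tm (EConst S)) : Tm (EConst S) :=
  Tm.const (EConst.Prod s₁ s₂) [A, B]
/-- `abs_{s₁,s₂} A B M`. -/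
def absC (s₁ s₂ : S) (A B M : Tm (EConst S)) : Tm (EConst S) :=
  Tm.const (EConst.abs s₁ s₂) [A, B, M]
/-- `app_{s₁,s₂} A B M N`. -/
def appC (s₁ s₂ : S) (A B M N : Tm (EConst S)) : Tm (EConst S) :=
  Tm.const (EConst.app s₁ s₂) [A, B, M, N]

/-- The signature `Σ_EPTS` (telescopes in de Bruijn form). -/
inductive SigEPTSMem (Ar : S → S → Prop) (Rr : S → S → S → Prop) :
    EConst S × List (Tm (EConst S)) × Tm (EConst S) → Prop
  | U (s : S) : SigEPTSMem Ar Rr (EConst.U s, [], Tm.type)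
  | El (s : S) : SigEPTSMem Ar Rr (EConst.El s, [Ucon s], Tm.type)
  | u {s₁ s₂} : Ar s₁ s₂ → SigEPTSMem Ar Rr (EConst.u s₁, [], Ucon s₂)
  | Prod {s₁ s₂ s₃} : Rr s₁ s₂ s₃ →
      SigEPTSMem Ar Rr (EConst.Prod s₁ s₂,
        [Ucon s₁, Tm.pi (Elcon s₁ (Tm.var 0)) (Ucon s₂)],
        Ucon s₃)
  | abs {s₁ s₂ s₃} : Rr s₁ s₂ s₃ →
      SigEPTSMem Ar Rr (EConst.abs s₁ s₂,
        [Ucon s₁, Tm.pi (Elcon s₁ (Tm.var 0)) (Ucon s₂),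
         Tm.pi (Elcon s₁ (Tm.var 1)) (Elcon s₂ (Tm.app (Tm.var 1) (Tm.var 0)))],
        Elcon s₃ (ProdC s₁ s₂ (Tm.var 2) (Tm.var 1)))
  | app {s₁ s₂ s₃} : Rr s₁ s₂ s₃ →
      SigEPTSMem Ar Rr (EConst.app s₁ s₂,
        [Ucon s₁, Tm.pi (Elcon s₁ (Tm.var 0)) (Ucon s₂),
         Elcon s₃ (ProdC s₁ s₂ (Tm.var 1) (Tm.var 0)),
         Elcon s₁ (Tm.var 2)],
        Elcon s₂ (Tm.app (Tm.var 2) (Tm.var 0)))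

/-- `Σ_EPTS` as a signature. -/
def sigEPTS (Ar : S → S → Prop) (Rr : S → S → S → Prop) : Sig (EConst S) :=
  fun e => SigEPTSMem Ar Rr e

/-- The rules `El_{s₂} u_{s₁} ↪ U_{s₁}` for `(s₁,s₂) ∈ 𝒜`. -/
inductive URulesMem (Ar : S → S → Prop) :
    EConst S × List (Tm (EConst S)) × Tm (EConst S) → Prop
  | u_red {s₁ s₂} : Ar s₁ s₂ → URulesMem Ar (EConst.El s₂, [ucon s₁], Ucon s₁)

/-- The rules `app_{s₁,s₂} A B (abs_{s₁,s₂} A' B' M) N ↪ M N` for `(s₁,s₂,s₃) ∈ ℛ`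
(pattern variables `A,B,A',B',M,N` are the de Bruijn variables `0,…,5`). -/
inductive BetaRulesMem (Rr : S → S → S → Prop) :
    EConst S × List (Tm (EConst S)) × Tm (EConst S) → Prop
  | beta {s₁ s₂ s₃} : Rr s₁ s₂ s₃ →
      BetaRulesMem Rr (EConst.app s₁ s₂,
        [Tm.var 0, Tm.var 1, absC s₁ s₂ (Tm.var 2) (Tm.var 3) (Tm.var 4), Tm.var 5],
        Tm.app (Tm.var 4) (Tm.var 5))

/-- The `u_{s₁}`-red rules as a rule set. -/
def uRules (Ar : S → S → Prop) : Rules (EConst S) := fun e => URulesMem Ar e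

/-- The `beta_{s₁,s₂}` rules as a rule set. -/
def betaRules (Rr : S → S → S → Prop) : Rules (EConst S) := fun e => BetaRulesMem Rr e

/-- The rewrite system `𝓡_EPTS`. -/
def rulesEPTS (Ar : S → S → Prop) (Rr : S → S → S → Prop) : Rules (EConst S) :=
  uRules Ar ∪ betaRules Rr

/-- The translation `⟦·⟧` from EPTS terms to Dedukti terms. -/
def trans : ETm S → Tm (EConst S)
  | ETm.var n => Tm.var n
  | ETm.sort s => ucon s
  | ETm.pi s₁ s₂ A B =>
      ProdC s₁ s₂ (trans A) (Tm.lam (Elcon s₁ (trans A)) (trans B))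
  | ETm.lam s₁ s₂ A B M =>
      absC s₁ s₂ (trans A) (Tm.lam (Elcon s₁ (trans A)) (trans B))
        (Tm.lam (Elcon s₁ (trans A)) (trans M))
  | ETm.app s₁ s₂ A B M N =>
      appC s₁ s₂ (trans A) (Tm.lam (Elcon s₁ (trans A)) (trans B)) (trans M) (trans N)

/-- The translation `⟦·⟧` on (well-formed) contexts: `⟦Γ, x:A⟧ = ⟦Γ⟧, x : El_{s_A} ⟦A⟧`
where `Γ ⊢ A : s_A`. -/
inductive TransCtx (Ar : S → S → Prop) (Rr : S → S → S → Prop) :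
    List (ETm S) → List (Tm (EConst S)) → Prop
  | nil : TransCtx Ar Rr [] []
  | cons {Γ Δ A sA} : TransCtx Ar Rr Γ Δ → ETyped Ar Rr Γ A (ETm.sort sA) →
      TransCtx Ar Rr (A :: Γ) (Elcon sA (trans A) :: Δ)

/-- Invertible forms. -/
inductive Invertible : Tm (EConst S) → Prop
  | var {n} : Invertible (Tm.var n)
  | u {s} : Invertible (ucon s)
  | abs {s₁ s₂ A T₁ B T₂ M} : Invertible A → Invertible B → Invertible M →
      Invertible (absC s₁ s₂ A (Tm.lam T₁ B) (Tm.lam T₂ M))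
  | beta {T M N} : Invertible M → Invertible N →
      Invertible (Tm.app (Tm.lam T M) N)
  | prod {s₁ s₂ A T₁ B} : Invertible A → Invertible B →
      Invertible (ProdC s₁ s₂ A (Tm.lam T₁ B))
  | app {s₁ s₂ A T₁ B M N} : Invertible A → Invertible B → Invertible M → Invertible N →
      Invertible (appC s₁ s₂ A (Tm.lam T₁ B) M N)

/-- The inverse translation `|·|`, defined (at least) on invertible forms. -/
def inv : Tm (EConst S) → Option (ETm S)
  | Tm.var n => some (ETm.var n)
  | Tm.const (EConst.u s) [] => some (ETm.sort s)
  | Tm.app (Tm.lam _ M) N => do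
      return ETm.substAt 0 (← inv N) (← inv M)
  | Tm.const (EConst.Prod s₁ s₂) [A, Tm.lam _ B] => do
      return ETm.pi s₁ s₂ (← inv A) (← inv B)
  | Tm.const (EConst.abs s₁ s₂) [A, Tm.lam _ B, Tm.lam _ M] => do
      return ETm.lam s₁ s₂ (← inv A) (← inv B) (← inv M)
  | Tm.const (EConst.app s₁ s₂) [A, Tm.lam _ B, M, N] => do
      return ETm.app s₁ s₂ (← inv A) (← inv B) (← inv M) (← inv N)
  | _ => none
termination_by t => sizeOf t
decreasing_by
  all_goals simp_wf
  all_goals omega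

/-- Hidden rewriting steps: a `↪_{β𝓡}` step inside the type annotation of a binder. -/
def HStep (R : Rules (EConst S)) : Tm (EConst S) → Tm (EConst S) → Prop :=
  Cong fun M N => ∃ A A' P, Step R A A' ∧ M = Tm.lam A P ∧ N = Tm.lam A' P

/-- The hidden conversion `≡_H`. -/
def HConv (R : Rules (EConst S)) : Tm (EConst S) → Tm (EConst S) → Prop :=
  Relation.EqvGen (HStep R)


/-- The hidden conversion `≡_H` is an equivalence on β-normal Dedukti terms of type `T`. -/
theorem hconv_equivalence {S : Type} (Ar : S → S → Prop) (Rr : S → S → S → Prop)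
    (Δ : List (Tm (EConst S))) (T : Tm (EConst S)) :
    Equivalence (fun (x y : {N : Tm (EConst S) //
        BetaNormal N ∧ Typed (sigEPTS Ar Rr) (rulesEPTS Ar Rr) Δ N T}) =>
      HConv (rulesEPTS Ar Rr) x.1 y.1) :=
  ⟨fun _ => Relation.EqvGen.refl _,
   fun h => Relation.EqvGen.symm _ _ h,
   fun h h' => Relation.EqvGen.trans _ _ _ h h'⟩

section Adequacy

namespace Tm
variable {C : Type}

theorem ind {P : Tm C → Prop} (var : ∀ n, P (.var n))
    (const : ∀ c Ms, (∀ M ∈ Ms, P M) → P (.const c Ms)) (type : P .type) (kind : P .kind)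
    (app : ∀ M N, P M → P N → P (.app M N)) (lam : ∀ A M, P A → P M → P (.lam A M))
    (pi : ∀ A B, P A → P B → P (.pi A B)) : ∀ M, P M
  | .var n => var n
  | .const c Ms => const c Ms fun M _ => ind var const type kind app lam pi M
  | .type => type
  | .kind => kind
  | .app M N => app M N (ind var const type kind app lam pi M) (ind var const type kind app lam pi N)
  | .lam M N => lam M N (ind var const type kind app lam pi M) (ind var const type kind app lam pi N)
  | .pi M N => pi M N (ind var const type kind app lam pi M) (ind var const type kind app lam pi N)
termination_by M => sizeOf M
decreasing_by
  all_goals simp_wf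
  all_goals try omega
  all_goals (have h := List.sizeOf_lt_of_mem ‹M ∈ Ms›; omega)

@[simp] theorem ren_var (ρ : Nat → Nat) (n) : ren ρ (var n : Tm C) = var (ρ n) := by rw [ren]
@[simp] theorem ren_const (ρ : Nat → Nat) (c : C) (Ms) :
    ren ρ (const c Ms) = const c (Ms.map (ren ρ)) := by rw [ren]; simp
@[simp] theorem ren_type (ρ : Nat → Nat) : ren ρ (type : Tm C) = type := by rw [ren]
@[simp] theorem ren_kind (ρ : Nat → Nat) : ren ρ (kind : Tm C) = kind := by rw [ren]
@[simp] theorem ren_app (ρ : Nat → Nat) (M N : Tm C) :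
    ren ρ (app M N) = app (ren ρ M) (ren ρ N) := by rw [ren]
@[simp] theorem ren_lam (ρ : Nat → Nat) (M N : Tm C) :
    ren ρ (lam M N) = lam (ren ρ M) (ren (liftRen ρ) N) := by rw [ren]
@[simp] theorem ren_pi (ρ : Nat → Nat) (M N : Tm C) :
    ren ρ (pi M N) = pi (ren ρ M) (ren (liftRen ρ) N) := by rw [ren]
@[simp] theorem sub_var (σ : Nat → Tm C) (n) : sub σ (var n : Tm C) = σ n := by rw [sub]
@[simp] theorem sub_const (σ : Nat → Tm C) (c : C) (Ms) :
    sub σ (const c Ms) = const c (Ms.map (sub σ)) := by rw [sub]; simp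
@[simp] theorem sub_type (σ : Nat → Tm C) : sub σ (type : Tm C) = type := by rw [sub]
@[simp] theorem sub_kind (σ : Nat → Tm C) : sub σ (kind : Tm C) = kind := by rw [sub]
@[simp] theorem sub_app (σ : Nat → Tm C) (M N : Tm C) :
    sub σ (app M N) = app (sub σ M) (sub σ N) := by rw [sub]
@[simp] theorem sub_lam (σ : Nat → Tm C) (M N : Tm C) :
    sub σ (lam M N) = lam (sub σ M) (sub (liftSub σ) N) := by rw [sub]
@[simp] theorem sub_pi (σ : Nat → Tm C) (M N : Tm C) :
    sub σ (pi M N) = pi (sub σ M) (sub (liftSub σ) N) := by rw [sub]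

/-- The substitution mapping `0` to `N` and `n + 1` to `σ n`. -/
def scons (N : Tm C) (σ : Nat → Tm C) : Nat → Tm C
  | 0 => N
  | n + 1 => σ n

theorem liftRen_comp (ρ' ρ : Nat → Nat) : liftRen ρ' ∘ liftRen ρ = liftRen (ρ' ∘ ρ) := by
  funext n; cases n <;> rfl

theorem ren_ren (M : Tm C) : ∀ ρ' ρ : Nat → Nat, ren ρ' (ren ρ M) = ren (ρ' ∘ ρ) M := by
  induction M using ind <;> intro ρ' ρ <;> simp_all [liftRen_comp]

theorem liftSub_comp_liftRen (σ : Nat → Tm C) (ρ : Nat → Nat) :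
    liftSub σ ∘ liftRen ρ = liftSub (σ ∘ ρ) := by
  funext n; cases n <;> rfl

theorem sub_ren (M : Tm C) : ∀ (σ : Nat → Tm C) (ρ : Nat → Nat),
    sub σ (ren ρ M) = sub (σ ∘ ρ) M := by
  induction M using ind <;> intro σ ρ <;> simp_all [liftSub_comp_liftRen]

theorem ren_comp_liftSub (ρ : Nat → Nat) (σ : Nat → Tm C) :
    ren (liftRen ρ) ∘ liftSub σ = liftSub (ren ρ ∘ σ) := by
  funext n
  cases n
  · simp [liftSub, liftRen]
  · simp only [Function.comp, liftSub, ren_ren]; rfl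

theorem ren_sub (M : Tm C) : ∀ (ρ : Nat → Nat) (σ : Nat → Tm C),
    ren ρ (sub σ M) = sub (ren ρ ∘ σ) M := by
  induction M using ind <;> intro σ ρ <;> simp_all [ren_comp_liftSub]

theorem sub_comp_liftSub (τ σ : Nat → Tm C) :
    sub (liftSub τ) ∘ liftSub σ = liftSub (sub τ ∘ σ) := by
  funext n
  cases n
  · simp [liftSub]
  · simp only [Function.comp, liftSub, sub_ren, ren_sub]; rfl

theorem sub_sub (M : Tm C) : ∀ τ σ : Nat → Tm C, sub τ (sub σ M) = sub (sub τ ∘ σ) M := by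
  induction M using ind <;> intro σ ρ <;> simp_all [sub_comp_liftSub]

theorem liftSub_var_comp (ρ : Nat → Nat) :
    liftSub (var ∘ ρ : Nat → Tm C) = var ∘ liftRen ρ := by
  funext n; cases n <;> simp [liftSub, liftRen]

theorem ren_eq_sub (M : Tm C) : ∀ ρ : Nat → Nat, ren ρ M = sub (var ∘ ρ) M := by
  induction M using ind <;> intro ρ <;> simp_all [liftSub_var_comp]

theorem liftSub_var : liftSub (var : Nat → Tm C) = var := by
  funext n; cases n <;> simp [liftSub]

@[simp] theorem sub_id (M : Tm C) : sub var M = M := by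
  induction M using ind with
  | const c Ms ih => rw [sub_const, List.map_congr_left (g := id) ih, List.map_id]
  | _ => simp_all [liftSub_var]

@[simp] theorem ren_id (M : Tm C) : ren (fun n => n) M = M := by
  rw [ren_eq_sub]; exact sub_id M

theorem substAt_zero (N M : Tm C) : substAt 0 N M = sub (scons N var) M := by
  unfold substAt
  congr 1
  funext n; cases n <;> simp [scons]

theorem sub_substAt (σ : Nat → Tm C) (N M : Tm C) :
    sub σ (substAt 0 N M) = substAt 0 (sub σ N) (sub (liftSub σ) M) := by
  simp only [substAt_zero, sub_sub]
  congr 1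
  funext n
  cases n
  · simp [scons, liftSub]
  · simp only [Function.comp, scons, liftSub, sub_ren, sub_var]
    exact (sub_id _).symm

theorem ren_substAt (ρ : Nat → Nat) (N M : Tm C) :
    ren ρ (substAt 0 N M) = substAt 0 (ren ρ N) (ren (liftRen ρ) M) := by
  simp only [ren_eq_sub, sub_substAt, liftSub_var_comp]

theorem substAt_liftSub (N : Tm C) (σ : Nat → Tm C) (M : Tm C) :
    substAt 0 N (sub (liftSub σ) M) = sub (scons N σ) M := by
  simp only [substAt_zero, sub_sub]
  congr 1
  funext n
  cases n
  · simp [scons, liftSub]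
  · simp only [Function.comp, scons, liftSub, sub_ren]
    exact sub_id _

end Tm

namespace ETm
variable {S : Type}

/-- The substitution mapping `0` to `N` and `n + 1` to `σ n`. -/
def scons (N : ETm S) (σ : Nat → ETm S) : Nat → ETm S
  | 0 => N
  | n + 1 => σ n

theorem ren_ren (M : ETm S) : ∀ ρ' ρ : Nat → Nat, ren ρ' (ren ρ M) = ren (ρ' ∘ ρ) M := by
  induction M <;> intro ρ' ρ <;> simp_all [ren, Tm.liftRen_comp]

theorem liftSub_comp_liftRen (σ : Nat → ETm S) (ρ : Nat → Nat) :
    liftSub σ ∘ Tm.liftRen ρ = liftSub (σ ∘ ρ) := by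
  funext n; cases n <;> rfl

theorem sub_ren (M : ETm S) : ∀ (σ : Nat → ETm S) (ρ : Nat → Nat),
    sub σ (ren ρ M) = sub (σ ∘ ρ) M := by
  induction M <;> intro σ ρ <;> simp_all [ren, sub, liftSub_comp_liftRen]

theorem ren_comp_liftSub (ρ : Nat → Nat) (σ : Nat → ETm S) :
    ren (Tm.liftRen ρ) ∘ liftSub σ = liftSub (ren ρ ∘ σ) := by
  funext n
  cases n
  · simp [liftSub, ren, Tm.liftRen]
  · simp only [Function.comp, liftSub, ren_ren]; rfl

theorem ren_sub (M : ETm S) : ∀ (ρ : Nat → Nat) (σ : Nat → ETm S),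
    ren ρ (sub σ M) = sub (ren ρ ∘ σ) M := by
  induction M <;> intro σ ρ <;> simp_all [ren, sub, ren_comp_liftSub]

theorem sub_comp_liftSub (τ σ : Nat → ETm S) :
    sub (liftSub τ) ∘ liftSub σ = liftSub (sub τ ∘ σ) := by
  funext n
  cases n
  · simp [liftSub, sub]
  · simp only [Function.comp, liftSub, sub_ren, ren_sub]; rfl

theorem sub_sub (M : ETm S) : ∀ τ σ : Nat → ETm S, sub τ (sub σ M) = sub (sub τ ∘ σ) M := by
  induction M <;> intro σ ρ <;> simp_all [sub, sub_comp_liftSub]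

theorem liftSub_var_comp (ρ : Nat → Nat) :
    liftSub (var ∘ ρ : Nat → ETm S) = var ∘ Tm.liftRen ρ := by
  funext n; cases n <;> simp [liftSub, Tm.liftRen, ren]

theorem ren_eq_sub (M : ETm S) : ∀ ρ : Nat → Nat, ren ρ M = sub (var ∘ ρ) M := by
  induction M <;> intro ρ <;> simp_all [ren, sub, liftSub_var_comp]

theorem liftSub_var : liftSub (var : Nat → ETm S) = var := by
  funext n; cases n <;> simp [liftSub, ren]

@[simp] theorem sub_id (M : ETm S) : sub var M = M := by
  induction M <;> simp_all [sub, liftSub_var]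

@[simp] theorem ren_id (M : ETm S) : ren (fun n => n) M = M := by
  rw [ren_eq_sub]; exact sub_id M

theorem substAt_zero (N M : ETm S) : substAt 0 N M = sub (scons N var) M := by
  unfold substAt
  congr 1
  funext n; cases n <;> simp [scons]

theorem sub_substAt (σ : Nat → ETm S) (N M : ETm S) :
    sub σ (substAt 0 N M) = substAt 0 (sub σ N) (sub (liftSub σ) M) := by
  simp only [substAt_zero, sub_sub]
  congr 1
  funext n
  cases n
  · simp [scons, liftSub, sub]
  · simp only [Function.comp, scons, liftSub, sub_ren, sub]
    exact (sub_id _).symm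

theorem ren_substAt (ρ : Nat → Nat) (N M : ETm S) :
    ren ρ (substAt 0 N M) = substAt 0 (ren ρ N) (ren (Tm.liftRen ρ) M) := by
  simp only [ren_eq_sub, sub_substAt, liftSub_var_comp]

end ETm

variable {S : Type}

theorem trans_ren (M : ETm S) : ∀ ρ : Nat → Nat, trans (ETm.ren ρ M) = Tm.ren ρ (trans M) := by
  induction M <;> intro ρ <;>
    simp_all [trans, ETm.ren, ucon, ProdC, absC, appC, Elcon]

theorem trans_comp_liftSub (σ : Nat → ETm S) :
    Tm.liftSub (trans ∘ σ) = trans ∘ ETm.liftSub σ := by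
  funext n; cases n <;> simp [Tm.liftSub, ETm.liftSub, trans, trans_ren]

theorem trans_sub (M : ETm S) : ∀ σ : Nat → ETm S,
    trans (ETm.sub σ M) = Tm.sub (trans ∘ σ) (trans M) := by
  induction M <;> intro σ <;>
    simp_all [trans, ETm.sub, ucon, ProdC, absC, appC, Elcon, trans_comp_liftSub]

theorem trans_substAt (M N : ETm S) (k : Nat) :
    Tm.substAt k (trans N) (trans M) = trans (ETm.substAt k N M) := by
  unfold Tm.substAt ETm.substAt
  rw [trans_sub]
  congr 1
  funext n
  simp only [Function.comp]
  split_ifs <;> simp [trans, trans_ren]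

/-! ## Confluence of the encoding -/

/-- Parallel reduction for `β` and `𝓡_EPTS`. -/
inductive Par (Ar : S → S → Prop) (Rr : S → S → S → Prop) :
    Tm (EConst S) → Tm (EConst S) → Prop
  | var (n) : Par Ar Rr (.var n) (.var n)
  | type : Par Ar Rr .type .type
  | kind : Par Ar Rr .kind .kind
  | const {c Ms Ns} : Ms.length = Ns.length →
      (∀ M N, (M, N) ∈ Ms.zip Ns → Par Ar Rr M N) → Par Ar Rr (.const c Ms) (.const c Ns)
  | app {M M' N N'} : Par Ar Rr M M' → Par Ar Rr N N' → Par Ar Rr (.app M N) (.app M' N')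
  | lam {A A' M M'} : Par Ar Rr A A' → Par Ar Rr M M' → Par Ar Rr (.lam A M) (.lam A' M')
  | pi {A A' B B'} : Par Ar Rr A A' → Par Ar Rr B B' → Par Ar Rr (.pi A B) (.pi A' B')
  | beta {A P P' Q Q'} : Par Ar Rr P P' → Par Ar Rr Q Q' →
      Par Ar Rr (.app (.lam A P) Q) (Tm.substAt 0 Q' P')
  | elU {s₁ s₂} : Ar s₁ s₂ →
      Par Ar Rr (.const (.El s₂) [.const (.u s₁) []]) (.const (.U s₁) [])
  | betaC {s₁ s₂ s₃ A B A' B' M M' N N'} : Rr s₁ s₂ s₃ → Par Ar Rr M M' → Par Ar Rr N N' →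
      Par Ar Rr (.const (.app s₁ s₂) [A, B, .const (.abs s₁ s₂) [A', B', M], N]) (.app M' N')

variable {Ar : S → S → Prop} {Rr : S → S → S → Prop}

namespace Par

theorem const_of_forall₂ {c Ms Ns} (h : List.Forall₂ (Par Ar Rr) Ms Ns) :
    Par Ar Rr (.const c Ms) (.const c Ns) :=
  have h' := List.forall₂_iff_zip.1 h
  .const h'.1 fun _ _ hm => h'.2 hm

theorem refl (M : Tm (EConst S)) : Par Ar Rr M M := by
  induction M using Tm.ind with
  | var n => exact .var n
  | type => exact .type
  | kind => exact .kind
  | app M N hM hN => exact .app hM hN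
  | lam M N hM hN => exact .lam hM hN
  | pi M N hM hN => exact .pi hM hN
  | const c Ms ih => exact const_of_forall₂ (List.forall₂_same.2 ih)

theorem lam_inv {A M X} (h : Par Ar Rr (.lam A M) X) :
    ∃ A' M', X = .lam A' M' ∧ Par Ar Rr A A' ∧ Par Ar Rr M M' := by
  cases h with
  | lam hA hM => exact ⟨_, _, rfl, hA, hM⟩

theorem pi_inv {A M X} (h : Par Ar Rr (.pi A M) X) :
    ∃ A' M', X = .pi A' M' ∧ Par Ar Rr A A' ∧ Par Ar Rr M M' := by
  cases h with
  | pi hA hM => exact ⟨_, _, rfl, hA, hM⟩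

theorem const_inv {c Ms X} (h : Par Ar Rr (.const c Ms) X) :
    (∃ Ns, X = .const c Ns ∧ List.Forall₂ (Par Ar Rr) Ms Ns) ∨
    (∃ s₁ s₂, c = .El s₂ ∧ Ms = [.const (.u s₁) []] ∧ X = .const (.U s₁) [] ∧ Ar s₁ s₂) ∨
    (∃ s₁ s₂ s₃ A B A' B' M M' N N', c = .app s₁ s₂ ∧
      Ms = [A, B, .const (.abs s₁ s₂) [A', B', M], N] ∧ X = .app M' N' ∧
      Rr s₁ s₂ s₃ ∧ Par Ar Rr M M' ∧ Par Ar Rr N N') := by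
  cases h with
  | const hl h => exact .inl ⟨_, rfl, List.forall₂_iff_zip.2 ⟨hl, fun hm => h _ _ hm⟩⟩
  | elU h => exact .inr (.inl ⟨_, _, rfl, rfl, rfl, h⟩)
  | betaC h hM hN => exact .inr (.inr ⟨_, _, _, _, _, _, _, _, _, _, _, rfl, rfl, rfl, h, hM, hN⟩)

theorem abs_inv {s₁ s₂ A B M X} (H : Par Ar Rr (.const (.abs s₁ s₂) [A, B, M]) X) :
    ∃ A' B' M', X = .const (.abs s₁ s₂) [A', B', M'] ∧
      Par Ar Rr A A' ∧ Par Ar Rr B B' ∧ Par Ar Rr M M' := by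
  rcases const_inv H with ⟨Ns, rfl, h⟩ | ⟨_, _, h, _⟩ | ⟨_, _, _, _, _, _, _, _, _, _, _, h, _⟩
  · rcases h with _ | ⟨hA, _ | ⟨hB, _ | ⟨hM, _ | _⟩⟩⟩
    exact ⟨_, _, _, rfl, hA, hB, hM⟩
  · cases h
  · cases h

theorem prod_inv {s₁ s₂ A B X} (H : Par Ar Rr (.const (.Prod s₁ s₂) [A, B]) X) :
    ∃ A' B', X = .const (.Prod s₁ s₂) [A', B'] ∧ Par Ar Rr A A' ∧ Par Ar Rr B B' := by
  rcases const_inv H with ⟨Ns, rfl, h⟩ | ⟨_, _, h, _⟩ | ⟨_, _, _, _, _, _, _, _, _, _, _, h, _⟩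
  · rcases h with _ | ⟨hA, _ | ⟨hB, _ | _⟩⟩
    exact ⟨_, _, rfl, hA, hB⟩
  · cases h
  · cases h

theorem app_inv {s₁ s₂ A B M N X} (H : Par Ar Rr (.const (.app s₁ s₂) [A, B, M, N]) X) :
    (∃ A' B' M' N', X = .const (.app s₁ s₂) [A', B', M', N'] ∧
      Par Ar Rr A A' ∧ Par Ar Rr B B' ∧ Par Ar Rr M M' ∧ Par Ar Rr N N') ∨
    (∃ s₃ A' B' P P' N', M = .const (.abs s₁ s₂) [A', B', P] ∧ X = .app P' N' ∧
      Rr s₁ s₂ s₃ ∧ Par Ar Rr P P' ∧ Par Ar Rr N N') := by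
  rcases const_inv H with ⟨Ns, rfl, h⟩ | ⟨_, _, h, _⟩ |
    ⟨_, _, _, _, _, _, _, _, _, _, _, h, h', rfl, hR, hM, hN⟩
  · rcases h with _ | ⟨hA, _ | ⟨hB, _ | ⟨hM, _ | ⟨hN, _ | _⟩⟩⟩⟩
    exact .inl ⟨_, _, _, _, rfl, hA, hB, hM, hN⟩
  · cases h
  · cases h
    cases h'
    exact .inr ⟨_, _, _, _, _, _, rfl, rfl, hR, hM, hN⟩

theorem El_inv {s A X} (H : Par Ar Rr (.const (.El s) [A]) X) :
    (∃ A', X = .const (.El s) [A'] ∧ Par Ar Rr A A') ∨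
    (∃ s₁, A = .const (.u s₁) [] ∧ X = .const (.U s₁) [] ∧ Ar s₁ s) := by
  rcases const_inv H with ⟨Ns, rfl, h⟩ | ⟨_, _, h, h', rfl, hA⟩ |
    ⟨_, _, _, _, _, _, _, _, _, _, _, h, _⟩
  · rcases h with _ | ⟨hA, _ | _⟩
    exact .inl ⟨_, rfl, hA⟩
  · cases h
    cases h'
    exact .inr ⟨_, rfl, rfl, hA⟩
  · cases h

theorem u_inv {s X} (H : Par Ar Rr (.const (.u s) []) X) : X = .const (.u s) [] := by
  rcases const_inv H with ⟨Ns, rfl, h⟩ | ⟨_, _, h, _⟩ | ⟨_, _, _, _, _, _, _, _, _, _, _, h, _⟩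
  · cases h; rfl
  · cases h
  · cases h

theorem U_inv {s X} (H : Par Ar Rr (.const (.U s) []) X) : X = .const (.U s) [] := by
  rcases const_inv H with ⟨Ns, rfl, h⟩ | ⟨_, _, h, _⟩ | ⟨_, _, _, _, _, _, _, _, _, _, _, h, _⟩
  · cases h; rfl
  · cases h
  · cases h

theorem ren {M N : Tm (EConst S)} (h : Par Ar Rr M N) :
    ∀ ρ : Nat → Nat, Par Ar Rr (Tm.ren ρ M) (Tm.ren ρ N) := by
  induction h with
  | const hl _ ih =>
    intro ρ
    rw [Tm.ren_const, Tm.ren_const]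
    refine const_of_forall₂ ?_
    rw [List.forall₂_map_left_iff, List.forall₂_map_right_iff]
    exact List.forall₂_iff_zip.2 ⟨hl, fun hm => ih _ _ hm ρ⟩
  | beta _ _ ihP ihQ =>
    intro ρ
    rw [Tm.ren_substAt]
    simpa using beta (ihP _) (ihQ _)
  | elU h => intro ρ; simpa using elU h
  | betaC h _ _ ihM ihN => intro ρ; simpa using betaC h (ihM ρ) (ihN ρ)
  | app _ _ ihM ihN => intro ρ; simpa using app (ihM ρ) (ihN ρ)
  | lam _ _ ihM ihN => intro ρ; simpa using lam (ihM ρ) (ihN _)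
  | pi _ _ ihM ihN => intro ρ; simpa using pi (ihM ρ) (ihN _)
  | _ => intro ρ; exact refl _

theorem liftSub {σ τ : Nat → Tm (EConst S)} (h : ∀ n, Par Ar Rr (σ n) (τ n)) (n : Nat) :
    Par Ar Rr (Tm.liftSub σ n) (Tm.liftSub τ n) := by
  cases n with
  | zero => exact refl _
  | succ n => exact (h n).ren _

theorem sub {M N : Tm (EConst S)} (h : Par Ar Rr M N) :
    ∀ σ τ : Nat → Tm (EConst S), (∀ n, Par Ar Rr (σ n) (τ n)) →
      Par Ar Rr (Tm.sub σ M) (Tm.sub τ N) := by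
  induction h with
  | const hl _ ih =>
    intro σ τ hσ
    rw [Tm.sub_const, Tm.sub_const]
    refine const_of_forall₂ ?_
    rw [List.forall₂_map_left_iff, List.forall₂_map_right_iff]
    exact List.forall₂_iff_zip.2 ⟨hl, fun hm => ih _ _ hm σ τ hσ⟩
  | beta _ _ ihP ihQ =>
    intro σ τ hσ
    rw [Tm.sub_substAt]
    simpa using beta (ihP _ _ (liftSub hσ)) (ihQ _ _ hσ)
  | elU h => intro σ τ hσ; simpa using elU h
  | betaC h _ _ ihM ihN => intro σ τ hσ; simpa using betaC h (ihM _ _ hσ) (ihN _ _ hσ)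
  | app _ _ ihM ihN => intro σ τ hσ; simpa using app (ihM _ _ hσ) (ihN _ _ hσ)
  | lam _ _ ihM ihN => intro σ τ hσ; simpa using lam (ihM _ _ hσ) (ihN _ _ (liftSub hσ))
  | pi _ _ ihM ihN => intro σ τ hσ; simpa using pi (ihM _ _ hσ) (ihN _ _ (liftSub hσ))
  | var n => intro σ τ hσ; simpa using hσ n
  | type => intro σ τ hσ; simpa using type
  | kind => intro σ τ hσ; simpa using kind

theorem substAt {M M' N N' : Tm (EConst S)} (hM : Par Ar Rr M M') (hN : Par Ar Rr N N') :
    Par Ar Rr (Tm.substAt 0 N M) (Tm.substAt 0 N' M') := by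
  rw [Tm.substAt_zero, Tm.substAt_zero]
  refine hM.sub _ _ fun n => ?_
  cases n with
  | zero => exact hN
  | succ n => exact refl _

theorem forall₂_diamond {Ms Ns : List (Tm (EConst S))}
    (h : List.Forall₂ (fun M N => ∀ N₂, Par Ar Rr M N₂ → ∃ Z, Par Ar Rr N Z ∧ Par Ar Rr N₂ Z)
      Ms Ns) : ∀ {Ns₂}, List.Forall₂ (Par Ar Rr) Ms Ns₂ →
    ∃ Zs, List.Forall₂ (Par Ar Rr) Ns Zs ∧ List.Forall₂ (Par Ar Rr) Ns₂ Zs := by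
  induction h with
  | nil => intro _ h; cases h; exact ⟨[], .nil, .nil⟩
  | cons h _ ih =>
    intro _ h₂
    rcases h₂ with _ | ⟨h₁, h₂⟩
    obtain ⟨Z, hZ, hZ'⟩ := h _ h₁
    obtain ⟨Zs, hZs, hZs'⟩ := ih h₂
    exact ⟨Z :: Zs, .cons hZ hZs, .cons hZ' hZs'⟩

theorem diamond {M N : Tm (EConst S)} (h : Par Ar Rr M N) :
    ∀ N₂, Par Ar Rr M N₂ → ∃ Z, Par Ar Rr N Z ∧ Par Ar Rr N₂ Z := by
  induction h with
  | var n => intro _ h; exact ⟨_, h, refl _⟩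
  | type => intro _ h; exact ⟨_, h, refl _⟩
  | kind => intro _ h; exact ⟨_, h, refl _⟩
  | @const c Ms Ns hl h ih =>
    intro N₂ h₂
    rcases const_inv h₂ with ⟨Ns₂, rfl, hNs⟩ | ⟨s₁, s₂, rfl, rfl, rfl, hA⟩ |
      ⟨s₁, s₂, s₃, A, B, A', B', P, P₂, Q, Q₂, rfl, rfl, rfl, hR, hP, hQ⟩
    · obtain ⟨Zs, hZ, hZ'⟩ := forall₂_diamond
        (List.forall₂_iff_zip.2 ⟨hl, fun hm => ih _ _ hm⟩) hNs
      exact ⟨_, const_of_forall₂ hZ, const_of_forall₂ hZ'⟩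
    · have h' : List.Forall₂ (Par Ar Rr) _ _ := List.forall₂_iff_zip.2 ⟨hl, fun hm => h _ _ hm⟩
      rcases h' with _ | ⟨h₁, _ | _⟩
      cases u_inv h₁
      exact ⟨_, elU hA, refl _⟩
    · have h' : List.Forall₂ (fun M N => Par Ar Rr M N ∧
          ∀ N₂, Par Ar Rr M N₂ → ∃ Z, Par Ar Rr N Z ∧ Par Ar Rr N₂ Z) _ _ :=
        List.forall₂_iff_zip.2 ⟨hl, fun hm => ⟨h _ _ hm, ih _ _ hm⟩⟩
      rcases h' with _ | ⟨_, _ | ⟨_, _ | ⟨h₁, _ | ⟨h₂, _ | _⟩⟩⟩⟩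
      obtain ⟨A₁, B₁, P₁, rfl, -, -, -⟩ := abs_inv h₁.1
      obtain ⟨Z, hZ, hZ'⟩ := h₁.2 (.const (.abs s₁ s₂) [A', B', P₂])
        (const_of_forall₂ (.cons (refl _) (.cons (refl _) (.cons hP .nil))))
      obtain ⟨A₃, B₃, P₃, rfl, -, -, hP₁⟩ := abs_inv hZ
      obtain ⟨A₄, B₄, P₄, h, -, -, hP₂⟩ := abs_inv hZ'
      cases h
      obtain ⟨Q₃, hQ₁, hQ₂⟩ := h₂.2 _ hQ
      exact ⟨_, betaC hR hP₁ hQ₁, app hP₂ hQ₂⟩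
  | app hM hN ihM ihN =>
    intro N₂ h₂
    cases h₂ with
    | app hM₂ hN₂ =>
      obtain ⟨Z, hZ, hZ'⟩ := ihM _ hM₂
      obtain ⟨W, hW, hW'⟩ := ihN _ hN₂
      exact ⟨_, app hZ hW, app hZ' hW'⟩
    | @beta A P P' Q Q' hP hQ =>
      obtain ⟨A₁, P₁, rfl, -, -⟩ := lam_inv hM
      obtain ⟨Z, hZ, hZ'⟩ := ihM _ (lam (refl A) hP)
      obtain ⟨A₂, P₂, rfl, -, hP₁⟩ := lam_inv hZ
      obtain ⟨A₃, P₃, h, -, hP₂⟩ := lam_inv hZ'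
      cases h
      obtain ⟨W, hW, hW'⟩ := ihN _ hQ
      exact ⟨_, beta hP₁ hW, substAt hP₂ hW'⟩
  | lam hM hN ihM ihN =>
    intro N₂ h₂
    obtain ⟨_, _, rfl, hM₂, hN₂⟩ := lam_inv h₂
    obtain ⟨Z, hZ, hZ'⟩ := ihM _ hM₂
    obtain ⟨W, hW, hW'⟩ := ihN _ hN₂
    exact ⟨_, lam hZ hW, lam hZ' hW'⟩
  | pi hM hN ihM ihN =>
    intro N₂ h₂
    obtain ⟨_, _, rfl, hM₂, hN₂⟩ := pi_inv h₂
    obtain ⟨Z, hZ, hZ'⟩ := ihM _ hM₂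
    obtain ⟨W, hW, hW'⟩ := ihN _ hN₂
    exact ⟨_, pi hZ hW, pi hZ' hW'⟩
  | beta hP hQ ihP ihQ =>
    intro N₂ h₂
    cases h₂ with
    | app hM₂ hN₂ =>
      obtain ⟨A₁, P₁, rfl, -, hP₁⟩ := lam_inv hM₂
      obtain ⟨Z, hZ, hZ'⟩ := ihP _ hP₁
      obtain ⟨W, hW, hW'⟩ := ihQ _ hN₂
      exact ⟨_, substAt hZ hW, beta hZ' hW'⟩
    | beta hP₂ hQ₂ =>
      obtain ⟨Z, hZ, hZ'⟩ := ihP _ hP₂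
      obtain ⟨W, hW, hW'⟩ := ihQ _ hQ₂
      exact ⟨_, substAt hZ hW, substAt hZ' hW'⟩
  | elU hA =>
    intro N₂ h₂
    rcases El_inv h₂ with ⟨A', rfl, h⟩ | ⟨s₁, h, rfl, -⟩
    · cases u_inv h
      exact ⟨_, refl _, elU hA⟩
    · cases h
      exact ⟨_, refl _, refl _⟩
  | betaC hR hM hN ihM ihN =>
    intro N₂ h₂
    rcases app_inv h₂ with ⟨A₁, B₁, M₁, N₁, rfl, -, -, hM₁, hN₁⟩ |
      ⟨s₃, A₁, B₁, P, P', N', h, rfl, -, hP, hN₁⟩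
    · obtain ⟨A₂, B₂, P₂, rfl, -, -, hP⟩ := abs_inv hM₁
      obtain ⟨Z, hZ, hZ'⟩ := ihM _ hP
      obtain ⟨W, hW, hW'⟩ := ihN _ hN₁
      exact ⟨_, app hZ hW, betaC hR hZ' hW'⟩
    · cases h
      obtain ⟨Z, hZ, hZ'⟩ := ihM _ hP
      obtain ⟨W, hW, hW'⟩ := ihN _ hN₁
      exact ⟨_, app hZ hW, app hZ' hW'⟩

theorem of_step {M N : Tm (EConst S)} (h : Step (rulesEPTS Ar Rr) M N) : Par Ar Rr M N := by
  induction h with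
  | base h =>
    rcases h with ⟨A, P, Q, rfl, rfl⟩ | ⟨rl, hrl, σ, rfl, rfl⟩
    · exact beta (refl _) (refl _)
    · rcases hrl with hrl | hrl
      · cases hrl with
        | u_red h => simpa [ucon, Ucon] using elU h
      · cases hrl with
        | beta h => simpa [absC] using betaC h (refl _) (refl _)
  | appL _ ih => exact app ih (refl _)
  | appR _ ih => exact app (refl _) ih
  | lamA _ ih => exact lam ih (refl _)
  | lamM _ ih => exact lam (refl _) ih
  | piA _ ih => exact pi ih (refl _)
  | piB _ ih => exact pi (refl _) ih
  | constArg _ ih =>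
    have hrefl (l : List (Tm (EConst S))) : List.Forall₂ (Par Ar Rr) l l :=
      List.forall₂_same.2 fun M _ => refl M
    exact const_of_forall₂ (List.rel_append (hrefl _) (.cons ih (hrefl _)))

end Par

open Relation

theorem Cong.star_const {r : Tm C → Tm C → Prop} {c : C} {Ms Ns : List (Tm C)}
    (h : List.Forall₂ (ReflTransGen (Cong r)) Ms Ns) :
    ∀ l, ReflTransGen (Cong r) (.const c (l ++ Ms)) (.const c (l ++ Ns)) := by
  induction h with
  | nil => intro l; exact .refl
  | @cons M N Ms Ns h _ ih =>
    intro l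
    have h₁ : ReflTransGen (Cong r) (.const c (l ++ M :: Ms)) (.const c (l ++ N :: Ms)) :=
      h.lift (fun X => Tm.const c (l ++ X :: Ms)) fun _ _ h => .constArg h
    refine h₁.trans ?_
    simpa using ih (l ++ [N])

theorem Cong.star_app {r : Tm C → Tm C → Prop} {M M' N N' : Tm C}
    (hM : ReflTransGen (Cong r) M M') (hN : ReflTransGen (Cong r) N N') :
    ReflTransGen (Cong r) (.app M N) (.app M' N') :=
  (hM.lift (Tm.app · N) fun _ _ h => .appL h).trans (hN.lift (Tm.app M' ·) fun _ _ h => .appR h)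

theorem Cong.star_lam {r : Tm C → Tm C → Prop} {M M' N N' : Tm C}
    (hM : ReflTransGen (Cong r) M M') (hN : ReflTransGen (Cong r) N N') :
    ReflTransGen (Cong r) (.lam M N) (.lam M' N') :=
  (hM.lift (Tm.lam · N) fun _ _ h => .lamA h).trans (hN.lift (Tm.lam M' ·) fun _ _ h => .lamM h)

theorem Cong.star_pi {r : Tm C → Tm C → Prop} {M M' N N' : Tm C}
    (hM : ReflTransGen (Cong r) M M') (hN : ReflTransGen (Cong r) N N') :
    ReflTransGen (Cong r) (.pi M N) (.pi M' N') :=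
  (hM.lift (Tm.pi · N) fun _ _ h => .piA h).trans (hN.lift (Tm.pi M' ·) fun _ _ h => .piB h)

theorem step_beta {R : Rules C} (A P Q : Tm C) :
    Step R (.app (.lam A P) Q) (Tm.substAt 0 Q P) :=
  .base (.inl ⟨A, P, Q, rfl, rfl⟩)

theorem step_elU {s₁ s₂ : S} (h : Ar s₁ s₂) :
    Step (rulesEPTS Ar Rr) (Elcon s₂ (ucon s₁)) (Ucon s₁) :=
  .base (.inr ⟨_, .inl (.u_red h), Tm.var, by simp [Elcon, ucon], by simp [Ucon]⟩)

theorem step_betaC {s₁ s₂ s₃ : S} (h : Rr s₁ s₂ s₃) (A B A' B' M N : Tm (EConst S)) :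
    Step (rulesEPTS Ar Rr) (appC s₁ s₂ A B (absC s₁ s₂ A' B' M) N) (.app M N) :=
  .base (.inr ⟨_, .inr (.beta h), fun n => [A, B, A', B', M, N].getD n .type,
    by simp [appC, absC], by simp⟩)

theorem Par.star_step {M N : Tm (EConst S)} (h : Par Ar Rr M N) :
    ReflTransGen (Step (rulesEPTS Ar Rr)) M N := by
  induction h with
  | var | type | kind => exact .refl
  | const hl _ ih =>
    exact Cong.star_const (List.forall₂_iff_zip.2 ⟨hl, fun hm => ih _ _ hm⟩) []
  | app _ _ ihM ihN => exact Cong.star_app ihM ihN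
  | lam _ _ ihM ihN => exact Cong.star_lam ihM ihN
  | pi _ _ ihM ihN => exact Cong.star_pi ihM ihN
  | beta _ _ ihP ihQ =>
    exact (Cong.star_app (Cong.star_lam .refl ihP) ihQ).tail (step_beta _ _ _)
  | elU h => exact .single (step_elU h)
  | betaC h _ _ ihM ihN => exact .head (step_betaC h ..) (Cong.star_app ihM ihN)

theorem Conv.of_star {M N : Tm (EConst S)} (h : ReflTransGen (Par Ar Rr) M N) :
    Conv (rulesEPTS Ar Rr) M N := by
  induction h with
  | refl => exact .refl _
  | tail _ h ih =>
    exact .trans _ _ _ ih (EqvGen.reflTransGen_le_eqvGen _ _ _ h.star_step)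

theorem Conv.of_par {M N : Tm (EConst S)} (h : Par Ar Rr M N) : Conv (rulesEPTS Ar Rr) M N :=
  .of_star (.single h)

/-- Church–Rosser property of the encoding. -/
theorem Conv.join {M N : Tm (EConst S)} (h : Conv (rulesEPTS Ar Rr) M N) :
    Join (ReflTransGen (Par Ar Rr)) M N := by
  have heq : Equivalence (Join (ReflTransGen (Par Ar Rr))) :=
    equivalence_join_reflTransGen fun a b c hab hac => by
      obtain ⟨Z, hZ, hZ'⟩ := hab.diamond c hac
      exact ⟨Z, .single hZ, .single hZ'⟩
  induction h with
  | rel _ _ h => exact ⟨_, .single (.of_step h), .refl⟩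
  | refl => exact heq.refl _
  | symm _ _ _ ih => exact heq.symm ih
  | trans _ _ _ _ _ ih ih' => exact heq.trans ih ih'

/-! ## Consequences of confluence -/

theorem Conv.congr₁ {f : Tm (EConst S) → Tm (EConst S)}
    (hf : ∀ {M N}, Par Ar Rr M N → Par Ar Rr (f M) (f N)) {M N : Tm (EConst S)}
    (h : Conv (rulesEPTS Ar Rr) M N) : Conv (rulesEPTS Ar Rr) (f M) (f N) := by
  induction h with
  | rel _ _ h => exact .of_par (hf (.of_step h))
  | refl => exact .refl _
  | symm _ _ _ ih => exact .symm _ _ ih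
  | trans _ _ _ _ _ ih ih' => exact .trans _ _ _ ih ih'

theorem Conv.congr₂ {f : Tm (EConst S) → Tm (EConst S) → Tm (EConst S)}
    (hf : ∀ {M N M' N'}, Par Ar Rr M N → Par Ar Rr M' N' → Par Ar Rr (f M M') (f N N'))
    {M N M' N' : Tm (EConst S)} (h : Conv (rulesEPTS Ar Rr) M N)
    (h' : Conv (rulesEPTS Ar Rr) M' N') : Conv (rulesEPTS Ar Rr) (f M M') (f N N') :=
  .trans _ (f N M') _ (h.congr₁ (f := (f · M')) fun h => hf h (.refl _))
    (h'.congr₁ (f := f N) fun h => hf (.refl _) h)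

theorem Conv.lam {A A' B B' : Tm (EConst S)} (hA : Conv (rulesEPTS Ar Rr) A A')
    (hB : Conv (rulesEPTS Ar Rr) B B') : Conv (rulesEPTS Ar Rr) (.lam A B) (.lam A' B') :=
  hA.congr₂ Par.lam hB

theorem Conv.El {s : S} {A A' : Tm (EConst S)} (hA : Conv (rulesEPTS Ar Rr) A A') :
    Conv (rulesEPTS Ar Rr) (Elcon s A) (Elcon s A') :=
  hA.congr₁ (f := Elcon s) fun h => .const_of_forall₂ (.cons h .nil)

theorem Conv.ProdC {s₁ s₂ : S} {A A' B B' : Tm (EConst S)} (hA : Conv (rulesEPTS Ar Rr) A A')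
    (hB : Conv (rulesEPTS Ar Rr) B B') :
    Conv (rulesEPTS Ar Rr) (ProdC s₁ s₂ A B) (ProdC s₁ s₂ A' B') :=
  hA.congr₂ (f := DKPaper.ProdC s₁ s₂) (fun h h' => .const_of_forall₂ (.cons h (.cons h' .nil))) hB

theorem Conv.ren {M N : Tm (EConst S)} (h : Conv (rulesEPTS Ar Rr) M N) (ρ : Nat → Nat) :
    Conv (rulesEPTS Ar Rr) (Tm.ren ρ M) (Tm.ren ρ N) :=
  h.congr₁ fun h => h.ren ρ

theorem Conv.substAt {M M' N N' : Tm (EConst S)} (hM : Conv (rulesEPTS Ar Rr) M M')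
    (hN : Conv (rulesEPTS Ar Rr) N N') :
    Conv (rulesEPTS Ar Rr) (Tm.substAt 0 N M) (Tm.substAt 0 N' M') :=
  hM.congr₂ (f := fun M N => Tm.substAt 0 N M) Par.substAt hN

theorem Conv.beta (A P Q : Tm (EConst S)) :
    Conv (rulesEPTS Ar Rr) (.app (.lam A P) Q) (Tm.substAt 0 Q P) :=
  .rel _ _ (step_beta A P Q)

theorem Conv.elU {s₁ s₂ : S} (h : Ar s₁ s₂) :
    Conv (rulesEPTS Ar Rr) (Elcon s₂ (ucon s₁)) (Ucon s₁) :=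
  .rel _ _ (step_elU h)

/-- Head symbols of types, which are invariant under reduction. -/
inductive Shape
  | pi | type | kind | base

def shape : Tm (EConst S) → Option Shape
  | .pi _ _ => some .pi
  | .type => some .type
  | .kind => some .kind
  | .const (.U _) _ => some .base
  | .const (.El _) _ => some .base
  | _ => none

theorem Par.shape_eq {M N : Tm (EConst S)} (h : Par Ar Rr M N) {k} (hM : shape M = some k) :
    shape N = some k := by
  cases h with
  | @const c => cases c <;> simp_all [shape]
  | _ => simp_all [shape]

theorem star_shape_eq {M N : Tm (EConst S)} (h : ReflTransGen (Par Ar Rr) M N) {k}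
    (hM : shape M = some k) : shape N = some k := by
  induction h with
  | refl => exact hM
  | tail _ h ih => exact h.shape_eq ih

theorem Conv.shape_eq {M N : Tm (EConst S)} (h : Conv (rulesEPTS Ar Rr) M N) {k l}
    (hM : shape M = some k) (hN : shape N = some l) : k = l := by
  obtain ⟨Z, h₁, h₂⟩ := h.join
  exact Option.some.inj ((star_shape_eq h₁ hM).symm.trans (star_shape_eq h₂ hN))

theorem star_pi_inv {A B X : Tm (EConst S)} (h : ReflTransGen (Par Ar Rr) (.pi A B) X) :
    ∃ A' B', X = .pi A' B' ∧ ReflTransGen (Par Ar Rr) A A' ∧ ReflTransGen (Par Ar Rr) B B' := by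
  induction h with
  | refl => exact ⟨_, _, rfl, .refl, .refl⟩
  | tail _ h ih =>
    obtain ⟨A', B', rfl, hA, hB⟩ := ih
    obtain ⟨A'', B'', rfl, hA', hB'⟩ := h.pi_inv
    exact ⟨_, _, rfl, hA.tail hA', hB.tail hB'⟩

theorem Conv.pi_inj {A B A' B' : Tm (EConst S)}
    (h : Conv (rulesEPTS Ar Rr) (.pi A B) (.pi A' B')) :
    Conv (rulesEPTS Ar Rr) A A' ∧ Conv (rulesEPTS Ar Rr) B B' := by
  obtain ⟨Z, h₁, h₂⟩ := h.join
  obtain ⟨_, _, rfl, hA, hB⟩ := star_pi_inv h₁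
  obtain ⟨_, _, h, hA', hB'⟩ := star_pi_inv h₂
  cases h
  exact ⟨EqvGen.trans _ _ _ (Conv.of_star hA) (.symm _ _ (Conv.of_star hA')),
    EqvGen.trans _ _ _ (Conv.of_star hB) (.symm _ _ (Conv.of_star hB'))⟩

theorem star_U_inv {s : S} {X : Tm (EConst S)} (h : ReflTransGen (Par Ar Rr) (Ucon s) X) :
    X = Ucon s := by
  induction h with
  | refl => rfl
  | tail _ h ih => subst ih; exact h.U_inv

theorem star_El_inv {s : S} {A X : Tm (EConst S)} (h : ReflTransGen (Par Ar Rr) (Elcon s A) X) :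
    (∃ A', X = Elcon s A' ∧ ReflTransGen (Par Ar Rr) A A') ∨
    (∃ t, X = Ucon t ∧ Ar t s ∧ ReflTransGen (Par Ar Rr) A (ucon t)) := by
  induction h with
  | refl => exact .inl ⟨_, rfl, .refl⟩
  | tail _ h ih =>
    rcases ih with ⟨A', rfl, hA⟩ | ⟨t, rfl, ht, hA⟩
    · rcases h.El_inv with ⟨A'', rfl, hA'⟩ | ⟨t, rfl, rfl, ht⟩
      · exact .inl ⟨_, rfl, hA.tail hA'⟩
      · exact .inr ⟨_, rfl, ht, hA⟩
    · exact .inr ⟨t, h.U_inv, ht, hA⟩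

theorem Conv.U_inj {s t : S} (h : Conv (rulesEPTS Ar Rr) (Ucon s) (Ucon t)) : s = t := by
  obtain ⟨Z, h₁, h₂⟩ := h.join
  cases star_U_inv h₁
  cases star_U_inv h₂
  rfl

theorem Conv.El_U {s t : S} {A : Tm (EConst S)}
    (h : Conv (rulesEPTS Ar Rr) (Elcon s A) (Ucon t)) :
    Ar t s ∧ Conv (rulesEPTS Ar Rr) A (ucon t) := by
  obtain ⟨Z, h₁, h₂⟩ := h.join
  cases star_U_inv h₂
  rcases star_El_inv h₁ with ⟨A', h, _⟩ | ⟨t', h, ht, hA⟩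
  · cases h
  · cases h
    exact ⟨ht, .of_star hA⟩

theorem Conv.El_inj {s t : S} {A B : Tm (EConst S)}
    (h : Conv (rulesEPTS Ar Rr) (Elcon s A) (Elcon t B)) : Conv (rulesEPTS Ar Rr) A B := by
  obtain ⟨Z, h₁, h₂⟩ := h.join
  rcases star_El_inv h₁ with ⟨A', rfl, hA⟩ | ⟨r, rfl, hr, hA⟩ <;>
  rcases star_El_inv h₂ with ⟨B', h, hB⟩ | ⟨r', h, hr', hB⟩ <;> cases h
  · exact .trans _ _ _ (Conv.of_star hA) (.symm _ _ (Conv.of_star hB))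
  · exact .trans _ _ _ (Conv.of_star hA) (.symm _ _ (Conv.of_star hB))

/-! ## Simulation between EPTS and Dedukti reductions -/

section EStar
variable {s₁ s₂ : S} {A A' B B' M M' N N' : ETm S}

theorem EStep.star_pi (hA : ReflTransGen (EStep Rr) A A') (hB : ReflTransGen (EStep Rr) B B') :
    ReflTransGen (EStep Rr) (.pi s₁ s₂ A B) (.pi s₁ s₂ A' B') :=
  (hA.lift (ETm.pi s₁ s₂ · B) fun _ _ h => .piA h).trans
    (hB.lift (ETm.pi s₁ s₂ A' ·) fun _ _ h => .piB h)

theorem EStep.star_lam (hA : ReflTransGen (EStep Rr) A A') (hB : ReflTransGen (EStep Rr) B B')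
    (hM : ReflTransGen (EStep Rr) M M') :
    ReflTransGen (EStep Rr) (.lam s₁ s₂ A B M) (.lam s₁ s₂ A' B' M') :=
  (hA.lift (ETm.lam s₁ s₂ · B M) fun _ _ h => .lamA h).trans <|
    (hB.lift (ETm.lam s₁ s₂ A' · M) fun _ _ h => .lamB h).trans
    (hM.lift (ETm.lam s₁ s₂ A' B' ·) fun _ _ h => .lamM h)

theorem EStep.star_app (hA : ReflTransGen (EStep Rr) A A') (hB : ReflTransGen (EStep Rr) B B')
    (hM : ReflTransGen (EStep Rr) M M') (hN : ReflTransGen (EStep Rr) N N') :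
    ReflTransGen (EStep Rr) (.app s₁ s₂ A B M N) (.app s₁ s₂ A' B' M' N') :=
  (hA.lift (ETm.app s₁ s₂ · B M N) fun _ _ h => .appA h).trans <|
    (hB.lift (ETm.app s₁ s₂ A' · M N) fun _ _ h => .appB h).trans <|
    (hM.lift (ETm.app s₁ s₂ A' B' · N) fun _ _ h => .appM h).trans
    (hN.lift (ETm.app s₁ s₂ A' B' M' ·) fun _ _ h => .appN h)

theorem EStep.sub (h : EStep Rr M N) :
    ∀ σ : Nat → ETm S, EStep Rr (ETm.sub σ M) (ETm.sub σ N) := by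
  induction h with
  | base h =>
    intro σ
    obtain ⟨s₁, s₂, s₃, A, B, A', B', P, Q, hR, rfl, rfl⟩ := h
    rw [ETm.sub_substAt]
    exact .base ⟨s₁, s₂, s₃, _, _, _, _, _, _, hR, rfl, rfl⟩
  | piA _ ih => exact fun σ => .piA (ih _)
  | piB _ ih => exact fun σ => .piB (ih _)
  | lamA _ ih => exact fun σ => .lamA (ih _)
  | lamB _ ih => exact fun σ => .lamB (ih _)
  | lamM _ ih => exact fun σ => .lamM (ih _)
  | appA _ ih => exact fun σ => .appA (ih _)
  | appB _ ih => exact fun σ => .appB (ih _)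
  | appM _ ih => exact fun σ => .appM (ih _)
  | appN _ ih => exact fun σ => .appN (ih _)

theorem EStep.ren (h : EStep Rr M N) (ρ : Nat → Nat) : EStep Rr (ETm.ren ρ M) (ETm.ren ρ N) := by
  rw [ETm.ren_eq_sub, ETm.ren_eq_sub]; exact h.sub _

theorem EStep.star_sub_right (M : ETm S) : ∀ σ τ : Nat → ETm S,
    (∀ n, ReflTransGen (EStep Rr) (σ n) (τ n)) →
    ReflTransGen (EStep Rr) (ETm.sub σ M) (ETm.sub τ M) := by
  have hlift {σ τ : Nat → ETm S} (h : ∀ n, ReflTransGen (EStep Rr) (σ n) (τ n)) (n : Nat) :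
      ReflTransGen (EStep Rr) (ETm.liftSub σ n) (ETm.liftSub τ n) := by
    cases n with
    | zero => exact .refl
    | succ n => exact (h n).lift _ fun _ _ h => h.ren _
  induction M with
  | var n => exact fun σ τ h => h n
  | sort s => exact fun σ τ h => .refl
  | pi _ _ _ _ ihA ihB => exact fun σ τ h => star_pi (ihA _ _ h) (ihB _ _ (hlift h))
  | lam _ _ _ _ _ ihA ihB ihM =>
    exact fun σ τ h => star_lam (ihA _ _ h) (ihB _ _ (hlift h)) (ihM _ _ (hlift h))
  | app _ _ _ _ _ _ ihA ihB ihM ihN =>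
    exact fun σ τ h => star_app (ihA _ _ h) (ihB _ _ (hlift h)) (ihM _ _ h) (ihN _ _ h)

theorem EStep.star_substAt (hM : ReflTransGen (EStep Rr) M M')
    (hN : ReflTransGen (EStep Rr) N N') :
    ReflTransGen (EStep Rr) (ETm.substAt 0 N M) (ETm.substAt 0 N' M') := by
  simp only [ETm.substAt_zero]
  refine (hM.lift _ fun _ _ h => h.sub _).trans (star_sub_right _ _ _ fun n => ?_)
  cases n with
  | zero => exact hN
  | succ n => exact .refl

theorem EStep.star_lam_inv {X : ETm S} (h : ReflTransGen (EStep Rr) (.lam s₁ s₂ A B M) X) :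
    ∃ A' B' M', X = .lam s₁ s₂ A' B' M' ∧ ReflTransGen (EStep Rr) A A' ∧
      ReflTransGen (EStep Rr) B B' ∧ ReflTransGen (EStep Rr) M M' := by
  induction h with
  | refl => exact ⟨_, _, _, rfl, .refl, .refl, .refl⟩
  | tail _ h ih =>
    obtain ⟨A', B', M', rfl, hA, hB, hM⟩ := ih
    cases h with
    | base h => obtain ⟨_, _, _, _, _, _, _, _, _, _, h, _⟩ := h; cases h
    | lamA h => exact ⟨_, _, _, rfl, hA.tail h, hB, hM⟩
    | lamB h => exact ⟨_, _, _, rfl, hA, hB.tail h, hM⟩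
    | lamM h => exact ⟨_, _, _, rfl, hA, hB, hM.tail h⟩

theorem EStep.star_pi_inv {X : ETm S} (h : ReflTransGen (EStep Rr) (.pi s₁ s₂ A B) X) :
    ∃ A' B', X = .pi s₁ s₂ A' B' ∧ ReflTransGen (EStep Rr) A A' ∧
      ReflTransGen (EStep Rr) B B' := by
  induction h with
  | refl => exact ⟨_, _, rfl, .refl, .refl⟩
  | tail _ h ih =>
    obtain ⟨A', B', rfl, hA, hB⟩ := ih
    cases h with
    | base h => obtain ⟨_, _, _, _, _, _, _, _, _, _, h, _⟩ := h; cases h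
    | piA h => exact ⟨_, _, rfl, hA.tail h, hB⟩
    | piB h => exact ⟨_, _, rfl, hA, hB.tail h⟩

theorem EStep.star_sort_inv {s : S} {X : ETm S} (h : ReflTransGen (EStep Rr) (.sort s) X) :
    X = .sort s := by
  induction h with
  | refl => rfl
  | tail _ h ih =>
    subst ih
    cases h with
    | base h => obtain ⟨_, _, _, _, _, _, _, _, _, _, h, _⟩ := h; cases h

end EStar

theorem trans_star_step {M N : ETm S} (h : EStep Rr M N) :
    ReflTransGen (Step (rulesEPTS Ar Rr)) (trans M) (trans N) := by
  have hEl {s : S} {A A' : Tm (EConst S)} (h : ReflTransGen (Step (rulesEPTS Ar Rr)) A A') :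
      ReflTransGen (Step (rulesEPTS Ar Rr)) (Elcon s A) (Elcon s A') :=
    Cong.star_const (.cons h .nil) []
  induction h with
  | base h =>
    obtain ⟨s₁, s₂, s₃, A, B, A', B', P, Q, hR, rfl, rfl⟩ := h
    rw [← trans_substAt]
    exact .head (step_betaC hR ..) (.single (step_beta ..))
  | piA _ ih =>
    exact Cong.star_const (.cons ih (.cons (Cong.star_lam (hEl ih) .refl) .nil)) []
  | piB _ ih =>
    exact Cong.star_const (.cons .refl (.cons (Cong.star_lam .refl ih) .nil)) []
  | lamA _ ih =>
    exact Cong.star_const (.cons ih (.cons (Cong.star_lam (hEl ih) .refl)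
      (.cons (Cong.star_lam (hEl ih) .refl) .nil))) []
  | lamB _ ih =>
    exact Cong.star_const (.cons .refl (.cons (Cong.star_lam .refl ih) (.cons .refl .nil))) []
  | lamM _ ih =>
    exact Cong.star_const (.cons .refl (.cons .refl (.cons (Cong.star_lam .refl ih) .nil))) []
  | appA _ ih =>
    exact Cong.star_const (.cons ih (.cons (Cong.star_lam (hEl ih) .refl)
      (.cons .refl (.cons .refl .nil)))) []
  | appB _ ih =>
    exact Cong.star_const (.cons .refl (.cons (Cong.star_lam .refl ih)
      (.cons .refl (.cons .refl .nil)))) []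
  | appM _ ih =>
    exact Cong.star_const (.cons .refl (.cons .refl (.cons ih (.cons .refl .nil)))) []
  | appN _ ih =>
    exact Cong.star_const (.cons .refl (.cons .refl (.cons .refl (.cons ih .nil)))) []

/-- The graph of the inverse translation on invertible forms. -/
inductive InvGraph : Tm (EConst S) → ETm S → Prop
  | var (n) : InvGraph (.var n) (.var n)
  | u (s) : InvGraph (.const (.u s) []) (.sort s)
  | abs {s₁ s₂ A T₁ B T₂ M a b m} : InvGraph A a → InvGraph B b → InvGraph M m →
      InvGraph (.const (.abs s₁ s₂) [A, .lam T₁ B, .lam T₂ M]) (.lam s₁ s₂ a b m)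
  | beta {T M N m n} : InvGraph M m → InvGraph N n →
      InvGraph (.app (.lam T M) N) (ETm.substAt 0 n m)
  | prod {s₁ s₂ A T₁ B a b} : InvGraph A a → InvGraph B b →
      InvGraph (.const (.Prod s₁ s₂) [A, .lam T₁ B]) (.pi s₁ s₂ a b)
  | app {s₁ s₂ A T₁ B M N a b m n} : InvGraph A a → InvGraph B b → InvGraph M m →
      InvGraph N n →
      InvGraph (.const (.app s₁ s₂) [A, .lam T₁ B, M, N]) (.app s₁ s₂ a b m n)

theorem InvGraph.trans (M : ETm S) : InvGraph (DKPaper.trans M) M := by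
  induction M with
  | var n => exact .var n
  | sort s => exact .u s
  | pi _ _ _ _ ihA ihB => exact .prod ihA ihB
  | lam _ _ _ _ _ ihA ihB ihM => exact .abs ihA ihB ihM
  | app _ _ _ _ _ _ ihA ihB ihM ihN => exact .app ihA ihB ihM ihN

theorem InvGraph.eq_of_trans {N : ETm S} : ∀ {M}, InvGraph (DKPaper.trans N) M → M = N := by
  induction N with
  | var n => intro _ h; cases h; rfl
  | sort s => intro _ h; cases h; rfl
  | pi _ _ _ _ ihA ihB =>
    intro _ h
    cases h with
    | prod hA hB => rw [ihA hA, ihB hB]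
  | lam _ _ _ _ _ ihA ihB ihM =>
    intro _ h
    cases h with
    | abs hA hB hM => rw [ihA hA, ihB hB, ihM hM]
  | app _ _ _ _ _ _ ihA ihB ihM ihN =>
    intro _ h
    cases h with
    | app hA hB hM hN => rw [ihA hA, ihB hB, ihM hM, ihN hN]

theorem InvGraph.ren {M : Tm (EConst S)} {m : ETm S} (h : InvGraph M m) :
    ∀ ρ : Nat → Nat, InvGraph (Tm.ren ρ M) (ETm.ren ρ m) := by
  induction h with
  | var n => intro ρ; simpa [ETm.ren] using var (ρ n)
  | u s => intro ρ; simpa [ETm.ren] using u s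
  | abs _ _ _ ihA ihB ihM => intro ρ; simpa [ETm.ren] using abs (ihA _) (ihB _) (ihM _)
  | beta _ _ ihM ihN =>
    intro ρ; rw [ETm.ren_substAt]; simpa [ETm.ren] using beta (ihM _) (ihN _)
  | prod _ _ ihA ihB => intro ρ; simpa [ETm.ren] using prod (ihA _) (ihB _)
  | app _ _ _ _ ihA ihB ihM ihN => intro ρ; simpa [ETm.ren] using app (ihA _) (ihB _) (ihM _) (ihN _)

theorem InvGraph.liftSub {σ : Nat → Tm (EConst S)} {τ : Nat → ETm S}
    (h : ∀ n, InvGraph (σ n) (τ n)) (n : Nat) :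
    InvGraph (Tm.liftSub σ n) (ETm.liftSub τ n) := by
  cases n with
  | zero => exact .var 0
  | succ n => exact (h n).ren _

theorem InvGraph.sub {M : Tm (EConst S)} {m : ETm S} (h : InvGraph M m) :
    ∀ (σ : Nat → Tm (EConst S)) (τ : Nat → ETm S), (∀ n, InvGraph (σ n) (τ n)) →
      InvGraph (Tm.sub σ M) (ETm.sub τ m) := by
  induction h with
  | var n => intro σ τ h; simpa [ETm.sub] using h n
  | u s => intro σ τ h; simpa [ETm.sub] using u s
  | abs _ _ _ ihA ihB ihM =>
    intro σ τ h
    simpa [ETm.sub] using abs (ihA _ _ h) (ihB _ _ (liftSub h)) (ihM _ _ (liftSub h))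
  | beta _ _ ihM ihN =>
    intro σ τ h
    rw [ETm.sub_substAt]
    simpa [ETm.sub] using beta (ihM _ _ (liftSub h)) (ihN _ _ h)
  | prod _ _ ihA ihB => intro σ τ h; simpa [ETm.sub] using prod (ihA _ _ h) (ihB _ _ (liftSub h))
  | app _ _ _ _ ihA ihB ihM ihN =>
    intro σ τ h
    simpa [ETm.sub] using app (ihA _ _ h) (ihB _ _ (liftSub h)) (ihM _ _ h) (ihN _ _ h)

theorem InvGraph.substAt {M N : Tm (EConst S)} {m n : ETm S} (hM : InvGraph M m)
    (hN : InvGraph N n) : InvGraph (Tm.substAt 0 N M) (ETm.substAt 0 n m) := by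
  rw [Tm.substAt_zero, ETm.substAt_zero]
  refine hM.sub _ _ fun k => ?_
  cases k with
  | zero => exact hN
  | succ k => exact .var k

/-- The inverse translation preserves computation. -/
theorem InvGraph.par {M : Tm (EConst S)} {m : ETm S} (h : InvGraph M m) :
    ∀ {M'}, Par Ar Rr M M' → ∃ m', InvGraph M' m' ∧ ReflTransGen (EStep Rr) m m' := by
  induction h with
  | var n => intro _ h; cases h; exact ⟨_, .var n, .refl⟩
  | u s => intro _ h; cases h.u_inv; exact ⟨_, .u s, .refl⟩
  | abs _ _ _ ihA ihB ihM =>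
    intro _ h
    obtain ⟨A', B', M', rfl, hA, hB, hM⟩ := h.abs_inv
    obtain ⟨_, _, rfl, -, hB⟩ := hB.lam_inv
    obtain ⟨_, _, rfl, -, hM⟩ := hM.lam_inv
    obtain ⟨a, ha, ha'⟩ := ihA hA
    obtain ⟨b, hb, hb'⟩ := ihB hB
    obtain ⟨m, hm, hm'⟩ := ihM hM
    exact ⟨_, .abs ha hb hm, EStep.star_lam ha' hb' hm'⟩
  | prod _ _ ihA ihB =>
    intro _ h
    obtain ⟨A', B', rfl, hA, hB⟩ := h.prod_inv
    obtain ⟨_, _, rfl, -, hB⟩ := hB.lam_inv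
    obtain ⟨a, ha, ha'⟩ := ihA hA
    obtain ⟨b, hb, hb'⟩ := ihB hB
    exact ⟨_, .prod ha hb, EStep.star_pi ha' hb'⟩
  | beta _ _ ihM ihN =>
    intro _ h
    cases h with
    | app hM hN =>
      obtain ⟨_, _, rfl, -, hM⟩ := hM.lam_inv
      obtain ⟨m, hm, hm'⟩ := ihM hM
      obtain ⟨n, hn, hn'⟩ := ihN hN
      exact ⟨_, .beta hm hn, EStep.star_substAt hm' hn'⟩
    | beta hM hN =>
      obtain ⟨m, hm, hm'⟩ := ihM hM
      obtain ⟨n, hn, hn'⟩ := ihN hN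
      exact ⟨_, hm.substAt hn, EStep.star_substAt hm' hn'⟩
  | app _ _ h₀ _ ihA ihB ihM ihN =>
    intro _ h
    rcases h.app_inv with ⟨A', B', M', N', rfl, hA, hB, hM, hN⟩ |
      ⟨s₃, A', B', P, P', N', rfl, rfl, hR, hP, hN⟩
    · obtain ⟨_, _, rfl, -, hB⟩ := hB.lam_inv
      obtain ⟨a, ha, ha'⟩ := ihA hA
      obtain ⟨b, hb, hb'⟩ := ihB hB
      obtain ⟨m, hm, hm'⟩ := ihM hM
      obtain ⟨n, hn, hn'⟩ := ihN hN
      exact ⟨_, .app ha hb hm hn, EStep.star_app ha' hb' hm' hn'⟩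
    · obtain ⟨n, hn, hn'⟩ := ihN hN
      obtain ⟨m, hm, hm'⟩ := ihM (.const_of_forall₂
        (.cons (.refl _) (.cons (.refl _) (.cons hP .nil))))
      cases h₀ with
      | abs hA hB hP₀ =>
        obtain ⟨a, b, p, rfl, -, -, hp⟩ := EStep.star_lam_inv hm'
        cases hm with
        | abs _ _ hp₀ =>
          refine ⟨_, .beta hp₀ hn, .head ?_ (EStep.star_substAt hp hn')⟩
          exact .base ⟨_, _, _, _, _, _, _, _, _, hR, rfl, rfl⟩

theorem InvGraph.star {M M' : Tm (EConst S)} {m : ETm S} (h : InvGraph M m)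
    (hM : ReflTransGen (Par Ar Rr) M M') :
    ∃ m', InvGraph M' m' ∧ ReflTransGen (EStep Rr) m m' := by
  induction hM with
  | refl => exact ⟨m, h, .refl⟩
  | tail _ hM ih =>
    obtain ⟨m₁, h₁, hm₁⟩ := ih
    obtain ⟨m₂, h₂, hm₂⟩ := h₁.par hM
    exact ⟨m₂, h₂, hm₁.trans hm₂⟩

theorem star_step_trans_iff (M N : ETm S) : ReflTransGen (EStep Rr) M N ↔
    ReflTransGen (Step (rulesEPTS Ar Rr)) (trans M) (trans N) := by
  constructor
  · intro h
    induction h with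
    | refl => exact .refl
    | tail _ h ih => exact ih.trans (trans_star_step h)
  · intro h
    obtain ⟨N', hN', h⟩ := (InvGraph.trans M).star (h.lift id fun _ _ h => Par.of_step h)
    rwa [hN'.eq_of_trans] at h

theorem InvGraph.unique {M : Tm (EConst S)} {m m' : ETm S} (h : InvGraph M m)
    (h' : InvGraph M m') : m = m' := by
  induction h generalizing m' with
  | var n => cases h'; rfl
  | u s => cases h'; rfl
  | abs _ _ _ ihA ihB ihM =>
    cases h' with
    | abs hA hB hM => rw [ihA hA, ihB hB, ihM hM]
  | beta _ _ ihM ihN =>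
    cases h' with
    | beta hM hN => rw [ihM hM, ihN hN]
  | prod _ _ ihA ihB =>
    cases h' with
    | prod hA hB => rw [ihA hA, ihB hB]
  | app _ _ _ _ ihA ihB ihM ihN =>
    cases h' with
    | app hA hB hM hN => rw [ihA hA, ihB hB, ihM hM, ihN hN]

theorem InvGraph.inv_eq {M : Tm (EConst S)} {m : ETm S} (h : InvGraph M m) :
    inv M = some m := by
  induction h with
  | var n => rw [inv]
  | u s => rw [inv]
  | abs _ _ _ ihA ihB ihM => rw [inv, ihA, ihB, ihM]; rfl
  | beta _ _ ihM ihN => rw [inv, ihM, ihN]; rfl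
  | prod _ _ ihA ihB => rw [inv, ihA, ihB]; rfl
  | app _ _ _ _ ihA ihB ihM ihN => rw [inv, ihA, ihB, ihM, ihN]; rfl

theorem join_of_conv_trans {M N : ETm S} (h : Conv (rulesEPTS Ar Rr) (trans M) (trans N)) :
    Join (ReflTransGen (EStep Rr)) M N := by
  obtain ⟨Z, h₁, h₂⟩ := h.join
  obtain ⟨M', h₁, hM⟩ := (InvGraph.trans M).star h₁
  obtain ⟨N', h₂, hN⟩ := (InvGraph.trans N).star h₂
  cases h₁.unique h₂
  exact ⟨M', hM, hN⟩

theorem EConv.of_star {M N : ETm S} (h : ReflTransGen (EStep Rr) M N) : EConv Rr M N :=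
  EqvGen.reflTransGen_le_eqvGen _ _ _ h

theorem EConv.trans_conv {M N : ETm S} (h : EConv Rr M N) :
    Conv (rulesEPTS Ar Rr) (trans M) (trans N) := by
  induction h with
  | rel _ _ h => exact EqvGen.reflTransGen_le_eqvGen _ _ _ (trans_star_step h)
  | refl => exact .refl _
  | symm _ _ _ ih => exact .symm _ _ ih
  | trans _ _ _ _ _ ih ih' => exact .trans _ _ _ ih ih'

/-- Church–Rosser property of the EPTS. -/
theorem EConv.join {M N : ETm S} (h : EConv Rr M N) : Join (ReflTransGen (EStep Rr)) M N :=
  join_of_conv_trans (Ar := fun _ _ => False) h.trans_conv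

theorem EConv.of_join {M N : ETm S} (h : Join (ReflTransGen (EStep Rr)) M N) : EConv Rr M N :=
  let ⟨_, h₁, h₂⟩ := h
  EqvGen.trans _ _ _ (EConv.of_star h₁) (.symm _ _ (EConv.of_star h₂))

theorem EConv.sub {M N : ETm S} (h : EConv Rr M N) (σ : Nat → ETm S) :
    EConv Rr (ETm.sub σ M) (ETm.sub σ N) := by
  obtain ⟨Z, h₁, h₂⟩ := h.join
  exact .of_join ⟨_, h₁.lift _ fun _ _ h => h.sub σ, h₂.lift _ fun _ _ h => h.sub σ⟩

theorem EConv.ren {M N : ETm S} (h : EConv Rr M N) (ρ : Nat → Nat) :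
    EConv Rr (ETm.ren ρ M) (ETm.ren ρ N) := by
  rw [ETm.ren_eq_sub, ETm.ren_eq_sub]; exact h.sub _

theorem EConv.pi_inj {s₁ s₂ t₁ t₂ : S} {A B A' B' : ETm S}
    (h : EConv Rr (.pi s₁ s₂ A B) (.pi t₁ t₂ A' B')) :
    s₁ = t₁ ∧ s₂ = t₂ ∧ EConv Rr A A' ∧ EConv Rr B B' := by
  obtain ⟨Z, h₁, h₂⟩ := h.join
  obtain ⟨_, _, rfl, hA, hB⟩ := EStep.star_pi_inv h₁
  obtain ⟨_, _, h, hA', hB'⟩ := EStep.star_pi_inv h₂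
  cases h
  exact ⟨rfl, rfl, .of_join ⟨_, hA, hA'⟩, .of_join ⟨_, hB, hB'⟩⟩

theorem EConv.sort_inj {s t : S} (h : EConv Rr (.sort s) (.sort t)) : s = t := by
  obtain ⟨Z, h₁, h₂⟩ := h.join
  cases EStep.star_sort_inv h₁
  cases EStep.star_sort_inv h₂
  rfl

/-! ## Metatheory of EPTSs -/

section EPTS
variable {Γ Γ' : List (ETm S)} {A A' B B' M M' N T : ETm S}

theorem ETyped.ind {P : ∀ Γ M A, ETyped Ar Rr Γ M A → Prop}
    (sort : ∀ {Γ s₁ s₂} (w : EWf Ar Rr Γ) (h : Ar s₁ s₂), P Γ _ _ (.sort w h))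
    (var : ∀ {Γ n A} (w : EWf Ar Rr Γ) (h : Γ[n]? = some A), P Γ _ _ (.var w h))
    (conv : ∀ {Γ M A B s} (h : ETyped Ar Rr Γ M A) (h' : ETyped Ar Rr Γ B (.sort s))
      (e : EConv Rr A B), P _ _ _ h → P _ _ _ h' → P _ _ _ (.conv h h' e))
    (pi : ∀ {Γ s₁ s₂ s₃ A B} (r : Rr s₁ s₂ s₃) (h : ETyped Ar Rr Γ A (.sort s₁))
      (h' : ETyped Ar Rr (A :: Γ) B (.sort s₂)), P _ _ _ h → P _ _ _ h' →
      P _ _ _ (.pi r h h'))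
    (lam : ∀ {Γ s₁ s₂ s₃ A B M} (r : Rr s₁ s₂ s₃) (h : ETyped Ar Rr Γ A (.sort s₁))
      (h' : ETyped Ar Rr (A :: Γ) B (.sort s₂)) (h'' : ETyped Ar Rr (A :: Γ) M B),
      P _ _ _ h → P _ _ _ h' → P _ _ _ h'' → P _ _ _ (.lam r h h' h''))
    (app : ∀ {Γ s₁ s₂ s₃ A B M N} (r : Rr s₁ s₂ s₃) (h : ETyped Ar Rr Γ A (.sort s₁))
      (h' : ETyped Ar Rr (A :: Γ) B (.sort s₂)) (h₁ : ETyped Ar Rr Γ N A)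
      (h₂ : ETyped Ar Rr Γ M (.pi s₁ s₂ A B)), P _ _ _ h → P _ _ _ h' → P _ _ _ h₁ →
      P _ _ _ h₂ → P _ _ _ (.app r h h' h₁ h₂))
    {Γ : List (ETm S)} {M A : ETm S} (h : ETyped Ar Rr Γ M A) : P Γ M A h :=
  ETyped.rec (motive_1 := fun _ _ => True) (motive_2 := P)
    trivial (fun _ _ => trivial) (fun h h' _ => sort h h') (fun h h' _ => var h h')
    conv pi lam app h

theorem ETyped.wf (h : ETyped Ar Rr Γ M A) : EWf Ar Rr Γ := by
  induction h using ETyped.ind <;> assumption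

def ERenOK (ρ : Nat → Nat) (Γ Γ' : List (ETm S)) : Prop :=
  ∀ n A, Γ[n]? = some A → ∃ A', Γ'[ρ n]? = some A' ∧
    ETm.ren (· + (ρ n + 1)) A' = ETm.ren ρ (ETm.ren (· + (n + 1)) A)

theorem ERenOK.lift {ρ : Nat → Nat} (h : ERenOK ρ Γ Γ') (A : ETm S) :
    ERenOK (Tm.liftRen ρ) (A :: Γ) (ETm.ren ρ A :: Γ') := by
  intro n B hB
  cases n with
  | zero =>
    simp only [List.getElem?_cons_zero, Option.some.injEq] at hB
    subst hB
    refine ⟨_, rfl, ?_⟩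
    simp only [ETm.ren_ren]; rfl
  | succ n =>
    obtain ⟨B', h₁, h₂⟩ := h n B hB
    refine ⟨B', h₁, ?_⟩
    have := congrArg (ETm.ren Nat.succ) h₂
    simp only [ETm.ren_ren] at this ⊢
    exact this

theorem ERenOK.succ (A : ETm S) : ERenOK Nat.succ Γ (A :: Γ) := by
  intro n B hB
  refine ⟨B, hB, ?_⟩
  simp only [ETm.ren_ren]; rfl

theorem ETyped.ren (h : ETyped Ar Rr Γ M A) :
    ∀ {ρ Γ'}, ERenOK ρ Γ Γ' → EWf Ar Rr Γ' → ETyped Ar Rr Γ' (ETm.ren ρ M) (ETm.ren ρ A) := by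
  induction h using ETyped.ind with
  | sort _ h => intro ρ Γ' hρ hΓ'; exact .sort hΓ' h
  | var _ h =>
    intro ρ Γ' hρ hΓ'
    obtain ⟨A', h₁, h₂⟩ := hρ _ _ h
    rw [← h₂]; exact .var hΓ' h₁
  | conv _ _ e ih ih' => intro ρ Γ' hρ hΓ'; exact .conv (ih hρ hΓ') (ih' hρ hΓ') (e.ren ρ)
  | pi r _ _ ih ih' =>
    intro ρ Γ' hρ hΓ'
    exact .pi r (ih hρ hΓ') (ih' (hρ.lift _) (.decl (ih hρ hΓ')))
  | lam r _ _ _ ih ih' ih'' =>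
    intro ρ Γ' hρ hΓ'
    have w := EWf.decl (ih hρ hΓ')
    exact .lam r (ih hρ hΓ') (ih' (hρ.lift _) w) (ih'' (hρ.lift _) w)
  | app r _ _ _ _ ih ih' ih₁ ih₂ =>
    intro ρ Γ' hρ hΓ'
    have w := EWf.decl (ih hρ hΓ')
    rw [ETm.ren_substAt]
    exact .app r (ih hρ hΓ') (ih' (hρ.lift _) w) (ih₁ hρ hΓ') (ih₂ hρ hΓ')

theorem ETyped.weaken (h : ETyped Ar Rr Γ M A) (hΓ : EWf Ar Rr (B :: Γ)) :
    ETyped Ar Rr (B :: Γ) (ETm.ren Nat.succ M) (ETm.ren Nat.succ A) :=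
  h.ren (.succ B) hΓ

def ESubOK (Ar : S → S → Prop) (Rr : S → S → S → Prop) (σ : Nat → ETm S)
    (Γ Γ' : List (ETm S)) : Prop :=
  ∀ n A, Γ[n]? = some A → ETyped Ar Rr Γ' (σ n) (ETm.sub σ (ETm.ren (· + (n + 1)) A))

theorem ESubOK.cons {σ : Nat → ETm S} (h : ∀ n B, Γ[n]? = some B →
      ETyped Ar Rr Γ' (σ (n + 1)) (ETm.sub (σ ∘ Nat.succ) (ETm.ren (· + (n + 1)) B)))
    (h₀ : ETyped Ar Rr Γ' (σ 0) (ETm.sub (σ ∘ Nat.succ) A)) : ESubOK Ar Rr σ (A :: Γ) Γ' := by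
  intro n B hB
  cases n with
  | zero =>
    simp only [List.getElem?_cons_zero, Option.some.injEq] at hB
    subst hB
    rw [ETm.sub_ren]; exact h₀
  | succ n =>
    have := h n B hB
    rw [ETm.sub_ren] at this ⊢
    exact this

theorem ESubOK.lift {σ : Nat → ETm S} (h : ESubOK Ar Rr σ Γ Γ') {A : ETm S}
    (hA : EWf Ar Rr (ETm.sub σ A :: Γ')) :
    ESubOK Ar Rr (ETm.liftSub σ) (A :: Γ) (ETm.sub σ A :: Γ') := by
  have e : ETm.liftSub σ ∘ Nat.succ = ETm.ren Nat.succ ∘ σ := rfl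
  refine .cons (fun n B hB => ?_) ?_
  · rw [e, ← ETm.ren_sub]; exact (h n B hB).weaken hA
  · rw [e, ← ETm.ren_sub]; exact .var hA rfl

theorem ETyped.sub (h : ETyped Ar Rr Γ M A) :
    ∀ {σ Γ'}, ESubOK Ar Rr σ Γ Γ' → EWf Ar Rr Γ' →
      ETyped Ar Rr Γ' (ETm.sub σ M) (ETm.sub σ A) := by
  induction h using ETyped.ind with
  | sort _ h => intro σ Γ' hσ hΓ'; exact .sort hΓ' h
  | var _ h => intro σ Γ' hσ hΓ'; exact hσ _ _ h
  | conv _ _ e ih ih' => intro σ Γ' hσ hΓ'; exact .conv (ih hσ hΓ') (ih' hσ hΓ') (e.sub σ)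
  | pi r _ _ ih ih' =>
    intro σ Γ' hσ hΓ'
    have w := EWf.decl (ih hσ hΓ')
    exact .pi r (ih hσ hΓ') (ih' (hσ.lift w) w)
  | lam r _ _ _ ih ih' ih'' =>
    intro σ Γ' hσ hΓ'
    have w := EWf.decl (ih hσ hΓ')
    exact .lam r (ih hσ hΓ') (ih' (hσ.lift w) w) (ih'' (hσ.lift w) w)
  | app r _ _ _ _ ih ih' ih₁ ih₂ =>
    intro σ Γ' hσ hΓ'
    have w := EWf.decl (ih hσ hΓ')
    rw [ETm.sub_substAt]
    exact .app r (ih hσ hΓ') (ih' (hσ.lift w) w) (ih₁ hσ hΓ') (ih₂ hσ hΓ')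

theorem ETyped.substAt (h : ETyped Ar Rr (A :: Γ) M B) (hN : ETyped Ar Rr Γ N A) :
    ETyped Ar Rr Γ (ETm.substAt 0 N M) (ETm.substAt 0 N B) := by
  rw [ETm.substAt_zero, ETm.substAt_zero]
  have e : ETm.scons N ETm.var ∘ Nat.succ = ETm.var := rfl
  refine h.sub (.cons (fun n B hB => ?_) ?_) hN.wf
  · rw [e, ETm.sub_id]; exact .var hN.wf hB
  · rw [e, ETm.sub_id]; exact hN

theorem ETyped.ctx_conv {s s' : S} (h : ETyped Ar Rr (A :: Γ) M B)
    (hA : ETyped Ar Rr Γ A (.sort s)) (hA' : ETyped Ar Rr Γ A' (.sort s'))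
    (e : EConv Rr A A') : ETyped Ar Rr (A' :: Γ) M B := by
  have w := EWf.decl hA'
  have hσ : ESubOK Ar Rr ETm.var (A :: Γ) (A' :: Γ) := by
    have e' : (ETm.var : Nat → ETm S) ∘ Nat.succ = ETm.var ∘ Nat.succ := rfl
    refine .cons (fun n B hB => ?_) ?_
    · rw [← ETm.ren_eq_sub, ETm.ren_ren]
      exact .var w hB
    · rw [← ETm.ren_eq_sub]
      exact .conv (.var w rfl) (hA.weaken w) (EConv.ren (.symm _ _ e) _)
  simpa using h.sub hσ w

/-- The information provided by the generation lemma. -/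
def EGen (Ar : S → S → Prop) (Rr : S → S → S → Prop) (Γ : List (ETm S)) :
    ETm S → ETm S → Prop
  | .var n, T => ∃ A, Γ[n]? = some A ∧ EConv Rr (ETm.ren (· + (n + 1)) A) T
  | .sort s, T => ∃ t, Ar s t ∧ EConv Rr (.sort t) T
  | .pi s₁ s₂ A B, T => ∃ s₃, Rr s₁ s₂ s₃ ∧ ETyped Ar Rr Γ A (.sort s₁) ∧
      ETyped Ar Rr (A :: Γ) B (.sort s₂) ∧ EConv Rr (.sort s₃) T
  | .lam s₁ s₂ A B M, T => ∃ s₃, Rr s₁ s₂ s₃ ∧ ETyped Ar Rr Γ A (.sort s₁) ∧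
      ETyped Ar Rr (A :: Γ) B (.sort s₂) ∧ ETyped Ar Rr (A :: Γ) M B ∧
      EConv Rr (.pi s₁ s₂ A B) T
  | .app s₁ s₂ A B M N, T => ∃ s₃, Rr s₁ s₂ s₃ ∧ ETyped Ar Rr Γ A (.sort s₁) ∧
      ETyped Ar Rr (A :: Γ) B (.sort s₂) ∧ ETyped Ar Rr Γ N A ∧
      ETyped Ar Rr Γ M (.pi s₁ s₂ A B) ∧ EConv Rr (ETm.substAt 0 N B) T

theorem EGen.conv (h : EGen Ar Rr Γ M A) (e : EConv Rr A B) : EGen Ar Rr Γ M B := by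
  cases M with
  | var n => obtain ⟨C, hC, h⟩ := h; exact ⟨C, hC, .trans _ _ _ h e⟩
  | sort s => obtain ⟨C, hC, h⟩ := h; exact ⟨C, hC, .trans _ _ _ h e⟩
  | pi => obtain ⟨C, h₁, h₂, h₃, h⟩ := h; exact ⟨C, h₁, h₂, h₃, .trans _ _ _ h e⟩
  | lam => obtain ⟨C, h₁, h₂, h₃, h₄, h⟩ := h; exact ⟨C, h₁, h₂, h₃, h₄, .trans _ _ _ h e⟩
  | app =>
    obtain ⟨C, h₁, h₂, h₃, h₄, h₅, h⟩ := h
    exact ⟨C, h₁, h₂, h₃, h₄, h₅, .trans _ _ _ h e⟩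

theorem ETyped.gen (h : ETyped Ar Rr Γ M A) : EGen Ar Rr Γ M A := by
  induction h using ETyped.ind with
  | sort _ h => exact ⟨_, h, .refl _⟩
  | var _ h => exact ⟨_, h, .refl _⟩
  | conv _ _ e ih _ => exact ih.conv e
  | pi r h h' => exact ⟨_, r, h, h', .refl _⟩
  | lam r h h' h'' => exact ⟨_, r, h, h', h'', .refl _⟩
  | app r h h' h₁ h₂ => exact ⟨_, r, h, h', h₁, h₂, .refl _⟩

theorem ETyped.unique (hfun : FunctionalSpec Ar Rr) (h : ETyped Ar Rr Γ M A)
    (h' : ETyped Ar Rr Γ M B) : EConv Rr A B := by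
  have g := h.gen
  have g' := h'.gen
  cases M with
  | var n =>
    obtain ⟨C, hC, h⟩ := g
    obtain ⟨C', hC', h'⟩ := g'
    cases hC.symm.trans hC'
    exact .trans _ _ _ (.symm _ _ h) h'
  | sort s =>
    obtain ⟨C, hC, h⟩ := g
    obtain ⟨C', hC', h'⟩ := g'
    cases hfun.1 _ _ _ hC hC'
    exact .trans _ _ _ (.symm _ _ h) h'
  | pi =>
    obtain ⟨C, hC, -, -, h⟩ := g
    obtain ⟨C', hC', -, -, h'⟩ := g'
    cases hfun.2 _ _ _ _ hC hC'
    exact .trans _ _ _ (.symm _ _ h) h'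
  | lam =>
    obtain ⟨C, hC, -, -, -, h⟩ := g
    obtain ⟨C', hC', -, -, -, h'⟩ := g'
    exact .trans _ _ _ (.symm _ _ h) h'
  | app =>
    obtain ⟨C, hC, -, -, -, -, h⟩ := g
    obtain ⟨C', hC', -, -, -, -, h'⟩ := g'
    exact .trans _ _ _ (.symm _ _ h) h'

theorem ETyped.unique_sort (hfun : FunctionalSpec Ar Rr) {s t : S}
    (h : ETyped Ar Rr Γ M (.sort s)) (h' : ETyped Ar Rr Γ M (.sort t)) : s = t :=
  (h.unique hfun h').sort_inj

theorem EConv.pi {s₁ s₂ : S} (hA : EConv Rr A A') (hB : EConv Rr B B') :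
    EConv Rr (.pi s₁ s₂ A B) (.pi s₁ s₂ A' B') := by
  obtain ⟨_, h₁, h₂⟩ := hA.join
  obtain ⟨_, h₃, h₄⟩ := hB.join
  exact .of_join ⟨_, EStep.star_pi h₁ h₃, EStep.star_pi h₂ h₄⟩

theorem EConv.of_step (h : EStep Rr M N) : EConv Rr M N := .rel _ _ h

theorem EConv.substAt (h : EConv Rr A B) (N : ETm S) :
    EConv Rr (ETm.substAt 0 N A) (ETm.substAt 0 N B) := h.sub _

theorem ETyped.step (h : ETyped Ar Rr Γ M A) :
    ∀ {M'}, EStep Rr M M' → ETyped Ar Rr Γ M' A := by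
  induction h using ETyped.ind with
  | sort _ h => intro M' e; cases e with | base e => obtain ⟨_, _, _, _, _, _, _, _, _, _, e, _⟩ := e; cases e
  | var _ h => intro M' e; cases e with | base e => obtain ⟨_, _, _, _, _, _, _, _, _, _, e, _⟩ := e; cases e
  | conv _ h' e ih ih' => intro M' e'; exact .conv (ih e') h' e
  | pi r h h' ih ih' =>
    intro M' e
    cases e with
    | base e => obtain ⟨_, _, _, _, _, _, _, _, _, _, e, _⟩ := e; cases e
    | piA e => exact .pi r (ih e) (h'.ctx_conv h (ih e) (.of_step e))
    | piB e => exact .pi r h (ih' e)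
  | lam r h h' h'' ih ih' ih'' =>
    intro M' e
    have hp := ETyped.pi r h h'
    cases e with
    | base e => obtain ⟨_, _, _, _, _, _, _, _, _, _, e, _⟩ := e; cases e
    | lamA e =>
      have c := EConv.of_step e
      exact .conv (.lam r (ih e) (h'.ctx_conv h (ih e) c) (h''.ctx_conv h (ih e) c)) hp
        (.symm _ _ (c.pi (.refl _)))
    | lamB e =>
      have c := EConv.of_step e
      exact .conv (.lam r h (ih' e) (.conv h'' (ih' e) c)) hp
        (.symm _ _ (EConv.pi (.refl _) c))
    | lamM e => exact .lam r h h' (ih'' e)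
  | app r h h' h₁ h₂ ih ih' ih₁ ih₂ =>
    intro M' e
    have ht := h'.substAt h₁
    cases e with
    | base e =>
      obtain ⟨_, _, _, _, _, _, _, P, _, _, e, rfl⟩ := e
      cases e
      obtain ⟨_, _, hA, hB, hP, e⟩ := h₂.gen
      obtain ⟨-, -, eA, eB⟩ := e.pi_inj
      exact .conv (hP.substAt (.conv h₁ hA (.symm _ _ eA))) ht (eB.substAt _)
    | appA e =>
      have c := EConv.of_step e
      have hB := h'.ctx_conv h (ih e) c
      exact .app r (ih e) hB (.conv h₁ (ih e) c) (.conv h₂ (.pi r (ih e) hB) (c.pi (.refl _)))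
    | appB e =>
      have c := EConv.of_step e
      exact .conv (.app r h (ih' e) h₁ (.conv h₂ (.pi r h (ih' e)) (EConv.pi (.refl _) c))) ht
        (.symm _ _ (c.substAt _))
    | appM e => exact .app r h h' h₁ (ih₂ e)
    | appN e =>
      exact .conv (.app r h h' (ih₁ e) h₂) ht
        (.symm _ _ (EConv.of_star (EStep.star_substAt .refl (.single e))))

theorem ETyped.star (h : ETyped Ar Rr Γ M A) (e : ReflTransGen (EStep Rr) M M') :
    ETyped Ar Rr Γ M' A := by
  induction e with
  | refl => exact h
  | tail _ e ih => exact ih.step e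

theorem ETyped.sort_eq_of_conv (hfun : FunctionalSpec Ar Rr) {s t : S}
    (h : ETyped Ar Rr Γ A (.sort s)) (h' : ETyped Ar Rr Γ B (.sort t)) (e : EConv Rr A B) :
    s = t := by
  obtain ⟨Z, h₁, h₂⟩ := e.join
  exact (h.star h₁).unique_sort hfun (h'.star h₂)

end EPTS

/-! ## Derived typing rules of the encoding -/

section Rules

/-- Dedukti typing in the theory encoding the EPTS. -/
abbrev DTyped (Ar : S → S → Prop) (Rr : S → S → S → Prop) :=
  Typed (sigEPTS Ar Rr) (rulesEPTS Ar Rr)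

/-- Well-formed contexts in the theory encoding the EPTS. -/
abbrev DWf (Ar : S → S → Prop) (Rr : S → S → S → Prop) :=
  Wf (sigEPTS Ar Rr) (rulesEPTS Ar Rr)

variable {Γ : List (Tm (EConst S))} {A B M N T : Tm (EConst S)} {s s₁ s₂ s₃ : S}

@[simp] theorem ren_Ucon (ρ : Nat → Nat) : Tm.ren ρ (Ucon s) = Ucon s := by simp [Ucon]
@[simp] theorem sub_Ucon (σ : Nat → Tm (EConst S)) : Tm.sub σ (Ucon s) = Ucon s := by simp [Ucon]
@[simp] theorem ren_Elcon (ρ : Nat → Nat) : Tm.ren ρ (Elcon s A) = Elcon s (Tm.ren ρ A) := by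
  simp [Elcon]
@[simp] theorem sub_Elcon (σ : Nat → Tm (EConst S)) :
    Tm.sub σ (Elcon s A) = Elcon s (Tm.sub σ A) := by simp [Elcon]
@[simp] theorem sub_ProdC (σ : Nat → Tm (EConst S)) :
    Tm.sub σ (ProdC s₁ s₂ A B) = ProdC s₁ s₂ (Tm.sub σ A) (Tm.sub σ B) := by simp [ProdC]

theorem DTyped.var_eq {n : Nat} (w : DWf Ar Rr Γ) (h : Γ[n]? = some A)
    (e : T = Tm.ren (· + (n + 1)) A) : DTyped Ar Rr Γ (.var n) T := e ▸ .var w h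

theorem DTyped.const_eq {c : EConst S} {Δ Ms : List (Tm (EConst S))} {t : Tm (EConst S)}
    (h : SigEPTSMem Ar Rr (c, Δ, A)) (hA : DTyped Ar Rr Δ.reverse A t) (ht : IsDKSort t)
    (hM : TypedArgs (sigEPTS Ar Rr) (rulesEPTS Ar Rr) Γ Ms Δ) (e : T = instArgs Ms A) :
    DTyped Ar Rr Γ (.const c Ms) T := e ▸ .cons h hA ht hM

theorem DTyped.app_eq (h : DTyped Ar Rr Γ M (.pi A B)) (h' : DTyped Ar Rr Γ N A)
    (e : T = Tm.substAt 0 N B) : DTyped Ar Rr Γ (.app M N) T := e ▸ .app h h'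

theorem DTyped.U (s : S) : DTyped Ar Rr Γ (Ucon s) .type :=
  .const_eq (.U s) (.sort .empty) (.inr rfl) .nil (by simp [instArgs])

theorem DTyped.u (h : Ar s₁ s₂) : DTyped Ar Rr Γ (ucon s₁) (Ucon s₂) :=
  .const_eq (.u h) (.U s₂) (.inl rfl) .nil (by simp [instArgs])

theorem DTyped.El (hA : DTyped Ar Rr Γ A (Ucon s)) : DTyped Ar Rr Γ (Elcon s A) .type :=
  .const_eq (.El s) (.sort (.decl (DTyped.U s))) (.inr rfl) (.cons hA .nil) (by simp [instArgs])

theorem Tm.substAt_ren_add (N M : Tm (EConst S)) (k : Nat) :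
    Tm.substAt k N (Tm.ren (· + (k + 1)) M) = Tm.ren (· + k) M := by
  rw [Tm.substAt, Tm.sub_ren, Tm.ren_eq_sub M]
  congr 1; funext n
  have h₁ : ¬ n + (k + 1) < k := by omega
  have h₂ : n + (k + 1) ≠ k := by omega
  simp only [Function.comp, h₁, h₂, if_false]
  congr 1

theorem TypedArgs.cons_eq {Ms Δ Δ' : List (Tm (EConst S))} (hM : DTyped Ar Rr Γ M A)
    (hMs : TypedArgs (sigEPTS Ar Rr) (rulesEPTS Ar Rr) Γ Ms Δ') (e : Δ' = instTele M Δ) :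
    TypedArgs (sigEPTS Ar Rr) (rulesEPTS Ar Rr) Γ (M :: Ms) (A :: Δ) := .cons hM (e ▸ hMs)

theorem instTele_Prod (A : Tm (EConst S)) (s₁ s₂ : S) :
    instTele A [.pi (Elcon s₁ (.var 0)) (Ucon s₂)] = [.pi (Elcon s₁ A) (Ucon s₂)] := by
  simp [instTele, Tm.substAt]

theorem instTele_abs (A : Tm (EConst S)) (s₁ s₂ : S) :
    instTele A [.pi (Elcon s₁ (.var 0)) (Ucon s₂),
        .pi (Elcon s₁ (.var 1)) (Elcon s₂ (.app (.var 1) (.var 0)))] =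
      [.pi (Elcon s₁ A) (Ucon s₂),
        .pi (Elcon s₁ (Tm.ren (· + 1) A)) (Elcon s₂ (.app (.var 1) (.var 0)))] := by
  simp [instTele, Tm.substAt, Tm.liftSub]

theorem instTele_abs_snd (A B : Tm (EConst S)) (s₁ s₂ : S) :
    instTele B [.pi (Elcon s₁ (Tm.ren (· + 1) A)) (Elcon s₂ (.app (.var 1) (.var 0)))] =
      [.pi (Elcon s₁ A) (Elcon s₂ (.app (Tm.ren Nat.succ B) (.var 0)))] := by
  have h := Tm.substAt_ren_add B A 0
  simp [Tm.substAt] at h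
  simp [instTele, Tm.substAt, Tm.liftSub, h]

theorem instTele_app (A : Tm (EConst S)) (s₁ s₂ s₃ : S) :
    instTele A [.pi (Elcon s₁ (.var 0)) (Ucon s₂),
        Elcon s₃ (ProdC s₁ s₂ (.var 1) (.var 0)), Elcon s₁ (.var 2)] =
      [.pi (Elcon s₁ A) (Ucon s₂), Elcon s₃ (ProdC s₁ s₂ (Tm.ren (· + 1) A) (.var 0)),
        Elcon s₁ (Tm.ren (· + 2) A)] := by
  simp [instTele, Tm.substAt]

theorem instTele_app_snd (A B : Tm (EConst S)) (s₁ s₂ s₃ : S) :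
    instTele B [Elcon s₃ (ProdC s₁ s₂ (Tm.ren (· + 1) A) (.var 0)),
        Elcon s₁ (Tm.ren (· + 2) A)] =
      [Elcon s₃ (ProdC s₁ s₂ A B), Elcon s₁ (Tm.ren (· + 1) A)] := by
  have h₀ := Tm.substAt_ren_add B A 0
  have h₁ := Tm.substAt_ren_add B A 1
  simp [Tm.substAt] at h₀ h₁
  simp [instTele, Tm.substAt, h₀, h₁]

theorem instTele_app_thd (A M : Tm (EConst S)) (s₁ : S) :
    instTele M [Elcon s₁ (Tm.ren (· + 1) A)] = [Elcon s₁ A] := by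
  have h₀ := Tm.substAt_ren_add M A 0
  simp [Tm.substAt] at h₀
  simp [instTele, Tm.substAt, h₀]

theorem DTyped.Prod (r : Rr s₁ s₂ s₃) (hA : DTyped Ar Rr Γ A (Ucon s₁))
    (hB : DTyped Ar Rr Γ B (.pi (Elcon s₁ A) (Ucon s₂))) :
    DTyped Ar Rr Γ (ProdC s₁ s₂ A B) (Ucon s₃) :=
  .const_eq (.Prod r) (.U s₃) (.inl rfl)
    (.cons_eq hA (.cons hB .nil) (instTele_Prod A s₁ s₂).symm) (by simp [instArgs])

theorem wf_tele (s₁ s₂ : S) : DWf Ar Rr [Tm.pi (Elcon s₁ (Tm.var 0)) (Ucon s₂), Ucon s₁] :=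
  .decl (.prod (DTyped.El (.var_eq (.decl (DTyped.U s₁)) rfl (by simp)))
    (DTyped.U s₂) (.inl rfl))

theorem wf_tele_abs (s₁ s₂ : S) : DWf Ar Rr
    [Tm.pi (Elcon s₁ (Tm.var 1)) (Elcon s₂ (Tm.app (Tm.var 1) (Tm.var 0))),
      Tm.pi (Elcon s₁ (Tm.var 0)) (Ucon s₂), Ucon s₁] := by
  have h : DTyped Ar Rr _ (Elcon s₁ (Tm.var 1)) .type :=
    DTyped.El (.var_eq (wf_tele s₁ s₂) rfl (by simp))
  refine .decl (.prod h (DTyped.El ?_) (.inl rfl))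
  exact .app_eq (A := Elcon s₁ (.var 2)) (B := Ucon s₂)
    (.var_eq (.decl h) rfl (by simp)) (.var_eq (.decl h) rfl (by simp))
    (by simp [Tm.substAt])

theorem DTyped.abs (r : Rr s₁ s₂ s₃) (hA : DTyped Ar Rr Γ A (Ucon s₁))
    (hB : DTyped Ar Rr Γ B (.pi (Elcon s₁ A) (Ucon s₂)))
    (hM : DTyped Ar Rr Γ M (.pi (Elcon s₁ A)
      (Elcon s₂ (.app (Tm.ren Nat.succ B) (.var 0))))) :
    DTyped Ar Rr Γ (absC s₁ s₂ A B M) (Elcon s₃ (ProdC s₁ s₂ A B)) := by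
  have w := wf_tele_abs (Ar := Ar) (Rr := Rr) s₁ s₂
  refine .const_eq (.abs r) (DTyped.El (.Prod r (.var_eq w rfl (by simp))
    (.var_eq w rfl (by simp)))) (.inl rfl)
    (.cons_eq hA (.cons_eq hB (.cons hM .nil) (instTele_abs_snd A B s₁ s₂).symm)
      (instTele_abs A s₁ s₂).symm) (by simp [instArgs])

theorem wf_tele_app (r : Rr s₁ s₂ s₃) : DWf Ar Rr
    [Elcon s₁ (Tm.var 2), Elcon s₃ (ProdC s₁ s₂ (Tm.var 1) (Tm.var 0)),
      Tm.pi (Elcon s₁ (Tm.var 0)) (Ucon s₂), Ucon s₁] := by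
  have w := wf_tele (Ar := Ar) (Rr := Rr) s₁ s₂
  have h : DTyped Ar Rr _ (Elcon s₃ (ProdC s₁ s₂ (Tm.var 1) (Tm.var 0))) .type :=
    DTyped.El (.Prod r (.var_eq w rfl (by simp)) (.var_eq w rfl (by simp)))
  exact .decl (DTyped.El (.var_eq (.decl h) rfl (by simp)))

theorem DTyped.appC (r : Rr s₁ s₂ s₃) (hA : DTyped Ar Rr Γ A (Ucon s₁))
    (hB : DTyped Ar Rr Γ B (.pi (Elcon s₁ A) (Ucon s₂)))
    (hM : DTyped Ar Rr Γ M (Elcon s₃ (ProdC s₁ s₂ A B)))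
    (hN : DTyped Ar Rr Γ N (Elcon s₁ A)) :
    DTyped Ar Rr Γ (appC s₁ s₂ A B M N) (Elcon s₂ (.app B N)) := by
  have w := wf_tele_app (Ar := Ar) r
  refine .const_eq (.app r) (DTyped.El (.app_eq (A := Elcon s₁ (.var 3)) (B := Ucon s₂)
    (.var_eq w rfl (by simp)) (.var_eq w rfl (by simp)) (by simp [Tm.substAt])))
    (.inl rfl) 
    (.cons_eq hA (.cons_eq hB (.cons_eq hM (.cons hN .nil) (instTele_app_thd A M s₁).symm)
      (instTele_app_snd A B s₁ s₂ s₃).symm) (instTele_app A s₁ s₂ s₃).symm)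
    (by simp [instArgs])

end Rules

/-! ## Soundness of the translation -/

section Soundness
variable {Γ Γ' : List (ETm S)} {Δ Δ' : List (Tm (EConst S))} {A B M : ETm S}
  {T : Tm (EConst S)} {s : S}

/-- `T` is, up to conversion, the Dedukti type representing the EPTS type `A`. -/
def Interp (Ar : S → S → Prop) (Rr : S → S → S → Prop) (Γ : List (ETm S)) (A : ETm S)
    (T : Tm (EConst S)) : Prop :=
  (∃ s, A = .sort s ∧ Conv (rulesEPTS Ar Rr) T (Ucon s)) ∨
    ∃ s, ETyped Ar Rr Γ A (.sort s) ∧ Conv (rulesEPTS Ar Rr) T (Elcon s (trans A))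

theorem ETyped.sort_inv {t : S} (h : ETyped Ar Rr Γ (.sort t) (.sort s)) : Ar t s := by
  obtain ⟨t', ht, e⟩ := h.gen
  exact e.sort_inj ▸ ht

theorem Interp.conv (hfun : FunctionalSpec Ar Rr) (h : Interp Ar Rr Γ A T)
    (hB : ETyped Ar Rr Γ B (.sort s)) (e : EConv Rr A B) :
    Conv (rulesEPTS Ar Rr) T (Elcon s (trans B)) := by
  rcases h with ⟨t, rfl, h⟩ | ⟨t, hA, h⟩
  · obtain ⟨Z, h₁, h₂⟩ := e.join
    cases EStep.star_sort_inv h₁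
    refine .trans _ _ _ h (.trans _ _ _ (.symm _ _ (Conv.elU (hB.star h₂).sort_inv)) ?_)
    exact Conv.El e.trans_conv
  · cases hA.sort_eq_of_conv hfun hB e
    exact .trans _ _ _ h (Conv.El e.trans_conv)

theorem Interp.conv_U (h : Interp Ar Rr Γ (.sort s) T) : Conv (rulesEPTS Ar Rr) T (Ucon s) := by
  rcases h with ⟨t, e, h⟩ | ⟨t, hA, h⟩
  · cases e; exact h
  · exact .trans _ _ _ h (Conv.elU hA.sort_inv)

theorem TransCtx.getElem (h : TransCtx Ar Rr Γ Δ) (w : EWf Ar Rr Γ) {n : Nat}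
    (hA : Γ[n]? = some A) : ∃ s D, ETyped Ar Rr Γ (ETm.ren (· + (n + 1)) A) (.sort s) ∧
      Δ[n]? = some D ∧
      Tm.ren (· + (n + 1)) D = Elcon s (trans (ETm.ren (· + (n + 1)) A)) := by
  induction h generalizing n A with
  | nil => simp at hA
  | cons h hB ih =>
    cases n with
    | zero =>
      simp only [List.getElem?_cons_zero, Option.some.injEq] at hA
      subst hA
      exact ⟨_, _, hB.weaken w, rfl, by simp [trans_ren]⟩
    | succ n =>
      obtain ⟨s, D, h₁, h₂, h₃⟩ := ih hB.wf hA
      refine ⟨s, D, ?_, h₂, ?_⟩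
      · have := h₁.weaken w
        rwa [ETm.ren_ren] at this
      · have := congrArg (Tm.ren Nat.succ) h₃
        rw [ren_Elcon, ← trans_ren, Tm.ren_ren, ETm.ren_ren] at this
        exact this

theorem DTyped.trans_lam {s₁ s₂ : S} {A B : Tm (EConst S)} (hA : DTyped Ar Rr Δ A (Ucon s₁))
    (hB : DTyped Ar Rr (Elcon s₁ A :: Δ) B (Ucon s₂)) :
    DTyped Ar Rr Δ (.lam (Elcon s₁ A) B) (.pi (Elcon s₁ A) (Ucon s₂)) :=
  Typed.abs (DTyped.El hA) (DTyped.U s₂) (.inl rfl) hB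

theorem ERenOK.id (Γ : List (ETm S)) : ERenOK (fun n => n) Γ Γ := fun _ A h =>
  ⟨A, h, (ETm.ren_id _).symm⟩

theorem Conv.eta_expand (D X : Tm (EConst S)) : Conv (rulesEPTS Ar Rr)
    (.app (Tm.ren Nat.succ (.lam D X)) (.var 0)) X := by
  rw [Tm.ren_lam]
  refine .trans _ _ _ (Conv.beta _ _ _) ?_
  rw [Tm.substAt_zero, Tm.sub_ren]
  have e : Tm.sub (Tm.scons (.var 0) .var ∘ Tm.liftRen Nat.succ) X = X := by
    conv_rhs => rw [← Tm.sub_id X]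
    congr 1; funext n; cases n <;> rfl
  rw [e]; exact .refl _

/-- Soundness of the translation, along an arbitrary renaming. -/
theorem ETyped.sound (hfun : FunctionalSpec Ar Rr) (h : ETyped Ar Rr Γ M A) :
    ∀ {ρ Γ' Δ'}, ERenOK ρ Γ Γ' → EWf Ar Rr Γ' → TransCtx Ar Rr Γ' Δ' → DWf Ar Rr Δ' →
      ∃ T, DTyped Ar Rr Δ' (trans (ETm.ren ρ M)) T ∧ Interp Ar Rr Γ' (ETm.ren ρ A) T := by
  induction h using ETyped.ind with
  | sort _ h =>
    intro ρ Γ' Δ' hρ hΓ' hΔ w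
    exact ⟨_, DTyped.u h, .inl ⟨_, rfl, .refl _⟩⟩
  | var _ h =>
    intro ρ Γ' Δ' hρ hΓ' hΔ w
    obtain ⟨A', h₁, h₂⟩ := hρ _ _ h
    obtain ⟨s, D, h₃, h₄, h₅⟩ := hΔ.getElem hΓ' h₁
    refine ⟨_, .var_eq w h₄ rfl, .inr ⟨s, ?_, ?_⟩⟩
    · rwa [← h₂]
    · rw [← h₂, h₅]; exact .refl _
  | conv _ h e ih _ =>
    intro ρ Γ' Δ' hρ hΓ' hΔ w
    obtain ⟨T, h₁, h₂⟩ := ih hρ hΓ' hΔ w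
    exact ⟨T, h₁, .inr ⟨_, h.ren hρ hΓ', h₂.conv hfun (h.ren hρ hΓ') (e.ren ρ)⟩⟩
  | @pi _ s₁ s₂ s₃ A B r h h' ih ih' =>
    intro ρ Γ' Δ' hρ hΓ' hΔ w
    obtain ⟨T, h₁, h₂⟩ := ih hρ hΓ' hΔ w
    have hA := Typed.conv h₁ (DTyped.U s₁) (.inl rfl) h₂.conv_U
    obtain ⟨T', h₃, h₄⟩ := ih' (hρ.lift _) (.decl (h.ren hρ hΓ'))
      (.cons hΔ (h.ren hρ hΓ')) (.decl (DTyped.El hA))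
    have hB := Typed.conv h₃ (DTyped.U s₂) (.inl rfl) h₄.conv_U
    exact ⟨_, .Prod r hA (.trans_lam hA hB), .inl ⟨_, rfl, .refl _⟩⟩
  | @lam Γ s₁ s₂ s₃ A B M r h h' h'' ih ih' ih'' =>
    have key : ∀ {ρ Γ' Δ'}, ERenOK ρ Γ Γ' → EWf Ar Rr Γ' → TransCtx Ar Rr Γ' Δ' →
        DWf Ar Rr Δ' → DTyped Ar Rr Δ' (trans (ETm.ren ρ A)) (Ucon s₁) ∧
        DTyped Ar Rr (Elcon s₁ (trans (ETm.ren ρ A)) :: Δ')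
          (trans (ETm.ren (Tm.liftRen ρ) B)) (Ucon s₂) := by
      intro ρ Γ' Δ' hρ hΓ' hΔ w
      obtain ⟨T, h₁, h₂⟩ := ih hρ hΓ' hΔ w
      have hA := Typed.conv h₁ (DTyped.U s₁) (.inl rfl) h₂.conv_U
      obtain ⟨T', h₃, h₄⟩ := ih' (hρ.lift _) (.decl (h.ren hρ hΓ'))
        (.cons hΔ (h.ren hρ hΓ')) (.decl (DTyped.El hA))
      exact ⟨hA, Typed.conv h₃ (DTyped.U s₂) (.inl rfl) h₄.conv_U⟩
    intro ρ Γ' Δ' hρ hΓ' hΔ w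
    obtain ⟨hA, hB⟩ := key hρ hΓ' hΔ w
    have hA' := h.ren hρ hΓ'
    have w' := Wf.decl (DTyped.El hA)
    obtain ⟨T, h₁, h₂⟩ := ih'' (hρ.lift A) (.decl hA') (.cons hΔ hA') w'
    have hB' := h'.ren (hρ.lift A) (.decl hA')
    have hlam := DTyped.trans_lam hA hB
    have hρ' : ERenOK (Nat.succ ∘ ρ) Γ (ETm.ren ρ A :: Γ') := by
      intro n B hB
      obtain ⟨B', h₁, h₂⟩ := hρ n B hB
      refine ⟨B', h₁, ?_⟩
      have := congrArg (ETm.ren Nat.succ) h₂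
      simp only [ETm.ren_ren] at this ⊢
      exact this
    obtain ⟨hA₁, hB₁⟩ := key hρ' (.decl hA') (.cons hΔ hA') w'
    have hlam₁ := DTyped.trans_lam hA₁ hB₁
    have hred : DTyped Ar Rr (Elcon s₁ (trans (ETm.ren ρ A)) :: Δ')
        (.app (Tm.ren Nat.succ (.lam (Elcon s₁ (trans (ETm.ren ρ A)))
          (trans (ETm.ren (Tm.liftRen ρ) B)))) (.var 0)) (Ucon s₂) := by
      simp only [Tm.ren_lam, ren_Elcon, ← trans_ren, ETm.ren_ren, Tm.liftRen_comp]
      exact .app_eq hlam₁ (.var_eq w' rfl (by simp [← trans_ren, ETm.ren_ren]))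
        (by simp [Tm.substAt])
    refine ⟨_, .abs r hA hlam (Typed.abs (DTyped.El hA) (DTyped.El hred) (.inl rfl)
      (.conv h₁ (DTyped.El hred) (.inl rfl) ?_)), .inr ⟨s₃, .pi r hA' hB', .refl _⟩⟩
    exact .trans _ _ _ (h₂.conv hfun hB' (.refl _)) (.symm _ _ (Conv.El (Conv.eta_expand _ _)))
  | @app Γ s₁ s₂ s₃ A B M N r h h' h₁ h₂ ih ih' ih₁ ih₂ =>
    intro ρ Γ' Δ' hρ hΓ' hΔ w
    have hA' := h.ren hρ hΓ'
    have hB' := h'.ren (hρ.lift A) (.decl hA')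
    obtain ⟨T, h₃, h₄⟩ := ih hρ hΓ' hΔ w
    have hA := Typed.conv h₃ (DTyped.U s₁) (.inl rfl) h₄.conv_U
    obtain ⟨T', h₅, h₆⟩ := ih' (hρ.lift _) (.decl hA')
      (.cons hΔ hA') (.decl (DTyped.El hA))
    have hB := Typed.conv h₅ (DTyped.U s₂) (.inl rfl) h₆.conv_U
    have hlam := DTyped.trans_lam hA hB
    obtain ⟨T₁, h₇, h₈⟩ := ih₁ hρ hΓ' hΔ w
    obtain ⟨T₂, h₉, h₀⟩ := ih₂ hρ hΓ' hΔ w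
    have hN := Typed.conv h₇ (DTyped.El hA) (.inl rfl) (h₈.conv hfun hA' (.refl _))
    have hM := Typed.conv h₉ (DTyped.El (.Prod r hA hlam)) (.inl rfl)
      (h₀.conv hfun (.pi r hA' hB') (.refl _))
    rw [ETm.ren_substAt]
    refine ⟨_, .appC r hA hlam hM hN, .inr ⟨s₂, hB'.substAt (h₁.ren hρ hΓ'), Conv.El ?_⟩⟩
    rw [← trans_substAt]
    exact .beta _ _ _

theorem TransCtx.wf (hfun : FunctionalSpec Ar Rr) (h : TransCtx Ar Rr Γ Δ) :
    EWf Ar Rr Γ ∧ DWf Ar Rr Δ := by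
  induction h with
  | nil => exact ⟨.empty, .empty⟩
  | cons h hA ih =>
    obtain ⟨T, h₁, h₂⟩ := hA.sound hfun (ERenOK.id _) ih.1 h ih.2
    rw [ETm.ren_id] at h₁
    exact ⟨.decl hA, .decl (DTyped.El (Typed.conv h₁ (DTyped.U _) (.inl rfl) h₂.conv_U))⟩

theorem ETyped.trans (hfun : FunctionalSpec Ar Rr) (h : ETyped Ar Rr Γ M A)
    (hΔ : TransCtx Ar Rr Γ Δ) :
    ∃ T, DTyped Ar Rr Δ (DKPaper.trans M) T ∧ Interp Ar Rr Γ A T := by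
  have := h.sound hfun (ERenOK.id _) (hΔ.wf hfun).1 hΔ (hΔ.wf hfun).2
  simpa only [ETm.ren_id] using this

theorem ETyped.trans_sort (hfun : FunctionalSpec Ar Rr) (h : ETyped Ar Rr Γ A (.sort s))
    (hΔ : TransCtx Ar Rr Γ Δ) : DTyped Ar Rr Δ (DKPaper.trans A) (Ucon s) := by
  obtain ⟨T, h₁, h₂⟩ := h.trans hfun hΔ
  exact Typed.conv h₁ (DTyped.U _) (.inl rfl) h₂.conv_U

end Soundness

/-! ## Generation for the encoding -/

section Generation
variable {Γ : List (Tm (EConst S))} {M A : Tm (EConst S)}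

/-- What a Dedukti typing derivation says about its subject, up to conversion. -/
def DGen (Ar : S → S → Prop) (Rr : S → S → S → Prop) (Γ : List (Tm (EConst S)))
    (M T : Tm (EConst S)) : Prop :=
  match M with
  | .var n => ∃ A, Γ[n]? = some A ∧ Conv (rulesEPTS Ar Rr) (Tm.ren (· + (n + 1)) A) T
  | .const c Ms => ∃ Δ A, SigEPTSMem Ar Rr (c, Δ, A) ∧
      TypedArgs (sigEPTS Ar Rr) (rulesEPTS Ar Rr) Γ Ms Δ ∧
      Conv (rulesEPTS Ar Rr) (instArgs Ms A) T
  | .type => Conv (rulesEPTS Ar Rr) .kind T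
  | .kind => False
  | .app M N => ∃ A B, DTyped Ar Rr Γ M (.pi A B) ∧ DTyped Ar Rr Γ N A ∧
      Conv (rulesEPTS Ar Rr) (Tm.substAt 0 N B) T
  | .lam A M => ∃ B, DTyped Ar Rr (A :: Γ) M B ∧ Conv (rulesEPTS Ar Rr) (.pi A B) T
  | .pi _ _ => ∃ s, IsDKSort s ∧ Conv (rulesEPTS Ar Rr) s T

theorem DGen.conv {T T' : Tm (EConst S)} (h : DGen Ar Rr Γ M T)
    (e : Conv (rulesEPTS Ar Rr) T T') : DGen Ar Rr Γ M T' := by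
  cases M with
  | var n => obtain ⟨A, h, e'⟩ := h; exact ⟨A, h, .trans _ _ _ e' e⟩
  | const c Ms => obtain ⟨Δ, A, h, h', e'⟩ := h; exact ⟨Δ, A, h, h', .trans _ _ _ e' e⟩
  | type => exact .trans _ _ _ h e
  | kind => exact h
  | app M N => obtain ⟨A, B, h, h', e'⟩ := h; exact ⟨A, B, h, h', .trans _ _ _ e' e⟩
  | lam A M => obtain ⟨B, h, e'⟩ := h; exact ⟨B, h, .trans _ _ _ e' e⟩
  | pi A B => obtain ⟨s, h, e'⟩ := h; exact ⟨s, h, .trans _ _ _ e' e⟩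

theorem DTyped.gen {Γ : List (Tm (EConst S))} {M A : Tm (EConst S)} (h : DTyped Ar Rr Γ M A) :
    DGen Ar Rr Γ M A :=
  Typed.rec (S := sigEPTS Ar Rr) (R := rulesEPTS Ar Rr) (motive_1 := fun _ _ => True)
    (motive_2 := fun Γ M A _ => DGen Ar Rr Γ M A) (motive_3 := fun _ _ _ _ => True)
    trivial (fun _ _ => trivial) (fun _ _ => EqvGen.refl _)
    (fun _ h _ => ⟨_, h, .refl _⟩) (fun h _ _ h' _ _ => ⟨_, _, h, h', .refl _⟩)
    (fun _ _ _ e h _ => DGen.conv h e) (fun _ _ hs _ _ => ⟨_, hs, .refl _⟩)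
    (fun _ _ _ h _ _ _ => ⟨_, h, .refl _⟩) (fun h h' _ _ => ⟨_, _, h, h', .refl _⟩)
    trivial (fun _ _ _ _ => trivial) h

theorem TypedArgs.prod_inv {Ms : List (Tm (EConst S))} {s₁ s₂ : S}
    (h : TypedArgs (sigEPTS Ar Rr) (rulesEPTS Ar Rr) Γ Ms
      [Ucon s₁, Tm.pi (Elcon s₁ (Tm.var 0)) (Ucon s₂)]) :
    ∃ A B, Ms = [A, B] ∧ DTyped Ar Rr Γ A (Ucon s₁) ∧
      DTyped Ar Rr Γ B (.pi (Elcon s₁ A) (Ucon s₂)) := by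
  cases h with | cons hA h =>
  rw [instTele_Prod] at h
  cases h with | cons hB h =>
  cases h
  exact ⟨_, _, rfl, hA, hB⟩

theorem TypedArgs.abs_inv {Ms : List (Tm (EConst S))} {s₁ s₂ : S}
    (h : TypedArgs (sigEPTS Ar Rr) (rulesEPTS Ar Rr) Γ Ms
      [Ucon s₁, Tm.pi (Elcon s₁ (Tm.var 0)) (Ucon s₂),
        Tm.pi (Elcon s₁ (Tm.var 1)) (Elcon s₂ (Tm.app (Tm.var 1) (Tm.var 0)))]) :
    ∃ A B M, Ms = [A, B, M] ∧ DTyped Ar Rr Γ A (Ucon s₁) ∧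
      DTyped Ar Rr Γ B (.pi (Elcon s₁ A) (Ucon s₂)) ∧
      DTyped Ar Rr Γ M (.pi (Elcon s₁ A) (Elcon s₂ (.app (Tm.ren Nat.succ B) (.var 0)))) := by
  cases h with | cons hA h =>
  rw [instTele_abs] at h
  cases h with | cons hB h =>
  rw [instTele_abs_snd] at h
  cases h with | cons hM h =>
  cases h
  exact ⟨_, _, _, rfl, hA, hB, hM⟩

theorem TypedArgs.app_inv {Ms : List (Tm (EConst S))} {s₁ s₂ s₃ : S}
    (h : TypedArgs (sigEPTS Ar Rr) (rulesEPTS Ar Rr) Γ Ms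
      [Ucon s₁, Tm.pi (Elcon s₁ (Tm.var 0)) (Ucon s₂),
        Elcon s₃ (ProdC s₁ s₂ (Tm.var 1) (Tm.var 0)), Elcon s₁ (Tm.var 2)]) :
    ∃ A B M N, Ms = [A, B, M, N] ∧ DTyped Ar Rr Γ A (Ucon s₁) ∧
      DTyped Ar Rr Γ B (.pi (Elcon s₁ A) (Ucon s₂)) ∧
      DTyped Ar Rr Γ M (Elcon s₃ (ProdC s₁ s₂ A B)) ∧ DTyped Ar Rr Γ N (Elcon s₁ A) := by
  cases h with | cons hA h =>
  rw [instTele_app] at h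
  cases h with | cons hB h =>
  rw [instTele_app_snd] at h
  cases h with | cons hM h =>
  rw [instTele_app_thd] at h
  cases h with | cons hN h =>
  cases h
  exact ⟨_, _, _, _, rfl, hA, hB, hM, hN⟩

end Generation

/-! ## β-normal forms and hidden conversion -/

section Normal
variable {C : Type} {A B M N : Tm C}

theorem BetaNormal.const_arg {c : C} {Ms : List (Tm C)} (h : BetaNormal (.const c Ms))
    (hM : M ∈ Ms) : BetaNormal M := by
  obtain ⟨l₁, l₂, rfl⟩ := List.append_of_mem hM
  exact fun N hN => h _ (.constArg hN)

theorem BetaNormal.app_fun (h : BetaNormal (.app M N)) : BetaNormal M := fun _ h' => h _ (.appL h')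

theorem BetaNormal.not_lam_app (h : BetaNormal (.app M N)) : M ≠ .lam A B := by
  rintro rfl
  exact h _ (.base ⟨_, _, _, rfl, rfl⟩)

theorem BetaNormal.lam_body (h : BetaNormal (.lam A M)) : BetaNormal M := fun _ h' => h _ (.lamM h')

end Normal

section HConv
variable {R : Rules (EConst S)} {A A' M M' N N' : Tm (EConst S)}

theorem HConv.congr {f : Tm (EConst S) → Tm (EConst S)}
    (hf : ∀ M N, HStep R M N → HStep R (f M) (f N)) (h : HConv R M N) : HConv R (f M) (f N) := by
  induction h with
  | rel _ _ h => exact .rel _ _ (hf _ _ h)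
  | refl => exact .refl _
  | symm _ _ _ ih => exact .symm _ _ ih
  | trans _ _ _ _ _ ih ih' => exact .trans _ _ _ ih ih'

theorem HConv.lam (hA : Conv R A A') (hM : HConv R M M') : HConv R (.lam A M) (.lam A' M') := by
  have h : HConv R (.lam A' M) (.lam A' M') := hM.congr fun _ _ h => .lamM h
  refine .trans _ _ _ ?_ h
  clear h
  induction hA with
  | rel _ _ h => exact .rel _ _ (.base ⟨_, _, _, h, rfl, rfl⟩)
  | refl => exact .refl _
  | symm _ _ _ ih => exact .symm _ _ ih
  | trans _ _ _ _ _ ih ih' => exact .trans _ _ _ ih ih'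

theorem HConv.const {c : EConst S} {Ms Ns : List (Tm (EConst S))}
    (h : List.Forall₂ (HConv R) Ms Ns) :
    ∀ l, HConv R (.const c (l ++ Ms)) (.const c (l ++ Ns)) := by
  induction h with
  | nil => intro l; exact .refl _
  | @cons M N Ms Ns h _ ih =>
    intro l
    refine .trans _ _ _ (HConv.congr (f := fun X => .const c (l ++ X :: Ms))
      (fun _ _ h => .constArg h) h) ?_
    have := ih (l ++ [N])
    simp only [List.append_assoc, List.singleton_append] at this
    exact this

theorem HStep.step (h : HStep R M N) : Step R M N := by
  induction h with
  | base h => obtain ⟨_, _, _, h, rfl, rfl⟩ := h; exact .lamA h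
  | appL _ ih => exact .appL ih
  | appR _ ih => exact .appR ih
  | lamA _ ih => exact .lamA ih
  | lamM _ ih => exact .lamM ih
  | piA _ ih => exact .piA ih
  | piB _ ih => exact .piB ih
  | constArg _ ih => exact .constArg ih

theorem HConv.conv (h : HConv R M N) : Conv R M N := h.mono fun _ _ h => h.step

end HConv

/-! ## Conservativity -/

section Conservativity
variable {Γ : List (ETm S)} {Δ : List (Tm (EConst S))} {A B M : ETm S}
  {T : Tm (EConst S)} {s : S}

/-- `Δ` represents the EPTS context `Γ` up to conversion. -/
inductive CtxRel (Ar : S → S → Prop) (Rr : S → S → S → Prop) :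
    List (ETm S) → List (Tm (EConst S)) → Prop
  | nil : CtxRel Ar Rr [] []
  | cons {Γ Δ A D s} : CtxRel Ar Rr Γ Δ → ETyped Ar Rr Γ A (.sort s) →
      Conv (rulesEPTS Ar Rr) D (Elcon s (trans A)) → CtxRel Ar Rr (A :: Γ) (D :: Δ)

theorem TransCtx.ctxRel (h : TransCtx Ar Rr Γ Δ) : CtxRel Ar Rr Γ Δ := by
  induction h with
  | nil => exact .nil
  | cons _ hA ih => exact .cons ih hA (.refl _)

theorem CtxRel.wf (h : CtxRel Ar Rr Γ Δ) : EWf Ar Rr Γ := by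
  cases h with
  | nil => exact .empty
  | cons _ hA => exact .decl hA

theorem CtxRel.getElem (h : CtxRel Ar Rr Γ Δ) {n : Nat} {D : Tm (EConst S)}
    (hD : Δ[n]? = some D) : ∃ A s, Γ[n]? = some A ∧
      ETyped Ar Rr Γ (ETm.ren (· + (n + 1)) A) (.sort s) ∧
      Conv (rulesEPTS Ar Rr) (Tm.ren (· + (n + 1)) D)
        (Elcon s (trans (ETm.ren (· + (n + 1)) A))) := by
  induction h generalizing n D with
  | nil => simp at hD
  | cons h hB e ih =>
    have w := EWf.decl hB
    cases n with
    | zero =>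
      simp only [List.getElem?_cons_zero, Option.some.injEq] at hD
      subst hD
      refine ⟨_, _, rfl, hB.weaken w, ?_⟩
      have := e.ren Nat.succ
      rw [ren_Elcon, ← trans_ren] at this
      exact this
    | succ n =>
      obtain ⟨A, s, h₁, h₂, h₃⟩ := ih hD
      refine ⟨A, s, h₁, ?_, ?_⟩
      · have := h₂.weaken w
        rwa [ETm.ren_ren] at this
      · have := h₃.ren Nat.succ
        rw [ren_Elcon, ← trans_ren, Tm.ren_ren, ETm.ren_ren] at this
        exact this

theorem Interp.cast (hM : ETyped Ar Rr Γ M A) (hA : Interp Ar Rr Γ A T)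
    (hB : Interp Ar Rr Γ B T) : ETyped Ar Rr Γ M B := by
  rcases hA with ⟨s, rfl, h⟩ | ⟨s, hA, h⟩ <;> rcases hB with ⟨t, rfl, h'⟩ | ⟨t, hB, h'⟩ <;>
    have e := EqvGen.trans _ _ _ (EqvGen.symm _ _ h) h'
  · rwa [← Conv.U_inj e]
  · obtain ⟨_, e⟩ := Conv.El_U (.symm _ _ e)
    exact .conv hM hB (.of_join (join_of_conv_trans (N := B) (M := .sort s) (.symm _ _ e)))
  · obtain ⟨r, e⟩ := Conv.El_U e
    exact .conv hM (.sort hM.wf r) (.of_join (join_of_conv_trans (M := A) (N := .sort t) e))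
  · exact .conv hM hB (.of_join (join_of_conv_trans (Conv.El_inj e)))

theorem shape_of_sig {c : EConst S} {Δ Ms : List (Tm (EConst S))} {A : Tm (EConst S)}
    (h : SigEPTSMem Ar Rr (c, Δ, A)) :
    shape (instArgs Ms A) = some .type ∨ shape (instArgs Ms A) = some .base := by
  cases h <;> simp [instArgs, shape, Ucon, Elcon]

theorem BetaNormal.not_pi (N : Tm (EConst S)) (hN : BetaNormal N)
    (hlam : ∀ A B, N ≠ .lam A B) (hΔ : CtxRel Ar Rr Γ Δ) : ∀ {T A B}, DTyped Ar Rr Δ N T →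
    ¬ Conv (rulesEPTS Ar Rr) T (.pi A B) := by
  induction N using Tm.ind with
  | var n =>
    intro T A B h e
    obtain ⟨D, hD, h⟩ := h.gen
    obtain ⟨A', s, h₁, h₂, h₃⟩ := hΔ.getElem hD
    have := Conv.shape_eq (.trans _ _ _ (.symm _ _ h₃) (.trans _ _ _ h e)) rfl rfl
    cases this
  | const c Ms =>
    intro T A B h e
    obtain ⟨Θ, A', h₁, h₂, h₃⟩ := h.gen
    rcases shape_of_sig (Ms := Ms) h₁ with hs | hs <;>
      cases Conv.shape_eq (.trans _ _ _ h₃ e) hs rfl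
  | type =>
    intro T A B h e
    cases Conv.shape_eq (.trans _ _ _ h.gen e) rfl rfl
  | kind => intro T A B h; exact h.gen.elim
  | app M N ihM _ =>
    intro T A B h e
    obtain ⟨A', B', h₁, h₂, h₃⟩ := h.gen
    exact ihM hN.app_fun (fun _ _ => hN.not_lam_app) h₁ (.refl _)
  | lam A B => exact (hlam _ _ rfl).elim
  | pi A B =>
    intro T A B h e
    obtain ⟨s, rfl | rfl, h⟩ := h.gen <;> cases Conv.shape_eq (.trans _ _ _ h e) rfl rfl

theorem BetaNormal.lam_of_pi {N A B : Tm (EConst S)} (hN : BetaNormal N)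
    (hΔ : CtxRel Ar Rr Γ Δ) (h : DTyped Ar Rr Δ N (.pi A B)) :
    ∃ D M C, N = .lam D M ∧ DTyped Ar Rr (D :: Δ) M C ∧ Conv (rulesEPTS Ar Rr) D A ∧
      Conv (rulesEPTS Ar Rr) C B := by
  by_cases hlam : ∃ D M, N = .lam D M
  · obtain ⟨D, M, rfl⟩ := hlam
    obtain ⟨C, h₁, h₂⟩ := h.gen
    obtain ⟨h₃, h₄⟩ := h₂.pi_inj
    exact ⟨D, M, C, rfl, h₁, h₃, h₄⟩
  · push Not at hlam
    exact (hN.not_pi _ hlam hΔ h (.refl _)).elim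

theorem BetaNormal.not_type {N T : Tm (EConst S)} (h : Interp Ar Rr Γ A T)
    (hN : shape N = some .pi ∨ shape N = some .type ∨ shape N = some .kind)
    (e : Conv (rulesEPTS Ar Rr) N T) : False := by
  rcases h with ⟨s, _, h⟩ | ⟨s, _, h⟩ <;> rcases hN with hN | hN | hN <;>
    cases Conv.shape_eq (.trans _ _ _ e h) hN rfl

/-- Every β-normal inhabitant of the representation of a type is the representation of
an inhabitant, up to hidden conversion. -/
theorem conservativity {Γ : List (ETm S)} {Δ : List (Tm (EConst S))} {A : ETm S}
    {T : Tm (EConst S)} (N : Tm (EConst S)) (hN : BetaNormal N)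
    (hΔ : CtxRel Ar Rr Γ Δ) (h : DTyped Ar Rr Δ N T) (hA : Interp Ar Rr Γ A T) :
    ∃ M, InvGraph N M ∧ ETyped Ar Rr Γ M A ∧ HConv (rulesEPTS Ar Rr) (trans M) N := by
  match N with
  | .var n =>
    obtain ⟨D, hD, e⟩ := h.gen
    obtain ⟨B, s, h₁, h₂, h₃⟩ := hΔ.getElem hD
    exact ⟨.var n, .var n, Interp.cast (.var hΔ.wf h₁)
      (.inr ⟨s, h₂, .trans _ _ _ (.symm _ _ e) h₃⟩) hA, .refl _⟩
  | .type => exact (BetaNormal.not_type hA (.inr (.inr rfl)) h.gen).elim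
  | .kind => exact h.gen.elim
  | .pi A B =>
    obtain ⟨s, rfl | rfl, e⟩ := h.gen
    · exact (BetaNormal.not_type hA (.inr (.inl rfl)) e).elim
    · exact (BetaNormal.not_type hA (.inr (.inr rfl)) e).elim
  | .lam D M =>
    obtain ⟨C, h₁, e⟩ := h.gen
    exact (BetaNormal.not_type hA (.inl rfl) e).elim
  | .app M N =>
    obtain ⟨A', B', h₁, h₂, h₃⟩ := h.gen
    exact (hN.app_fun.not_pi _ (fun _ _ => hN.not_lam_app) hΔ h₁ (.refl _)).elim
  | .const c Ms =>
    obtain ⟨Θ, A', hc, hMs, e⟩ := h.gen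
    cases hc with
    | U s => exact (BetaNormal.not_type (N := .type) hA (.inr (.inl rfl))
        (by simpa [instArgs] using e)).elim
    | El s => exact (BetaNormal.not_type (N := .type) hA (.inr (.inl rfl))
        (by simpa [instArgs] using e)).elim
    | u r =>
      cases hMs
      simp only [instArgs, sub_Ucon] at e
      exact ⟨.sort _, .u _, Interp.cast (.sort hΔ.wf r) (.inl ⟨_, rfl, .symm _ _ e⟩) hA, .refl _⟩
    | @Prod s₁ s₂ s₃ r =>
      obtain ⟨X, Y, rfl, hX, hY⟩ := hMs.prod_inv
      simp only [instArgs, sub_Ucon] at e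
      obtain ⟨D, Y, C, rfl, hY, eD, eC⟩ := (hN.const_arg (M := Y) (by simp)).lam_of_pi hΔ hY
      obtain ⟨a, i₁, ha, k₁⟩ := conservativity X (A := .sort s₁) (hN.const_arg (by simp)) hΔ hX
        (.inl ⟨_, rfl, .refl _⟩)
      have eD' := EqvGen.trans _ _ _ eD (Conv.El (.symm _ _ k₁.conv))
      obtain ⟨b, i₂, hb, k₂⟩ := conservativity Y (A := .sort s₂)
        (hN.const_arg (M := .lam D Y) (by simp)).lam_body (.cons hΔ ha eD') hY (.inl ⟨_, rfl, eC⟩)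
      exact ⟨.pi s₁ s₂ a b, .prod i₁ i₂,
        Interp.cast (.pi r ha hb) (.inl ⟨_, rfl, .symm _ _ e⟩) hA,
        HConv.const (.cons k₁ (.cons (.lam (.symm _ _ eD') k₂) .nil)) []⟩
    | @abs s₁ s₂ s₃ r =>
      obtain ⟨X, Y, Z, rfl, hX, hY, hZ⟩ := hMs.abs_inv
      obtain ⟨D, Y, C, rfl, hY, eD, eC⟩ := (hN.const_arg (M := Y) (by simp)).lam_of_pi hΔ hY
      obtain ⟨D₁, Z, C₁, rfl, hZ, eD₁, eC₁⟩ := (hN.const_arg (M := Z) (by simp)).lam_of_pi hΔ hZ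
      obtain ⟨a, i₁, ha, k₁⟩ := conservativity X (A := .sort s₁) (hN.const_arg (by simp)) hΔ hX
        (.inl ⟨_, rfl, .refl _⟩)
      have eD' := EqvGen.trans _ _ _ eD (Conv.El (.symm _ _ k₁.conv))
      have eD₁' := EqvGen.trans _ _ _ eD₁ (Conv.El (.symm _ _ k₁.conv))
      obtain ⟨b, i₂, hb, k₂⟩ := conservativity Y (A := .sort s₂)
        (hN.const_arg (M := .lam D Y) (by simp)).lam_body (.cons hΔ ha eD') hY (.inl ⟨_, rfl, eC⟩)
      have eC₁' : Conv (rulesEPTS Ar Rr) C₁ (Elcon s₂ (trans b)) :=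
        .trans _ _ _ eC₁ (Conv.El (.trans _ _ _ (Conv.eta_expand _ _) (.symm _ _ k₂.conv)))
      obtain ⟨m, i₃, hm, k₃⟩ := conservativity Z (A := b)
        (hN.const_arg (M := .lam D₁ Z) (by simp)).lam_body (.cons hΔ ha eD₁') hZ
        (.inr ⟨_, hb, eC₁'⟩)
      refine ⟨.lam s₁ s₂ a b m, .abs i₁ i₂ i₃, Interp.cast (.lam r ha hb hm)
        (.inr ⟨_, .pi r ha hb, .trans _ _ _ (.symm _ _ e) ?_⟩) hA,
        HConv.const (.cons k₁ (.cons (.lam (.symm _ _ eD') k₂)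
          (.cons (.lam (.symm _ _ eD₁') k₃) .nil))) []⟩
      simp only [instArgs, sub_Elcon, sub_ProdC, Tm.sub_var]
      exact Conv.El (.symm _ _ (Conv.ProdC k₁.conv (Conv.lam (.symm _ _ eD') k₂.conv)))
    | @app s₁ s₂ s₃ r =>
      obtain ⟨X, Y, Z, W, rfl, hX, hY, hZ, hW⟩ := hMs.app_inv
      obtain ⟨D, Y, C, rfl, hY, eD, eC⟩ := (hN.const_arg (M := Y) (by simp)).lam_of_pi hΔ hY
      obtain ⟨a, i₁, ha, k₁⟩ := conservativity X (A := .sort s₁) (hN.const_arg (by simp)) hΔ hX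
        (.inl ⟨_, rfl, .refl _⟩)
      have eD' := EqvGen.trans _ _ _ eD (Conv.El (.symm _ _ k₁.conv))
      obtain ⟨b, i₂, hb, k₂⟩ := conservativity Y (A := .sort s₂)
        (hN.const_arg (M := .lam D Y) (by simp)).lam_body (.cons hΔ ha eD') hY (.inl ⟨_, rfl, eC⟩)
      obtain ⟨m, i₃, hm, k₃⟩ := conservativity Z (A := .pi s₁ s₂ a b) (hN.const_arg (by simp)) hΔ
        hZ (.inr ⟨_, .pi r ha hb,
          Conv.El (.symm _ _ (Conv.ProdC k₁.conv (Conv.lam (.symm _ _ eD') k₂.conv)))⟩)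
      obtain ⟨n, i₄, hn, k₄⟩ := conservativity W (A := a) (hN.const_arg (by simp)) hΔ
        hW (.inr ⟨_, ha, Conv.El (.symm _ _ k₁.conv)⟩)
      refine ⟨.app s₁ s₂ a b m n, .app i₁ i₂ i₃ i₄, Interp.cast (.app r ha hb hn hm)
        (.inr ⟨_, hb.substAt hn, .trans _ _ _ (.symm _ _ e) ?_⟩) hA,
        HConv.const (.cons k₁ (.cons (.lam (.symm _ _ eD') k₂)
          (.cons k₃ (.cons k₄ .nil)))) []⟩
      simp only [instArgs, sub_Elcon, ← trans_substAt]
      refine Conv.El (.trans _ (.app (.lam D Y) W) _ (by simp; exact .refl _) ?_)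
      refine .trans _ _ _ (Conv.beta _ _ _) ?_
      exact Conv.substAt (.symm _ _ k₂.conv) (.symm _ _ k₄.conv)
termination_by sizeOf N
decreasing_by
  all_goals subst_vars; simp; try omega

end Conservativity

/-! ## The translation yields β-normal forms and is injective up to hidden conversion -/

section Injectivity

theorem Beta.const_inv {C : Type} {c : C} {Ms : List (Tm C)} {N : Tm C}
    (h : Beta (.const c Ms) N) : ∃ M ∈ Ms, ∃ M', Beta M M' := by
  generalize hX : Tm.const c Ms = X at h
  cases h with
  | base h => obtain ⟨_, _, _, rfl, _⟩ := h; cases hX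
  | constArg h => cases hX; exact ⟨_, by simp, _, h⟩
  | _ => cases hX

theorem BetaNormal.const {C : Type} {c : C} {Ms : List (Tm C)} (h : ∀ M ∈ Ms, BetaNormal M) :
    BetaNormal (.const c Ms) := fun _ hN => by
  obtain ⟨M, hM, M', h'⟩ := Beta.const_inv hN
  exact h M hM M' h'

theorem BetaNormal.lam {C : Type} {A M : Tm C} (hA : BetaNormal A) (hM : BetaNormal M) :
    BetaNormal (.lam A M) := fun N h => by
  generalize hX : Tm.lam A M = X at h
  cases h with
  | base h => obtain ⟨_, _, _, rfl, _⟩ := h; cases hX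
  | lamA h => cases hX; exact hA _ h
  | lamM h => cases hX; exact hM _ h
  | _ => cases hX

theorem BetaNormal.var {C : Type} (n : Nat) : BetaNormal (.var n : Tm C) := fun N h => by
  generalize hX : (.var n : Tm C) = X at h
  cases h with
  | base h => obtain ⟨_, _, _, rfl, _⟩ := h; cases hX
  | _ => cases hX

theorem betaNormal_trans (M : ETm S) : BetaNormal (trans M) := by
  have hEl : ∀ (s : S) (A : Tm (EConst S)), BetaNormal A → BetaNormal (Elcon s A) :=
    fun s A h => .const (by simpa using h)
  induction M with
  | var n => exact .var n
  | sort s => exact .const (by simp)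
  | pi s₁ s₂ A B hA hB =>
    refine .const ?_
    simp only [List.forall_mem_cons]
    exact ⟨hA, .lam (hEl _ _ hA) hB, by simp⟩
  | lam s₁ s₂ A B M hA hB hM =>
    refine .const ?_
    simp only [List.forall_mem_cons]
    exact ⟨hA, .lam (hEl _ _ hA) hB, .lam (hEl _ _ hA) hM, by simp⟩
  | app s₁ s₂ A B M N hA hB hM hN =>
    refine .const ?_
    simp only [List.forall_mem_cons]
    exact ⟨hA, .lam (hEl _ _ hA) hB, hM, hN, by simp⟩

/-- Equality of terms up to the annotations of abstractions. -/
inductive AnnEq : Tm (EConst S) → Tm (EConst S) → Prop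
  | var (n) : AnnEq (.var n) (.var n)
  | const {c Ms Ns} : List.Forall₂ AnnEq Ms Ns → AnnEq (.const c Ms) (.const c Ns)
  | type : AnnEq .type .type
  | kind : AnnEq .kind .kind
  | app {M M' N N'} : AnnEq M M' → AnnEq N N' → AnnEq (.app M N) (.app M' N')
  | lam {A A' M M'} : AnnEq M M' → AnnEq (.lam A M) (.lam A' M')
  | pi {A A' B B'} : AnnEq A A' → AnnEq B B' → AnnEq (.pi A B) (.pi A' B')

theorem AnnEq.refl (M : Tm (EConst S)) : AnnEq M M := by
  induction M using Tm.ind with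
  | var n => exact .var n
  | const c Ms ih => exact .const (List.forall₂_same.2 ih)
  | type => exact .type
  | kind => exact .kind
  | app M N hM hN => exact .app hM hN
  | lam A M _ hM => exact .lam hM
  | pi A B hA hB => exact .pi hA hB

theorem HStep.annEq {R : Rules (EConst S)} {M N : Tm (EConst S)} (h : HStep R M N) :
    AnnEq M N ∧ AnnEq N M := by
  induction h with
  | base h => obtain ⟨_, _, P, _, rfl, rfl⟩ := h; exact ⟨.lam (.refl P), .lam (.refl P)⟩
  | appL _ ih => exact ⟨.app ih.1 (.refl _), .app ih.2 (.refl _)⟩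
  | appR _ ih => exact ⟨.app (.refl _) ih.1, .app (.refl _) ih.2⟩
  | lamA => exact ⟨.lam (.refl _), .lam (.refl _)⟩
  | lamM _ ih => exact ⟨.lam ih.1, .lam ih.2⟩
  | piA _ ih => exact ⟨.pi ih.1 (.refl _), .pi ih.2 (.refl _)⟩
  | piB _ ih => exact ⟨.pi (.refl _) ih.1, .pi (.refl _) ih.2⟩
  | constArg _ ih =>
    have hr : ∀ l : List (Tm (EConst S)), List.Forall₂ AnnEq l l :=
      fun l => List.forall₂_same.2 fun M _ => .refl M
    exact ⟨.const (List.rel_append (hr _) (.cons ih.1 (hr _))),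
      .const (List.rel_append (hr _) (.cons ih.2 (hr _)))⟩

theorem InvGraph.annEq {N N' : Tm (EConst S)} {M : ETm S} (h : InvGraph N M)
    (e : AnnEq N N') : InvGraph N' M := by
  induction h generalizing N' with
  | var n => cases e; exact .var n
  | u s => cases e with | const h => cases h; exact .u s
  | abs _ _ _ hA hB hM =>
    cases e with | const h =>
    cases h with | cons e₁ h =>
    cases h with | cons e₂ h =>
    cases h with | cons e₃ h =>
    cases h
    cases e₂ with | lam e₂ =>
    cases e₃ with | lam e₃ =>
    exact .abs (hA e₁) (hB e₂) (hM e₃)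
  | beta _ _ hM hN =>
    cases e with | app e₁ e₂ =>
    cases e₁ with | lam e₁ =>
    exact .beta (hM e₁) (hN e₂)
  | prod _ _ hA hB =>
    cases e with | const h =>
    cases h with | cons e₁ h =>
    cases h with | cons e₂ h =>
    cases h
    cases e₂ with | lam e₂ =>
    exact .prod (hA e₁) (hB e₂)
  | app _ _ _ _ hA hB hM hN =>
    cases e with | const h =>
    cases h with | cons e₁ h =>
    cases h with | cons e₂ h =>
    cases h with | cons e₃ h =>
    cases h with | cons e₄ h =>
    cases h
    cases e₂ with | lam e₂ =>
    exact .app (hA e₁) (hB e₂) (hM e₃) (hN e₄)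

theorem InvGraph.hconv_iff {R : Rules (EConst S)} {N N' : Tm (EConst S)} {M : ETm S}
    (h : HConv R N N') : InvGraph N M ↔ InvGraph N' M := by
  induction h with
  | rel _ _ h => exact ⟨fun g => g.annEq h.annEq.1, fun g => g.annEq h.annEq.2⟩
  | refl => rfl
  | symm _ _ _ ih => exact ih.symm
  | trans _ _ _ _ _ ih ih' => exact ih.trans ih'

theorem eq_of_hconv_trans {R : Rules (EConst S)} {M N : ETm S}
    (h : HConv R (trans M) (trans N)) : M = N :=
  ((InvGraph.hconv_iff h).1 (InvGraph.trans M)).eq_of_trans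

end Injectivity

/-! ## Simple types of Dedukti types and kinds -/

section SimpleTyping

/-- The simple type of a type family of the encoding. -/
inductive Fam : Tm (EConst S) → STy → Prop
  | U {s Ms} : Fam (.const (.U s) Ms) .star
  | El {s Ms} : Fam (.const (.El s) Ms) .star
  | app {M N σ} : Fam M σ → Fam (.app M N) σ
  | lam {A M σ} : Fam M σ → Fam (.lam A M) σ
  | pi {A B σ τ} : Fam A σ → Fam B τ → Fam (.pi A B) (.arr σ τ)

/-- The simple type of a kind. -/
inductive Knd : Tm (EConst S) → STy → Prop
  | type : Knd .type .star
  | pi {A K σ τ} : Fam A σ → Knd K τ → Knd (.pi A K) (.arr σ τ)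

variable {M N A B : Tm (EConst S)} {σ τ : STy}

theorem Fam.unique (h : Fam M σ) (h' : Fam M τ) : σ = τ := by
  induction h generalizing τ with
  | U => cases h'; rfl
  | El => cases h'; rfl
  | app _ ih => cases h' with | app h' => exact ih h'
  | lam _ ih => cases h' with | lam h' => exact ih h'
  | pi _ _ ih ih' => cases h' with | pi h₁ h₂ => rw [ih h₁, ih' h₂]

theorem Knd.unique (h : Knd M σ) (h' : Knd M τ) : σ = τ := by
  induction h generalizing τ with
  | type => cases h'; rfl
  | pi h _ ih => cases h' with | pi h₁ h₂ => rw [h.unique h₁, ih h₂]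

theorem Fam.not_knd (h : Fam M σ) (h' : Knd M τ) : False := by
  induction h' generalizing σ with
  | type => cases h
  | pi _ _ ih => cases h with | pi _ h => exact ih h

theorem Fam.sub (h : Fam M σ) (θ : Nat → Tm (EConst S)) : Fam (Tm.sub θ M) σ := by
  induction h generalizing θ with
  | U => simpa using .U
  | El => simpa using .El
  | app _ ih => simpa using .app (ih θ)
  | lam _ ih => simpa using .lam (ih _)
  | pi _ _ ih ih' => simpa using .pi (ih θ) (ih' _)

theorem Knd.sub (h : Knd M σ) (θ : Nat → Tm (EConst S)) : Knd (Tm.sub θ M) σ := by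
  induction h generalizing θ with
  | type => simpa using .type
  | pi h _ ih => simpa using .pi (h.sub θ) (ih _)

theorem Fam.par (h : Par Ar Rr M N) (hM : Fam M σ) : Fam N σ := by
  induction h generalizing σ with
  | const => cases hM with | U => exact .U | El => exact .El
  | app _ _ ih => cases hM with | app h => exact .app (ih h)
  | lam _ _ _ ih => cases hM with | lam h => exact .lam (ih h)
  | pi _ _ ih ih' => cases hM with | pi h h' => exact .pi (ih h) (ih' h')
  | beta _ _ ih =>
    cases hM with | app h =>
    cases h with | lam h => exact (ih h).sub _
  | elU => cases hM; exact .U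
  | _ => cases hM

theorem Knd.par (h : Par Ar Rr M N) (hM : Knd M σ) : Knd N σ := by
  induction hM generalizing N with
  | type => cases h; exact .type
  | pi hA _ ih => cases h with | pi h h' => exact .pi (hA.par h) (ih h')

theorem Fam.star (h : ReflTransGen (Par Ar Rr) M N) (hM : Fam M σ) : Fam N σ := by
  induction h with
  | refl => exact hM
  | tail _ h ih => exact ih.par h

theorem Knd.star (h : ReflTransGen (Par Ar Rr) M N) (hM : Knd M σ) : Knd N σ := by
  induction h with
  | refl => exact hM
  | tail _ h ih => exact ih.par h

theorem Fam.conv_unique (e : Conv (rulesEPTS Ar Rr) M N) (hM : Fam M σ) (hN : Fam N τ) :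
    σ = τ := by
  obtain ⟨Z, h, h'⟩ := e.join
  exact (hM.star h).unique (hN.star h')

theorem Knd.conv_unique (e : Conv (rulesEPTS Ar Rr) M N) (hM : Knd M σ) (hN : Knd N τ) :
    σ = τ := by
  obtain ⟨Z, h, h'⟩ := e.join
  exact (hM.star h).unique (hN.star h')

theorem Fam.not_conv_knd (e : Conv (rulesEPTS Ar Rr) M N) (hM : Fam M σ) (hN : Knd N τ) :
    False := by
  obtain ⟨Z, h, h'⟩ := e.join
  exact (hM.star h).not_knd (hN.star h')

theorem not_kind_conv (e : Conv (rulesEPTS Ar Rr) .kind N) (hN : Fam N σ ∨ Knd N σ) : False := by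
  obtain ⟨Z, h, hNZ⟩ := e.join
  have hZ : Z = .kind := by
    clear hNZ
    induction h with
    | refl => rfl
    | tail _ h ih => subst ih; cases h; rfl
  subst hZ
  rcases hN with hN | hN
  · cases hN.star hNZ
  · cases hN.star hNZ

/-- The simple types of the arguments of a constant. -/
def constArity : EConst S → List STy
  | .U _ => []
  | .El _ => [.star]
  | .u _ => []
  | .Prod _ _ => [.star, .arr .star .star]
  | .abs _ _ => [.star, .arr .star .star, .arr .star .star]
  | .app _ _ => [.star, .arr .star .star, .star, .star]

/-- Simple typing of Dedukti terms of the encoding. -/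
inductive SimplyTyped : List STy → Tm (EConst S) → STy → Prop
  | var {Γ n σ} : Γ[n]? = some σ → SimplyTyped Γ (.var n) σ
  | const {Γ c Ms} : Ms.length = (constArity c).length →
      (∀ M σ, (M, σ) ∈ Ms.zip (constArity c) → SimplyTyped Γ M σ) →
      SimplyTyped Γ (.const c Ms) .star
  | app {Γ M N σ τ} : SimplyTyped Γ M (.arr σ τ) → SimplyTyped Γ N σ →
      SimplyTyped Γ (.app M N) τ
  | lam {Γ A M σ τ} : SimplyTyped Γ A .star → SimplyTyped (σ :: Γ) M τ →
      SimplyTyped Γ (.lam A M) (.arr σ τ)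
  | pi {Γ A B σ} : SimplyTyped Γ A .star → SimplyTyped (σ :: Γ) B .star →
      SimplyTyped Γ (.pi A B) .star

/-- The stratification of a Dedukti judgment, with the simple type of its subject. -/
def Stratified (Γ : List STy) (M A : Tm (EConst S)) : Prop :=
  (A = .kind ∧ ∃ σ, Knd M σ) ∨ (∃ σ, Knd A σ ∧ (∃ τ, Fam M τ) ∧ SimplyTyped Γ M σ) ∨
    ∃ σ, Fam A σ ∧ SimplyTyped Γ M σ

theorem Stratified.fam {Γ : List STy} (h : Stratified Γ M .type) :
    (∃ σ, Fam M σ) ∧ SimplyTyped Γ M .star := by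
  rcases h with ⟨h, _⟩ | ⟨σ, h, h', hM⟩ | ⟨σ, h, _⟩
  · cases h
  · cases h; exact ⟨h', hM⟩
  · cases h

theorem Stratified.fam_or_knd {Γ : List STy} {s : Tm (EConst S)} (h : Stratified Γ M s)
    (hs : IsDKSort s) : ∃ σ, Fam M σ ∨ Knd M σ := by
  rcases hs with rfl | rfl
  · obtain ⟨⟨σ, h⟩, _⟩ := h.fam
    exact ⟨σ, .inl h⟩
  · rcases h with ⟨_, σ, h⟩ | ⟨σ, h, _⟩ | ⟨σ, h, _⟩
    · exact ⟨σ, .inr h⟩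
    · cases h
    · cases h

theorem forall₂_fam_instTele {Δ : List (Tm (EConst S))} {Δ' : List STy}
    (h : List.Forall₂ Fam Δ Δ') : List.Forall₂ Fam (instTele M Δ) Δ' := by
  rw [List.forall₂_iff_get] at h ⊢
  refine ⟨by simpa [instTele] using h.1, fun i h₁ h₂ => ?_⟩
  have := h.2 i (by simpa [instTele] using h₁) h₂
  simpa [instTele, Tm.substAt] using this.sub _

theorem forall₂_fam_sig {c : EConst S} {Δ : List (Tm (EConst S))}
    (h : (c, Δ, A) ∈ sigEPTS Ar Rr) :
    List.Forall₂ Fam Δ (constArity c) ∧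
      (Fam A .star ∨ Knd A .star ∧ ∀ Ms, Fam (.const c Ms) .star) := by
  cases h with
  | U => exact ⟨.nil, .inr ⟨.type, fun _ => .U⟩⟩
  | El => exact ⟨.cons .U .nil, .inr ⟨.type, fun _ => .El⟩⟩
  | u => exact ⟨.nil, .inl .U⟩
  | Prod => exact ⟨.cons .U (.cons (.pi .El .U) .nil), .inl .U⟩
  | abs => exact ⟨.cons .U (.cons (.pi .El .U) (.cons (.pi .El .El) .nil)), .inl .El⟩
  | app => exact ⟨.cons .U (.cons (.pi .El .U) (.cons .El (.cons .El .nil))), .inl .El⟩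

theorem DTyped.stratified {Γ : List (Tm (EConst S))} (h : DTyped Ar Rr Γ M A) :
    ∀ Γ', List.Forall₂ Fam Γ Γ' → Stratified Γ' M A := by
  refine Typed.rec (S := sigEPTS Ar Rr) (R := rulesEPTS Ar Rr) (motive_1 := fun _ _ => True)
    (motive_2 := fun Γ M A _ => ∀ Γ', List.Forall₂ Fam Γ Γ' → Stratified Γ' M A)
    (motive_3 := fun Γ Ms Δ _ => ∀ Γ', List.Forall₂ Fam Γ Γ' → ∀ Δ', List.Forall₂ Fam Δ Δ' →
      List.Forall₂ (SimplyTyped Γ') Ms Δ')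
    trivial (fun _ _ => trivial) (fun _ _ _ _ => .inl ⟨rfl, _, .type⟩) ?var ?cons ?conv ?prod
    ?abs ?app ?nil ?argsCons h
  case var =>
    intro Γ n A _ hA _ Γ' hΓ
    obtain ⟨hn, rfl⟩ := List.getElem?_eq_some_iff.1 hA
    have hn' : n < Γ'.length := hΓ.length_eq ▸ hn
    have := (List.forall₂_iff_get.1 hΓ).2 n hn hn'
    refine .inr (.inr ⟨Γ'[n], ?_, .var (List.getElem?_eq_getElem hn')⟩)
    rw [Tm.ren_eq_sub]
    exact this.sub _
  case cons =>
    intro Γ c Δ A s Ms hc _ _ _ _ ih Γ' hΓ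
    obtain ⟨hΔ, hA⟩ := forall₂_fam_sig hc
    have hMs := ih Γ' hΓ _ hΔ
    have hM : SimplyTyped Γ' (.const c Ms) .star :=
      .const hMs.length_eq fun M σ hm => (List.forall₂_iff_zip.1 hMs).2 hm
    rcases hA with hA | ⟨hA, hF⟩
    · exact .inr (.inr ⟨_, hA.sub _, hM⟩)
    · exact .inr (.inl ⟨_, hA.sub _, ⟨_, hF Ms⟩, hM⟩)
  case conv =>
    intro Γ M A B s _ _ hs e ihM ihB Γ' hΓ
    obtain ⟨σ, hB⟩ := (ihB Γ' hΓ).fam_or_knd hs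
    rcases ihM Γ' hΓ with ⟨rfl, _⟩ | ⟨τ, hA, hF, hM⟩ | ⟨τ, hA, hM⟩
    · exact (not_kind_conv e hB).elim
    · rcases hB with hB | hB
      · exact (hB.not_conv_knd (.symm _ _ e) hA).elim
      · cases hA.conv_unique e hB
        exact .inr (.inl ⟨_, hB, hF, hM⟩)
    · rcases hB with hB | hB
      · cases hA.conv_unique e hB
        exact .inr (.inr ⟨_, hB, hM⟩)
      · exact (hA.not_conv_knd e hB).elim
  case prod =>
    intro Γ A B s _ _ hs ihA ihB Γ' hΓ
    obtain ⟨⟨σ, hA⟩, hA'⟩ := (ihA Γ' hΓ).fam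
    have hB := ihB (σ :: Γ') (.cons hA hΓ)
    rcases hs with rfl | rfl
    · obtain ⟨⟨τ, hB⟩, hB'⟩ := hB.fam
      exact .inr (.inl ⟨_, .type, ⟨_, .pi hA hB⟩, .pi hA' hB'⟩)
    · rcases hB with ⟨_, τ, hB⟩ | ⟨τ, hB, _⟩ | ⟨τ, hB, _⟩
      · exact .inl ⟨rfl, _, .pi hA hB⟩
      · cases hB
      · cases hB
  case abs =>
    intro Γ A B s M _ _ hs _ ihA ihB ihM Γ' hΓ
    obtain ⟨⟨σ, hA⟩, hA'⟩ := (ihA Γ' hΓ).fam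
    obtain ⟨τ, hB⟩ := (ihB (σ :: Γ') (.cons hA hΓ)).fam_or_knd hs
    rcases ihM (σ :: Γ') (.cons hA hΓ) with ⟨rfl, _⟩ | ⟨τ', hB', ⟨_, hF⟩, hM⟩ | ⟨τ', hB', hM⟩
    · exact (not_kind_conv (Ar := Ar) (Rr := Rr) (.refl _) hB).elim
    · exact .inr (.inl ⟨_, .pi hA hB', ⟨_, .lam hF⟩, .lam hA' hM⟩)
    · exact .inr (.inr ⟨_, .pi hA hB', .lam hA' hM⟩)
  case app =>
    intro Γ M N A B _ _ ihM ihN Γ' hΓ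
    have hN : ∀ σ, Fam A σ → SimplyTyped Γ' N σ := by
      intro σ hA
      rcases ihN Γ' hΓ with ⟨rfl, _⟩ | ⟨τ, hA', _⟩ | ⟨τ, hA', hN⟩
      · cases hA
      · exact (hA.not_knd hA').elim
      · cases hA.unique hA'; exact hN
    rcases ihM Γ' hΓ with ⟨h, _⟩ | ⟨τ, h, ⟨_, hF⟩, hM⟩ | ⟨τ, h, hM⟩
    · cases h
    · cases h with | pi hA hB =>
      exact .inr (.inl ⟨_, hB.sub _, ⟨_, .app hF⟩, .app hM (hN _ hA)⟩)
    · cases h with | pi hA hB =>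
      exact .inr (.inr ⟨_, hB.sub _, .app hM (hN _ hA)⟩)
  case nil =>
    intro Γ Γ' _ Δ' h
    cases h
    exact .nil
  case argsCons =>
    intro Γ M Ms A Δ _ _ ihM ihMs Γ' hΓ Δ' hΔ
    cases hΔ with | cons hA hΔ =>
    refine .cons ?_ (ihMs Γ' hΓ _ (forall₂_fam_instTele hΔ))
    rcases ihM Γ' hΓ with ⟨rfl, _⟩ | ⟨τ, hA', _⟩ | ⟨τ, hA', hM⟩
    · cases hA
    · exact (hA.not_knd hA').elim
    · cases hA.unique hA'; exact hM

theorem TransCtx.forall₂_fam {Γ : List (ETm S)} {Δ : List (Tm (EConst S))}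
    (h : TransCtx Ar Rr Γ Δ) : ∃ Δ', List.Forall₂ Fam Δ Δ' := by
  induction h with
  | nil => exact ⟨[], .nil⟩
  | cons _ _ ih =>
    obtain ⟨Δ', ih⟩ := ih
    exact ⟨_, .cons .El ih⟩

end SimpleTyping

/-! ## Weak normalization of β-reduction -/

section Normalization

section Renaming

variable {C : Type} {M N : Tm C}

theorem BetaNormal.app {M N : Tm C} (hM : BetaNormal M) (hN : BetaNormal N)
    (h : ∀ A P, M ≠ .lam A P) : BetaNormal (.app M N) := fun X hX => by
  generalize hY : Tm.app M N = Y at hX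
  cases hX with
  | base h' => obtain ⟨_, _, _, rfl, _⟩ := h'; cases hY; exact h _ _ rfl
  | appL h' => cases hY; exact hM _ h'
  | appR h' => cases hY; exact hN _ h'
  | _ => cases hY

theorem BetaNormal.pi {A B : Tm C} (hA : BetaNormal A) (hB : BetaNormal B) :
    BetaNormal (.pi A B) := fun X hX => by
  generalize hY : Tm.pi A B = Y at hX
  cases hX with
  | base h' => obtain ⟨_, _, _, rfl, _⟩ := h'; cases hY
  | piA h' => cases hY; exact hA _ h'
  | piB h' => cases hY; exact hB _ h'
  | _ => cases hY

theorem Tm.ren_ne_lam (h : ∀ A P, M ≠ .lam A P) (ρ : Nat → Nat) :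
    ∀ A P, Tm.ren ρ M ≠ .lam A P := by
  intro A P e
  cases M <;> simp at e
  exact h _ _ rfl

theorem Beta.ren (h : Beta M N) (ρ : Nat → Nat) : Beta (Tm.ren ρ M) (Tm.ren ρ N) := by
  induction h generalizing ρ with
  | base h =>
    obtain ⟨A, P, Q, rfl, rfl⟩ := h
    rw [Tm.ren_substAt]
    exact .base ⟨Tm.ren ρ A, Tm.ren (Tm.liftRen ρ) P, Tm.ren ρ Q, by simp, rfl⟩
  | appL _ ih => simpa [Beta] using Cong.appL (ih ρ)
  | appR _ ih => simpa [Beta] using Cong.appR (ih ρ)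
  | lamA _ ih => simpa [Beta] using Cong.lamA (ih ρ)
  | lamM _ ih => simpa [Beta] using Cong.lamM (ih _)
  | piA _ ih => simpa [Beta] using Cong.piA (ih ρ)
  | piB _ ih => simpa [Beta] using Cong.piB (ih _)
  | constArg _ ih => simpa [Beta] using Cong.constArg (ih ρ)

theorem Beta.star_ren (h : ReflTransGen Beta M N) (ρ : Nat → Nat) :
    ReflTransGen Beta (Tm.ren ρ M) (Tm.ren ρ N) :=
  h.lift _ fun _ _ h => h.ren ρ

theorem BetaNormal.ren (h : BetaNormal M) (ρ : Nat → Nat) : BetaNormal (Tm.ren ρ M) := by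
  induction M using Tm.ind generalizing ρ with
  | var n => simpa using BetaNormal.var _
  | const c Ms ih =>
    rw [Tm.ren_const]
    refine .const fun N hN => ?_
    obtain ⟨M, hM, rfl⟩ := List.mem_map.1 hN
    exact ih M hM (h.const_arg hM) ρ
  | type => simpa using h
  | kind => simpa using h
  | app M N ihM ihN =>
    rw [Tm.ren_app]
    exact .app (ihM h.app_fun ρ) (ihN (fun _ h' => h _ (.appR h')) ρ)
      (Tm.ren_ne_lam (fun _ _ => h.not_lam_app) ρ)
  | lam A M ihA ihM =>
    rw [Tm.ren_lam]
    exact .lam (ihA (fun _ h' => h _ (.lamA h')) ρ) (ihM h.lam_body _)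
  | pi A B ihA ihB =>
    rw [Tm.ren_pi]
    exact .pi (ihA (fun _ h' => h _ (.piA h')) ρ) (ihB (fun _ h' => h _ (.piB h')) _)

end Renaming

/-- `M` has a β-normal form. -/
def WN {C : Type} (M : Tm C) : Prop := ∃ M₀, ReflTransGen Beta M M₀ ∧ BetaNormal M₀

/-- `M` has a β-normal form which is not an abstraction. -/
def WNeutral {C : Type} (M : Tm C) : Prop :=
  ∃ M₀, ReflTransGen Beta M M₀ ∧ BetaNormal M₀ ∧ ∀ A P, M₀ ≠ .lam A P

/-- Reducibility at a simple type. -/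
def Red {C : Type} : STy → Tm C → Prop
  | .star, M => WN M
  | .arr σ τ, M => WN M ∧ ∀ (ρ : Nat → Nat) (N : Tm C), Red σ N → Red τ (.app (Tm.ren ρ M) N)

section Reducibility

variable {C : Type} {M N : Tm C} {σ : STy}

theorem WN.ren (h : WN M) (ρ : Nat → Nat) : WN (Tm.ren ρ M) := by
  obtain ⟨M₀, h, h'⟩ := h
  exact ⟨_, Beta.star_ren h ρ, h'.ren ρ⟩

theorem WN.lam (hM : WN M) (hN : WN N) : WN (.lam M N) := by
  obtain ⟨M₀, h, h'⟩ := hM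
  obtain ⟨N₀, k, k'⟩ := hN
  exact ⟨_, Cong.star_lam h k, .lam h' k'⟩

theorem WN.pi (hM : WN M) (hN : WN N) : WN (.pi M N) := by
  obtain ⟨M₀, h, h'⟩ := hM
  obtain ⟨N₀, k, k'⟩ := hN
  exact ⟨_, Cong.star_pi h k, .pi h' k'⟩

theorem WN.const {c : C} {Ms : List (Tm C)} (h : ∀ M ∈ Ms, WN M) : WN (.const c Ms) := by
  choose! f hf hf' using h
  refine ⟨.const c (Ms.map f), Cong.star_const (l := []) ?_, .const ?_⟩
  · rw [List.forall₂_map_right_iff]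
    exact List.forall₂_same.2 hf
  · simpa using hf'

theorem WNeutral.app (hM : WNeutral M) (hN : WN N) : WNeutral (.app M N) := by
  obtain ⟨M₀, h, h', hl⟩ := hM
  obtain ⟨N₀, k, k'⟩ := hN
  exact ⟨_, Cong.star_app h k, .app h' k' hl, by simp⟩

theorem WNeutral.ren (h : WNeutral M) (ρ : Nat → Nat) : WNeutral (Tm.ren ρ M) := by
  obtain ⟨M₀, h, h', hl⟩ := h
  exact ⟨_, Beta.star_ren h ρ, h'.ren ρ, Tm.ren_ne_lam hl ρ⟩

theorem Red.wn (h : Red σ M) : WN M := by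
  cases σ with
  | star => exact h
  | arr => exact h.1

theorem Red.ren (h : Red σ M) (ρ : Nat → Nat) : Red σ (Tm.ren ρ M) := by
  cases σ with
  | star => exact WN.ren h ρ
  | arr σ τ =>
    refine ⟨h.1.ren ρ, fun ρ' N hN => ?_⟩
    rw [Tm.ren_ren]
    exact h.2 _ N hN

theorem WNeutral.red (h : WNeutral M) : Red σ M := by
  induction σ generalizing M with
  | star => exact h.imp fun _ h => ⟨h.1, h.2.1⟩
  | arr σ τ _ ih =>
    exact ⟨h.imp fun _ h => ⟨h.1, h.2.1⟩, fun ρ N hN => ih ((h.ren ρ).app hN.wn)⟩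

theorem Red.var (n : Nat) : Red σ (.var n : Tm C) :=
  WNeutral.red ⟨_, .refl, .var n, by simp⟩

theorem Red.expand (h : Beta M N) (hN : Red σ N) : Red σ M := by
  have hWN : ∀ {M N : Tm C}, Beta M N → WN N → WN M := fun h ⟨N₀, h₁, h₂⟩ => ⟨N₀, .head h h₁, h₂⟩
  induction σ generalizing M N with
  | star => exact hWN h hN
  | arr σ τ _ ih =>
    exact ⟨hWN h hN.1, fun ρ P hP => ih (.appL (h.ren ρ)) (hN.2 ρ P hP)⟩

end Reducibility

theorem SimplyTyped.red {Γ : List STy} {M : Tm (EConst S)} {σ : STy} (h : SimplyTyped Γ M σ) :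
    ∀ θ : Nat → Tm (EConst S), (∀ n τ, Γ[n]? = some τ → Red τ (θ n)) → Red σ (Tm.sub θ M) := by
  have lift : ∀ {Γ : List STy} {θ : Nat → Tm (EConst S)} (σ : STy),
      (∀ n τ, Γ[n]? = some τ → Red τ (θ n)) →
      ∀ n τ, (σ :: Γ)[n]? = some τ → Red τ (Tm.liftSub θ n) := by
    intro Γ θ σ hθ n τ hn
    cases n with
    | zero => exact .var 0
    | succ n => exact (hθ n τ (by simpa using hn)).ren _
  induction h with
  | var h => intro θ hθ; simpa using hθ _ _ h
  | @const Γ c Ms hl _ ih =>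
    intro θ hθ
    rw [Tm.sub_const]
    refine WN.const fun N hN => ?_
    obtain ⟨M, hM, rfl⟩ := List.mem_map.1 hN
    obtain ⟨i, hi, rfl⟩ := List.getElem_of_mem hM
    have hz : (Ms[i], (constArity c)[i]) ∈ Ms.zip (constArity c) := by
      rw [← List.getElem_zip (h := by simp; omega)]
      exact List.getElem_mem _
    exact (ih _ _ hz θ hθ).wn
  | app _ _ ihM ihN =>
    intro θ hθ
    have := (ihM θ hθ).2 (fun n => n) _ (ihN θ hθ)
    rw [Tm.ren_id] at this
    simpa using this
  | @lam Γ A M σ τ _ _ ihA ihM =>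
    intro θ hθ
    rw [Tm.sub_lam]
    refine ⟨WN.lam (ihA θ hθ).wn (ihM _ (lift σ hθ)).wn, fun ρ N hN => ?_⟩
    refine Red.expand (.base ⟨_, _, _, by rw [Tm.ren_lam], rfl⟩) ?_
    rw [Tm.ren_sub, Tm.ren_comp_liftSub, Tm.substAt_liftSub]
    refine ihM _ fun n τ hn => ?_
    cases n with
    | zero => cases hn; exact hN
    | succ n => exact (hθ n τ (by simpa using hn)).ren ρ
  | @pi Γ A B σ _ _ ihA ihB =>
    intro θ hθ
    rw [Tm.sub_pi]
    exact WN.pi (ihA θ hθ).wn (ihB _ (lift σ hθ)).wn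

theorem SimplyTyped.wn {Γ : List STy} {M : Tm (EConst S)} {σ : STy} (h : SimplyTyped Γ M σ) :
    WN M := by
  have := (h.red .var fun _ _ _ => .var _).wn
  rwa [Tm.sub_id] at this

theorem DTyped.wn {Γ : List (ETm S)} {Δ : List (Tm (EConst S))} {M T : Tm (EConst S)}
    (hΔ : TransCtx Ar Rr Γ Δ) (h : DTyped Ar Rr Δ M T) (hT : T ≠ .kind) : WN M := by
  obtain ⟨Δ', hΔ'⟩ := hΔ.forall₂_fam
  rcases h.stratified Δ' hΔ' with ⟨rfl, _⟩ | ⟨_, _, _, h⟩ | ⟨_, _, h⟩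
  · exact (hT rfl).elim
  · exact h.wn
  · exact h.wn

end Normalization

end Adequacy

/-- Computational adequacy. -/
theorem computational_adequacy {S : Type} (Ar : S → S → Prop)
    (Rr : S → S → S → Prop) (hfun : FunctionalSpec Ar Rr)
    {Γ : List (ETm S)} {Δ : List (Tm (EConst S))} (hΓ : TransCtx Ar Rr Γ Δ)
    {A : ETm S} (hA : ETypeJ Ar Rr Γ A)
    {T : Tm (EConst S)}
    (hT : (∃ s, A = ETm.sort s ∧ IsTopSort Ar s ∧ T = Ucon s) ∨
          (∃ sA, ETyped Ar Rr Γ A (ETm.sort sA) ∧ T = Elcon sA (trans A))) :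
    -- a bijection between well-typed EPTS terms and β-normal well-typed Dedukti
    -- terms modulo `≡_H` ...
    Nonempty ({M : ETm S // ETyped Ar Rr Γ M A} ≃
      Quotient (Setoid.mk _ (hconv_equivalence Ar Rr Δ T))) ∧
    -- ... which is given by `⟦·⟧`:
    (∀ M : ETm S, ETyped Ar Rr Γ M A →
      BetaNormal (trans M) ∧ Typed (sigEPTS Ar Rr) (rulesEPTS Ar Rr) Δ (trans M) T) ∧
    (∀ M N : ETm S, ETyped Ar Rr Γ M A → ETyped Ar Rr Γ N A →
      HConv (rulesEPTS Ar Rr) (trans M) (trans N) → M = N) ∧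
    -- ... and by `|·|` in the other direction:
    (∀ N : Tm (EConst S), BetaNormal N → Typed (sigEPTS Ar Rr) (rulesEPTS Ar Rr) Δ N T →
      ∃ M, inv N = some M ∧ ETyped Ar Rr Γ M A ∧ HConv (rulesEPTS Ar Rr) (trans M) N) ∧
    -- compositionality:
    (∀ (M N : ETm S) (k : Nat),
      Tm.substAt k (trans N) (trans M) = trans (ETm.substAt k N M)) ∧
    -- computationality:
    (∀ M N : ETm S, Relation.ReflTransGen (EStep Rr) M N ↔
      Relation.ReflTransGen (Step (rulesEPTS Ar Rr)) (trans M) (trans N)) ∧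
    -- every well-typed Dedukti term of type `T` has a β-normal form:
    (∀ M : Tm (EConst S), Typed (sigEPTS Ar Rr) (rulesEPTS Ar Rr) Δ M T →
      ∃ M₀, Relation.ReflTransGen Beta M M₀ ∧ BetaNormal M₀) := by
  have hI : Interp Ar Rr Γ A T := by
    rcases hT with ⟨s, rfl, _, rfl⟩ | ⟨sA, hA, rfl⟩
    · exact .inl ⟨s, rfl, .refl _⟩
    · exact .inr ⟨sA, hA, .refl _⟩
  have htyped : ∀ M, ETyped Ar Rr Γ M A → DTyped Ar Rr Δ (trans M) T := by
    intro M hM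
    obtain ⟨T', hM', hI'⟩ := hM.trans hfun hΓ
    rcases hT with ⟨s, rfl, _, rfl⟩ | ⟨sA, hA, rfl⟩
    · exact hM'.conv (DTyped.U s) (.inl rfl) hI'.conv_U
    · exact hM'.conv (DTyped.El (hA.trans_sort hfun hΓ)) (.inl rfl) (hI'.conv hfun hA (.refl _))
  have hinv : ∀ N, BetaNormal N → DTyped Ar Rr Δ N T →
      ∃ M, inv N = some M ∧ ETyped Ar Rr Γ M A ∧ HConv (rulesEPTS Ar Rr) (trans M) N := by
    intro N hN h
    obtain ⟨M, hg, hM, e⟩ := conservativity N hN hΓ.ctxRel h hI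
    exact ⟨M, hg.inv_eq, hM, e⟩
  refine ⟨⟨Equiv.ofBijective
      (fun M => Quotient.mk _ ⟨trans M.1, betaNormal_trans M.1, htyped M.1 M.2⟩) ⟨?_, ?_⟩⟩,
    fun M hM => ⟨betaNormal_trans M, htyped M hM⟩, fun M N _ _ => eq_of_hconv_trans, hinv,
    trans_substAt, star_step_trans_iff, fun M hM => DTyped.wn hΓ hM ?_⟩
  · intro M N e
    exact Subtype.ext (eq_of_hconv_trans (Quotient.exact e))
  · intro q
    induction q using Quotient.inductionOn with | h N =>
    obtain ⟨M, _, hM, e⟩ := hinv N.1 N.2.1 N.2.2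
    exact ⟨⟨M, hM⟩, Quotient.sound e⟩
  · rcases hT with ⟨s, _, _, rfl⟩ | ⟨sA, _, rfl⟩
    · simp [Ucon]
    · simp [Elcon]

end DKPaper
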